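/- Let Ω ⊆ ℂ be a bounded open connected set with C^∞ smooth boundary. Then for every m ∈ ℕ and every δ > 0 there exists a function g, C^∞ on an open neighborhood of closure(Ω), holomorphic on Ω, injective on closure(Ω), and (m, δ)-close to the identity on closure(Ω), such that g(Ω) is a quadrature domain; in particular, Ω is biholomorphic (via g) to a quadrature domain that is C^∞ close to Ω. -/

import Mathlib

open MeasureTheory Complex ComplexConjugate Metric Set

noncomputable section

/-- `f` belongs to the Bergman space `A²(Ω)`. -/
def BergmanFun (Ω : Set ℂ) (f : ℂ → ℂ) : Prop :=
  DifferentiableOn ℂ f Ω ∧ IntegrableOn (fun z => ‖f z‖ ^ 2) Ω volume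

/-- `Ω` is a finitely connected domain none of whose complementary components is a point. -/
def IsFinConnDomain (Ω : Set ℂ) : Prop :=
  IsOpen Ω ∧ IsConnected Ω ∧
  {C : Set ℂ | ∃ x ∈ Ωᶜ, C = connectedComponentIn Ωᶜ x}.Finite ∧
  ∀ x ∈ Ωᶜ, ¬ (connectedComponentIn Ωᶜ x).Subsingleton

/-- `Ω` is a quadrature domain. -/
def IsQuadratureDomain (Ω : Set ℂ) : Prop :=
  ∃ N : ℕ, 0 < N ∧ ∃ (w : Fin N → ℂ) (n : Fin N → ℕ) (c : Fin N → ℕ → ℂ),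
    (∀ j, w j ∈ Ω) ∧
    ∀ f : ℂ → ℂ, BergmanFun Ω f →
      (∫ z in Ω, f z) =
        ∑ j, ∑ k ∈ Finset.range (n j + 1), c j k * iteratedDerivWithin k f Ω (w j)

/-- `fa` is an Ahlfors map of `Ω` at `a`. -/
def IsAhlforsMap (Ω : Set ℂ) (a : ℂ) (fa : ℂ → ℂ) : Prop :=
  DifferentiableOn ℂ fa Ω ∧ (∀ z ∈ Ω, ‖fa z‖ < 1) ∧
  (deriv fa a).im = 0 ∧ 0 < (deriv fa a).re ∧
  ∀ g : ℂ → ℂ, DifferentiableOn ℂ g Ω → (∀ z ∈ Ω, ‖g z‖ < 1) →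
    ‖deriv g a‖ ≤ (deriv fa a).re

/-- `Ω` is bounded with `C^∞` smooth boundary consisting of finitely many disjoint
simple closed curves. -/
def HasSmoothBoundary (Ω : Set ℂ) : Prop :=
  Bornology.IsBounded Ω ∧
  ∃ (n : ℕ) (γ : Fin n → ℝ → ℂ),
    (∀ i, ContDiff ℝ (⊤ : ℕ∞) (γ i)) ∧
    (∀ i, Function.Periodic (γ i) (2 * Real.pi)) ∧
    (∀ i, InjOn (γ i) (Ico 0 (2 * Real.pi))) ∧
    (∀ i t, deriv (γ i) t ≠ 0) ∧
    (Pairwise fun i j => Disjoint (range (γ i)) (range (γ j))) ∧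
    frontier Ω = ⋃ i, range (γ i)

/-- Partial derivative in the `x`-direction of a real-valued function on `ℂ`. -/
def pdx (u : ℂ → ℝ) (z : ℂ) : ℝ := deriv (fun t : ℝ => u (z + (t : ℂ))) 0

/-- Partial derivative in the `y`-direction of a real-valued function on `ℂ`. -/
def pdy (u : ℂ → ℝ) (z : ℂ) : ℝ := deriv (fun t : ℝ => u (z + (t : ℂ) * Complex.I)) 0

/-- `f` is a proper holomorphic map of `Ω` onto the open unit disc. -/
def IsProperOntoDisc (Ω : Set ℂ) (f : ℂ → ℂ) : Prop :=
  DifferentiableOn ℂ f Ω ∧ f '' Ω = ball (0 : ℂ) 1 ∧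
  ∀ L : Set ℂ, L ⊆ ball (0 : ℂ) 1 → IsCompact L → IsCompact (Ω ∩ f ⁻¹' L)

/-- `g` is `(m, δ)`-close to the identity on `closure Ω`. -/
def CloseToId (Ω : Set ℂ) (m : ℕ) (δ : ℝ) (g : ℂ → ℂ) : Prop :=
  ∀ k ≤ m, ∀ z ∈ closure Ω, ‖iteratedFDeriv ℝ k (fun w => g w - w) z‖ ≤ δ

/-- `σ : [0,1] → ℂ` is a piecewise continuously differentiable curve. -/
def PiecewiseC1On01 (σ : ℝ → ℂ) : Prop :=
  ContinuousOn σ (Icc 0 1) ∧ ∃ s : Finset ℝ, ContDiffOn ℝ 1 σ (Icc (0 : ℝ) 1 \ s)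

/-- `Ω` is a generalized quadrature domain. -/
def IsGenQuadratureDomain (Ω : Set ℂ) : Prop :=
  ∃ (N M : ℕ) (w : Fin N → ℂ) (n : Fin N → ℕ) (c : Fin N → ℕ → ℂ)
    (b : Fin M → ℂ) (σ : Fin M → ℝ → ℂ),
    (∀ j, w j ∈ Ω) ∧
    (∀ m, PiecewiseC1On01 (σ m)) ∧
    (∀ m, ∀ t ∈ Icc (0 : ℝ) 1, σ m t ∈ Ω) ∧
    ∀ f : ℂ → ℂ, BergmanFun Ω f →
      (∫ z in Ω, f z) =
        (∑ j, ∑ k ∈ Finset.range (n j + 1), c j k * iteratedDerivWithin k f Ω (w j)) +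
        ∑ m, b m * ∫ t in (0 : ℝ)..1, f (σ m t) * deriv (σ m) t

open scoped ContDiff

theorem hasFTaylorSeriesUpTo_integral {α E F : Type*} [MeasurableSpace α] {μ : Measure α}
    [NormedAddCommGroup E] [NormedSpace ℝ E] [NormedAddCommGroup F] [NormedSpace ℝ F]
    [CompleteSpace F] {Φ : α → E → F} {b : ℕ → α → ℝ}
    (hΦ : ∀ᵐ a ∂μ, ContDiff ℝ ∞ (Φ a))
    (hm : ∀ k x, AEStronglyMeasurable (fun a => iteratedFDeriv ℝ k (Φ a) x) μ)
    (hb : ∀ k, Integrable (b k) μ)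
    (hbd : ∀ k, ∀ᵐ a ∂μ, ∀ x, ‖iteratedFDeriv ℝ k (Φ a) x‖ ≤ b k a) :
    HasFTaylorSeriesUpTo ∞ (fun x => ∫ a, Φ a x ∂μ)
      (fun x k => ∫ a, iteratedFDeriv ℝ k (Φ a) x ∂μ) := by
  have hinteg : ∀ k x, Integrable (fun a => iteratedFDeriv ℝ k (Φ a) x) μ := fun k x =>
    (hb k).mono' (hm k x) ((hbd k).mono fun a h => h x)
  have hder : ∀ (k : ℕ) x, HasFDerivAt (fun x => ∫ a, iteratedFDeriv ℝ k (Φ a) x ∂μ)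
      (∫ a, iteratedFDeriv ℝ (k + 1) (Φ a) x ∂μ).curryLeft x := by
    intro k x
    have key : (∫ a, iteratedFDeriv ℝ (k + 1) (Φ a) x ∂μ).curryLeft
        = ∫ a, (iteratedFDeriv ℝ (k + 1) (Φ a) x).curryLeft ∂μ := by
      let L : (E [×(k + 1)]→L[ℝ] F) →L[ℝ] (E →L[ℝ] (E [×k]→L[ℝ] F)) :=
        (continuousMultilinearCurryLeftEquiv ℝ (fun _ : Fin (k + 1) => E)
          F).toContinuousLinearEquiv.toContinuousLinearMap
      exact (ContinuousLinearMap.integral_comp_comm (𝕜 := ℝ) (Fₗ := E →L[ℝ] (E [×k]→L[ℝ] F)) L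
        (hinteg (k + 1) x)).symm
    rw [key]
    refine hasFDerivAt_integral_of_dominated_of_fderiv_le (s := univ)
      (F' := fun x a => (iteratedFDeriv ℝ (k + 1) (Φ a) x).curryLeft)
      (bound := b (k + 1)) Filter.univ_mem
      (Filter.Eventually.of_forall fun x => hm k x) (hinteg k x) ?_ ?_ (hb _) ?_
    · exact (continuousMultilinearCurryLeftEquiv ℝ (fun _ : Fin (k + 1) => E)
        F).continuous.comp_aestronglyMeasurable (hm (k + 1) x)
    · filter_upwards [hbd (k + 1)] with a h x _
      simpa using h x
    · filter_upwards [hΦ] with a h x _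
      exact (h.ftaylorSeries).fderiv k (by exact_mod_cast WithTop.coe_lt_top _) x
  refine ⟨fun x => ?_, fun k _ x => hder k x, fun k _ => ?_⟩
  · rw [ContinuousMultilinearMap.curry0]
    simp only [ContinuousMultilinearMap.integral_apply (hinteg 0 x), iteratedFDeriv_zero_apply]
  · exact continuous_iff_continuousAt.2 fun x => (hder k x).continuousAt

theorem contDiff_integral_of_bounded {α E F : Type*} [MeasurableSpace α] {μ : Measure α}
    [NormedAddCommGroup E] [NormedSpace ℝ E] [NormedAddCommGroup F] [NormedSpace ℝ F]
    [CompleteSpace F] {Φ : α → E → F} {b : ℕ → α → ℝ}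
    (hΦ : ∀ᵐ a ∂μ, ContDiff ℝ ∞ (Φ a))
    (hm : ∀ k x, AEStronglyMeasurable (fun a => iteratedFDeriv ℝ k (Φ a) x) μ)
    (hb : ∀ k, Integrable (b k) μ)
    (hbd : ∀ k, ∀ᵐ a ∂μ, ∀ x, ‖iteratedFDeriv ℝ k (Φ a) x‖ ≤ b k a) :
    ContDiff ℝ ∞ (fun x => ∫ a, Φ a x ∂μ) :=
  (hasFTaylorSeriesUpTo_integral hΦ hm hb hbd).contDiff

theorem iteratedFDeriv_integral_of_bounded {α E F : Type*} [MeasurableSpace α] {μ : Measure α}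
    [NormedAddCommGroup E] [NormedSpace ℝ E] [NormedAddCommGroup F] [NormedSpace ℝ F]
    [CompleteSpace F] {Φ : α → E → F} {b : ℕ → α → ℝ}
    (hΦ : ∀ᵐ a ∂μ, ContDiff ℝ ∞ (Φ a))
    (hm : ∀ k x, AEStronglyMeasurable (fun a => iteratedFDeriv ℝ k (Φ a) x) μ)
    (hb : ∀ k, Integrable (b k) μ)
    (hbd : ∀ k, ∀ᵐ a ∂μ, ∀ x, ‖iteratedFDeriv ℝ k (Φ a) x‖ ≤ b k a) (k : ℕ) (x : E) :
    iteratedFDeriv ℝ k (fun x => ∫ a, Φ a x ∂μ) x = ∫ a, iteratedFDeriv ℝ k (Φ a) x ∂μ :=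
  ((hasFTaylorSeriesUpTo_integral hΦ hm hb hbd).eq_iteratedFDeriv
    (by exact_mod_cast le_top) x).symm

theorem norm_iteratedFDeriv_integral_le {α E F : Type*} [MeasurableSpace α] {μ : Measure α}
    [NormedAddCommGroup E] [NormedSpace ℝ E] [NormedAddCommGroup F] [NormedSpace ℝ F]
    [CompleteSpace F] {Φ : α → E → F} {b : ℕ → α → ℝ}
    (hΦ : ∀ᵐ a ∂μ, ContDiff ℝ ∞ (Φ a))
    (hm : ∀ k x, AEStronglyMeasurable (fun a => iteratedFDeriv ℝ k (Φ a) x) μ)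
    (hb : ∀ k, Integrable (b k) μ)
    (hbd : ∀ k, ∀ᵐ a ∂μ, ∀ x, ‖iteratedFDeriv ℝ k (Φ a) x‖ ≤ b k a) (k : ℕ) (x : E) :
    ‖iteratedFDeriv ℝ k (fun x => ∫ a, Φ a x ∂μ) x‖ ≤ ∫ a, b k a ∂μ := by
  rw [iteratedFDeriv_integral_of_bounded hΦ hm hb hbd]
  exact norm_integral_le_of_norm_le (hb k) ((hbd k).mono fun a h => h x)

/-- Twice the Cauchy–Riemann operator `∂/∂z̄`. -/
def dbar (χ : ℂ → ℂ) (z : ℂ) : ℂ := fderiv ℝ χ z 1 + I * fderiv ℝ χ z I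

theorem dbar_mul {f g : ℂ → ℂ} {z : ℂ} (hf : DifferentiableAt ℂ f z)
    (hg : DifferentiableAt ℝ g z) : dbar (fun z => f z * g z) z = f z * dbar g z := by
  have h1 : fderiv ℝ f z I = I * fderiv ℝ f z 1 := by
    rw [hf.fderiv_restrictScalars ℝ]
    simp
  have h2 : fderiv ℝ (fun z => f z * g z) z = f z • fderiv ℝ g z + g z • fderiv ℝ f z :=
    fderiv_fun_mul (hf.restrictScalars ℝ) hg
  simp only [dbar, h2, add_apply, smul_apply, smul_eq_mul,
    h1]
  linear_combination (g z * fderiv ℝ f z 1) * I_mul_I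

theorem integral_dbar_eq_zero {F : ℂ → ℂ} (hF : ContDiff ℝ 1 F) (hc : HasCompactSupport F) :
    ∫ z, dbar F z = 0 := by
  have hcont : ∀ v, Continuous fun z => fderiv ℝ F z v := fun v =>
    (hF.continuous_fderiv (by norm_num)).clm_apply continuous_const
  have hinteg : ∀ v, Integrable fun z => fderiv ℝ F z v := fun v =>
    (hcont v).integrable_of_hasCompactSupport (hc.fderiv_apply (𝕜 := ℝ) v)
  have h0 : ∀ v, ∫ z, fderiv ℝ F z v = 0 := by
    intro v
    have := integral_mul_fderiv_eq_neg_fderiv_mul_of_integrable (μ := (volume : Measure ℂ))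
      (f := fun _ : ℂ => (1 : ℂ)) (g := F) (v := v) (by simp) (by simpa using hinteg v)
      (by simpa using hF.continuous.integrable_of_hasCompactSupport hc) (by simp)
      (fun x _ => hF.differentiable (by norm_num) x)
    simpa using this
  simp only [dbar]
  rw [integral_add (hinteg 1) ((hinteg I).const_mul I), integral_const_mul, h0, h0]
  simp

theorem integral_mul_dbar_eq_zero_of_tsupport_subset {Ω : Set ℂ} (hΩ : IsOpen Ω) {h χ : ℂ → ℂ}
    (hh : DifferentiableOn ℂ h Ω) (hχ : ContDiff ℝ 1 χ) (hc : HasCompactSupport χ)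
    (hs : tsupport χ ⊆ Ω) : ∫ z, h z * dbar χ z = 0 := by
  have hz : ∀ z ∉ tsupport χ, (fun z => h z * χ z) =ᶠ[nhds z] fun _ => 0 := by
    intro z hz
    filter_upwards [(isClosed_tsupport χ).isOpen_compl.mem_nhds hz] with w hw
    rw [image_eq_zero_of_notMem_tsupport hw, mul_zero]
  have hF : ContDiff ℝ 1 (fun z => h z * χ z) := by
    rw [contDiff_iff_contDiffAt]
    intro z
    by_cases hzs : z ∈ tsupport χ
    · have : ContDiffAt ℂ 1 h z := ((hh.contDiffOn hΩ) z (hs hzs)).contDiffAt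
        (hΩ.mem_nhds (hs hzs))
      exact (this.restrict_scalars ℝ).mul hχ.contDiffAt
    · exact contDiffAt_const.congr_of_eventuallyEq (hz z hzs)
  rw [← integral_dbar_eq_zero hF hc.mul_left]
  congr 1
  ext z
  by_cases hzs : z ∈ tsupport χ
  · rw [dbar_mul (hh.differentiableAt (hΩ.mem_nhds (hs hzs)))
      (hχ.differentiable (by norm_num) z)]
  · have h1 : χ =ᶠ[nhds z] fun _ => 0 := by
      filter_upwards [(isClosed_tsupport χ).isOpen_compl.mem_nhds hzs] with w hw
      exact image_eq_zero_of_notMem_tsupport hw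
    simp [dbar, h1.fderiv_eq, (hz z hzs).fderiv_eq]

theorem integral_mul_dbar_eq_zero_of_frontier {Ω : Set ℂ} (hΩ : IsOpen Ω)
    (hb : Bornology.IsBounded Ω) {h χ : ℂ → ℂ} (hh : DifferentiableOn ℂ h Ω)
    (hi : IntegrableOn h Ω) (hχ : ContDiff ℝ 1 χ) (h0 : ∀ z ∈ frontier Ω, χ z = 0) :
    ∫ z in Ω, h z * dbar χ z = 0 := by
  obtain ⟨v, hvs, hvd, hvr⟩ := hΩ.exists_contDiff_support_eq (n := 1)
  let P : ℂ → ℂ × ℝ := fun z => (χ z, v z)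
  have hP : ContDiff ℝ 1 P := hχ.prodMk (by exact_mod_cast hvd)
  let β : ContDiffBump (0 : ℂ × ℝ) := ⟨1, 2, by norm_num, by norm_num⟩
  let Θ : ℂ × ℝ → ℂ := fun x => (1 - β x) • x.1
  have hΘ : ContDiff ℝ 1 Θ := (contDiff_const.sub β.contDiff).smul contDiff_fst
  have hΘ0 : ∀ x, ‖x‖ < 1 → Θ x = 0 := by
    intro x hx
    have : β x = 1 := β.one_of_mem_closedBall (by simpa using hx.le)
    simp [Θ, this]
  have hΘ1 : ∀ x, 2 < ‖x‖ → fderiv ℝ Θ x = ContinuousLinearMap.fst ℝ ℂ ℝ := by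
    intro x hx
    have : Θ =ᶠ[nhds x] Prod.fst := by
      filter_upwards [(isOpen_lt continuous_const continuous_norm).mem_nhds hx] with y hy
      have : β y = 0 := β.zero_of_le_dist (by simpa using (le_of_lt hy))
      simp [Θ, this]
    rw [this.fderiv_eq, fderiv_fst]
  obtain ⟨C, hC⟩ : ∃ C, ∀ x, ‖fderiv ℝ Θ x‖ ≤ C := by
    obtain ⟨C, hC⟩ := (isCompact_closedBall (0 : ℂ × ℝ) 2).exists_bound_of_continuousOn
      (hΘ.continuous_fderiv (by norm_num)).continuousOn
    refine ⟨max C ‖ContinuousLinearMap.fst ℝ ℂ ℝ‖, fun x => ?_⟩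
    by_cases hx : 2 < ‖x‖
    · rw [hΘ1 x hx]; exact le_max_right _ _
    · exact (hC x (by simpa using hx)).trans (le_max_left _ _)
  let ψ : ℕ → ℂ → ℂ := fun n z => ((n + 1 : ℝ)⁻¹) • Θ ((n + 1 : ℝ) • P z)
  have hψ : ∀ n, ContDiff ℝ 1 (ψ n) := fun n =>
    (hΘ.comp (hP.const_smul (n + 1 : ℝ))).const_smul ((n + 1 : ℝ)⁻¹)
  have hψd : ∀ n z, fderiv ℝ (ψ n) z =
      (fderiv ℝ Θ ((n + 1 : ℝ) • P z)).comp (fderiv ℝ P z) := by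
    intro n z
    have h1 : HasFDerivAt P (fderiv ℝ P z) z :=
      (hP.differentiable (by norm_num) z).hasFDerivAt
    have h2 := (hΘ.differentiable (by norm_num) ((n + 1 : ℝ) • P z)).hasFDerivAt
    have h3 := ((h2.comp z (h1.const_smul (n + 1 : ℝ))).const_smul ((n + 1 : ℝ)⁻¹)).fderiv
    refine h3.trans ?_
    have : (n + 1 : ℝ) ≠ 0 := by positivity
    ext
    simp [this]
  have hψ0 : ∀ n : ℕ, ∀ z, ‖(n + 1 : ℝ) • P z‖ < 1 → ψ n z = 0 := fun n z hz => by
    simp [ψ, hΘ0 _ hz]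
  have hcl : IsCompact (closure Ω) := hb.isCompact_closure
  have hzero : ∀ n, ∫ z in Ω, h z * dbar (ψ n) z = 0 := by
    intro n
    let K : Set ℂ := closure Ω ∩ {z | 1 ≤ ‖(n + 1 : ℝ) • P z‖}
    have hK : IsCompact K := hcl.inter_right
      (isClosed_le continuous_const (hP.continuous.const_smul (n + 1 : ℝ)).norm)
    have hKΩ : K ⊆ Ω := by
      rintro z ⟨hz1, hz2⟩
      by_contra hz
      have hf : z ∈ frontier Ω := ⟨hz1, by rwa [hΩ.interior_eq]⟩
      have : v z = 0 := by
        rw [← Function.notMem_support, hvs]; exact hz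
      have : P z = 0 := by simp [P, h0 z hf, this]
      rw [mem_ofPred_eq, this] at hz2
      norm_num at hz2
    have hsupp : ∀ z ∉ K, indicator Ω (ψ n) z = 0 := by
      intro z hz
      by_cases hzΩ : z ∈ Ω
      · rw [indicator_of_mem hzΩ]
        refine hψ0 n z ?_
        by_contra hlt
        exact hz ⟨subset_closure hzΩ, not_lt.1 hlt⟩
      · rw [indicator_of_notMem hzΩ]
    have hts : tsupport (indicator Ω (ψ n)) ⊆ K :=
      closure_minimal (fun z hz => by_contra fun h => hz (hsupp z h)) hK.isClosed
    have heq : ∀ z ∈ Ω, indicator Ω (ψ n) =ᶠ[nhds z] ψ n := fun z hz => by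
      filter_upwards [hΩ.mem_nhds hz] with w hw
      rw [indicator_of_mem hw]
    have hsm : ContDiff ℝ 1 (indicator Ω (ψ n)) := by
      rw [contDiff_iff_contDiffAt]
      intro z
      by_cases hz : z ∈ Ω
      · exact (hψ n).contDiffAt.congr_of_eventuallyEq (heq z hz)
      · refine contDiffAt_const (c := (0 : ℂ)).congr_of_eventuallyEq ?_
        filter_upwards [hK.isClosed.isOpen_compl.mem_nhds fun h => hz (hKΩ h)] with w hw
        exact hsupp w hw
    rw [← integral_mul_dbar_eq_zero_of_tsupport_subset hΩ hh hsm
      (HasCompactSupport.intro hK hsupp) (hts.trans hKΩ), ← integral_indicator hΩ.measurableSet]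
    congr 1
    ext z
    by_cases hz : z ∈ Ω
    · rw [indicator_of_mem hz, dbar, dbar, (heq z hz).fderiv_eq]
    · have : indicator Ω (ψ n) =ᶠ[nhds z] fun _ => 0 := by
        filter_upwards [hK.isClosed.isOpen_compl.mem_nhds fun h => hz (hKΩ h)] with w hw
        exact hsupp w hw
      rw [indicator_of_notMem hz, dbar, this.fderiv_eq]
      simp
  obtain ⟨A, hA⟩ := hcl.exists_bound_of_continuousOn
    (hP.continuous_fderiv (by norm_num)).continuousOn
  have hC0 : 0 ≤ C := (norm_nonneg _).trans (hC 0)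
  have hbd : ∀ n, ∀ z ∈ Ω, ‖dbar (ψ n) z‖ ≤ C * A + C * A := by
    intro n z hz
    have hA' := hA z (subset_closure hz)
    have hle : ‖fderiv ℝ (ψ n) z‖ ≤ C * A := by
      rw [hψd]
      exact (ContinuousLinearMap.opNorm_comp_le _ _).trans
        (mul_le_mul (hC _) hA' (norm_nonneg _) hC0)
    refine (norm_add_le _ _).trans (add_le_add ?_ ?_)
    · simpa using (fderiv ℝ (ψ n) z).le_of_opNorm_le hle 1
    · simpa using (fderiv ℝ (ψ n) z).le_of_opNorm_le hle I
  have hcontd : ∀ {f : ℂ → ℂ}, ContDiff ℝ 1 f → Continuous (dbar f) := fun hf =>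
    ((hf.continuous_fderiv (by norm_num)).clm_apply continuous_const).add
      (continuous_const.mul ((hf.continuous_fderiv (by norm_num)).clm_apply continuous_const))
  have hlim : Filter.Tendsto (fun n => ∫ z in Ω, h z * dbar (ψ n) z) Filter.atTop
      (nhds (∫ z in Ω, h z * dbar χ z)) := by
    refine tendsto_integral_of_dominated_convergence (fun z => ‖h z‖ * (C * A + C * A))
      (fun n => hi.aestronglyMeasurable.mul (hcontd (hψ n)).aestronglyMeasurable)
      (hi.norm.mul_const _) (fun n => ?_) ?_
    · filter_upwards [ae_restrict_mem hΩ.measurableSet] with z hz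
      rw [norm_mul]
      exact mul_le_mul_of_nonneg_left (hbd n z hz) (norm_nonneg _)
    · filter_upwards [ae_restrict_mem hΩ.measurableSet] with z hz
      have hPz : 0 < ‖P z‖ := by
        rw [norm_pos_iff]
        intro h
        have : z ∈ Function.support v := by rw [hvs]; exact hz
        exact this (congrArg Prod.snd h)
      refine tendsto_const_nhds.congr' ?_
      filter_upwards [Filter.eventually_gt_atTop ⌈2 / ‖P z‖⌉₊] with n hn
      have hn' : 2 < ‖(n + 1 : ℝ) • P z‖ := by
        have : 2 / ‖P z‖ < n := Nat.lt_of_ceil_lt hn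
        rw [div_lt_iff₀ hPz] at this
        rw [norm_smul, Real.norm_of_nonneg (by positivity)]
        nlinarith
      have : fderiv ℝ (ψ n) z = fderiv ℝ χ z := by
        rw [hψd, hΘ1 _ hn']
        have h1 : HasFDerivAt P (fderiv ℝ P z) z :=
          (hP.differentiable (by norm_num) z).hasFDerivAt
        exact ((ContinuousLinearMap.fst ℝ ℂ ℝ).hasFDerivAt.comp z h1).fderiv.symm
      simp only [dbar, this]
  simp only [hzero] at hlim
  exact (tendsto_nhds_unique hlim tendsto_const_nhds)

theorem dbar_add {f g : ℂ → ℂ} {z : ℂ} (hf : DifferentiableAt ℝ f z)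
    (hg : DifferentiableAt ℝ g z) : dbar (fun z => f z + g z) z = dbar f z + dbar g z := by
  simp only [dbar, fderiv_fun_add hf hg, add_apply]
  ring

theorem dbar_eq_zero {f : ℂ → ℂ} {z : ℂ} (hf : DifferentiableAt ℂ f z) : dbar f z = 0 := by
  have := dbar_mul hf (differentiableAt_const (1 : ℂ) (x := z) (𝕜 := ℝ))
  simpa [dbar] using this

theorem dbar_conj {f : ℂ → ℂ} {z : ℂ} (hf : DifferentiableAt ℂ f z) :
    dbar (fun z => conj (f z)) z = 2 * conj (deriv f z) := by
  have h1 : HasFDerivAt (fun z => conj (f z))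
      ((conjCLE : ℂ →L[ℝ] ℂ).comp (fderiv ℝ f z)) z :=
    (conjCLE : ℂ →L[ℝ] ℂ).hasFDerivAt.comp z (hf.restrictScalars ℝ).hasFDerivAt
  have h2 : ∀ v, fderiv ℝ f z v = v * deriv f z := by
    intro v
    rw [hf.fderiv_restrictScalars ℝ]
    simp
  simp only [dbar, h1.fderiv, ContinuousLinearMap.comp_apply, h2]
  simp only [ContinuousLinearEquiv.coe_coe, conjCLE_apply, map_mul, conj_I, map_one]
  linear_combination -(conj (deriv f z)) * I_mul_I

theorem continuous_dbar {f : ℂ → ℂ} (hf : ContDiff ℝ 1 f) : Continuous (dbar f) :=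
  ((hf.continuous_fderiv (by norm_num)).clm_apply continuous_const).add
    (continuous_const.mul ((hf.continuous_fderiv (by norm_num)).clm_apply continuous_const))

theorem integrableOn_mul_continuous {Ω : Set ℂ} (hΩ : IsOpen Ω) (hb : Bornology.IsBounded Ω)
    {h χ : ℂ → ℂ} (hi : IntegrableOn h Ω) (hχ : Continuous χ) :
    IntegrableOn (fun z => h z * χ z) Ω := by
  obtain ⟨C, hC⟩ := hb.isCompact_closure.exists_bound_of_continuousOn hχ.continuousOn
  exact Integrable.mul_bdd (c := C) hi hχ.aestronglyMeasurable
    ((ae_restrict_mem hΩ.measurableSet).mono fun z hz => hC z (subset_closure hz))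

/-- If `r` is a smooth function equal to `1 / (z - w)` on the boundary, then integrating
holomorphic functions against `∂r/∂z̄` is a multiple of the evaluation at `w`. -/
theorem integral_mul_dbar_eq_mul_apply {Ω : Set ℂ} (hΩ : IsOpen Ω) (hb : Bornology.IsBounded Ω)
    {w : ℂ} (hw : w ∉ frontier Ω) {r h : ℂ → ℂ} (hr : ContDiff ℝ 1 r)
    (hrf : ∀ z ∈ frontier Ω, r z = (z - w)⁻¹) (hh : DifferentiableOn ℂ h Ω)
    (hi : IntegrableOn h Ω) :
    ∫ z in Ω, h z * dbar r z = h w * ∫ z in Ω, dbar r z := by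
  obtain ⟨ε, hε, hball⟩ := Metric.isOpen_iff.1 isClosed_frontier.isOpen_compl w hw
  have hwΩ : w ∈ Ω ∨ w ∉ closure Ω := by
    by_contra! h
    exact hw ⟨h.2, by rw [hΩ.interior_eq]; exact h.1⟩
  have hk : DifferentiableOn ℂ (dslope h w) Ω := by
    rcases hwΩ with h | h
    · exact (differentiableOn_dslope (hΩ.mem_nhds h)).2 hh
    · exact (differentiableOn_dslope_of_notMem fun h' => h (subset_closure h')).2 hh
  have hfin : volume Ω ≠ ⊤ := hb.measure_lt_top.ne
  have hki : IntegrableOn (dslope h w) Ω := by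
    obtain ⟨η, hη, C, hC⟩ : ∃ η > 0, ∃ C, ∀ z ∈ Ω, z ∈ closedBall w η → ‖dslope h w z‖ ≤ C := by
      rcases hwΩ with h1 | h1
      · obtain ⟨η, hη, hηs⟩ := Metric.nhds_basis_closedBall.mem_iff.1 (hΩ.mem_nhds h1)
        obtain ⟨C, hC⟩ := (isCompact_closedBall w η).exists_bound_of_continuousOn
          (hk.continuousOn.mono hηs)
        exact ⟨η, hη, C, fun z _ hz => hC z hz⟩
      · obtain ⟨η, hη, hηs⟩ := Metric.nhds_basis_closedBall.mem_iff.1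
          (isClosed_closure.isOpen_compl.mem_nhds h1)
        exact ⟨η, hη, 0, fun z hz hz' => absurd (subset_closure hz) (hηs hz')⟩
    have hdom : IntegrableOn (fun z => C ⊔ 0 + (‖h z‖ + ‖h w‖) / η) Ω :=
      Integrable.add (integrableOn_const hfin)
        ((Integrable.add hi.norm (integrableOn_const hfin)).div_const η)
    refine Integrable.mono' hdom (hk.continuousOn.aestronglyMeasurable hΩ.measurableSet) ?_
    filter_upwards [ae_restrict_mem hΩ.measurableSet] with z hz
    by_cases hzw : z ∈ closedBall w η
    · have : 0 ≤ (‖h z‖ + ‖h w‖) / η := by positivity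
      linarith [hC z hz hzw, le_max_left C 0]
    · have hzw' : η < ‖z - w‖ := by simpa [dist_eq_norm] using hzw
      have hne : z ≠ w := by
        rintro rfl
        simp at hzw'
        linarith
      rw [dslope_of_ne _ hne, slope_def_field, norm_div]
      have : ‖h z - h w‖ / ‖z - w‖ ≤ (‖h z‖ + ‖h w‖) / η := by
        gcongr
        exact norm_sub_le _ _
      linarith [le_max_right C 0]
  let χ : ℂ → ℂ := fun z => (z - w) * r z + (-1)
  have hχ : ContDiff ℝ 1 χ := ((contDiff_id.sub contDiff_const).mul hr).add contDiff_const
  have hd : ∀ z, dbar χ z = (z - w) * dbar r z := by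
    intro z
    have hr' := hr.differentiable (by norm_num) z
    rw [← dbar_mul (f := fun z => z - w) (by fun_prop) hr', dbar_add (by fun_prop) (by fun_prop),
      dbar_eq_zero (differentiableAt_const _), add_zero]
  have h0 := integral_mul_dbar_eq_zero_of_frontier hΩ hb hk hki hχ (by
    intro z hz
    have : z - w ≠ 0 := by
      rintro h
      rw [sub_eq_zero] at h
      exact hw (h ▸ hz)
    simp [χ, hrf z hz, this])
  have hcongr : ∀ z, h z * dbar r z = dslope h w z * dbar χ z + h w * dbar r z := by
    intro z
    have : (z - w) * dslope h w z = h z - h w := sub_smul_dslope h w z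
    rw [hd]
    linear_combination (-dbar r z) * this
  have hcd := continuous_dbar hr
  simp_rw [hcongr]
  rw [integral_add (integrableOn_mul_continuous hΩ hb hki (continuous_dbar hχ))
    (integrableOn_mul_continuous hΩ hb (integrableOn_const hfin) hcd), h0, zero_add,
    integral_const_mul]

theorem exists_contDiff_eq_inv {w : ℂ} {K : Set ℂ} (hK : IsClosed K) (hw : w ∉ K) :
    ∃ r : ℂ → ℂ, ContDiff ℝ 1 r ∧ ∀ z ∈ K, r z = (z - w)⁻¹ := by
  obtain ⟨ε, hε, hball⟩ := Metric.isOpen_iff.1 hK.isOpen_compl w hw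
  let β : ContDiffBump w := ⟨ε / 2, ε, by linarith, by linarith⟩
  refine ⟨fun z => (1 - β z) • (z - w)⁻¹, ?_, fun z hz => ?_⟩
  · rw [contDiff_iff_contDiffAt]
    intro z
    by_cases hz : z = w
    · subst hz
      refine (contDiffAt_const (c := (0 : ℂ))).congr_of_eventuallyEq ?_
      filter_upwards [ball_mem_nhds z (half_pos hε)] with y hy
      rw [β.one_of_mem_closedBall (ball_subset_closedBall hy)]
      simp
    · exact (contDiffAt_const.sub β.contDiff.contDiffAt).smul
        ((contDiffAt_id.sub contDiffAt_const).inv (sub_ne_zero.2 hz))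
  · have : β z = 0 := by
      refine β.zero_of_le_dist ?_
      by_contra! h
      exact hball h hz
    simp [this]

theorem injective_id_sub {G : ℂ → ℂ} (hG : Differentiable ℝ G)
    (hGd : ∀ z, ‖fderiv ℝ G z‖ ≤ 1 / 2) : Function.Injective fun z => z - G z := by
  intro z w h
  have := convex_univ.norm_image_sub_le_of_norm_fderiv_le (𝕜 := ℝ) (fun x _ => hG x)
    (fun x _ => hGd x) (mem_univ w) (mem_univ z)
  have h' : G z - G w = z - w := by
    simp only at h
    linear_combination -h
  rw [h'] at this
  have h0 : ‖z - w‖ = 0 := by linarith [norm_nonneg (z - w)]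
  exact sub_eq_zero.1 (norm_eq_zero.1 h0)

theorem abs_det_restrictScalars_smul_one (c : ℂ) :
    |((c • (1 : ℂ →L[ℂ] ℂ)).restrictScalars ℝ).det| = ‖c‖ ^ 2 := by
  have h : ((c • (1 : ℂ →L[ℂ] ℂ)).restrictScalars ℝ).det = normSq c := by
    rw [← Algebra.norm_complex_apply, Algebra.norm_apply, ContinuousLinearMap.det]
    congr 1
  rw [h, abs_of_nonneg (normSq_nonneg c), normSq_eq_norm_sq]

theorem hasFDerivAt_restrictScalars_smul_one {g : ℂ → ℂ} {z : ℂ} (hg : DifferentiableAt ℂ g z) :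
    HasFDerivAt g ((deriv g z • (1 : ℂ →L[ℂ] ℂ)).restrictScalars ℝ) z := by
  have h : deriv g z • (1 : ℂ →L[ℂ] ℂ) = ContinuousLinearMap.toSpanSingleton ℂ (deriv g z) := by
    ext
    simp
  rw [h]
  exact hg.hasDerivAt.hasFDerivAt.restrictScalars ℝ

theorem setIntegral_image_eq {Ω : Set ℂ} (hΩ : IsOpen Ω) {g : ℂ → ℂ}
    (hg : DifferentiableOn ℂ g Ω) (hinj : InjOn g Ω) (f : ℂ → ℂ) :
    ∫ z in g '' Ω, f z = ∫ z in Ω, (f (g z) * deriv g z) * conj (deriv g z) := by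
  rw [integral_image_eq_integral_abs_det_fderiv_smul volume hΩ.measurableSet
    (f' := fun z => (deriv g z • (1 : ℂ →L[ℂ] ℂ)).restrictScalars ℝ) (fun z hz =>
      (hasFDerivAt_restrictScalars_smul_one
        (hg.differentiableAt (hΩ.mem_nhds hz))).hasFDerivWithinAt) hinj]
  congr 1
  ext z
  rw [abs_det_restrictScalars_smul_one]
  rw [mul_assoc, mul_conj, normSq_eq_norm_sq, real_smul, mul_comm]

theorem integrableOn_image_iff {Ω : Set ℂ} (hΩ : IsOpen Ω) {g : ℂ → ℂ}
    (hg : DifferentiableOn ℂ g Ω) (hinj : InjOn g Ω) (f : ℂ → ℂ) :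
    IntegrableOn (fun z => ‖f z‖ ^ 2) (g '' Ω) ↔
      IntegrableOn (fun z => ‖f (g z) * deriv g z‖ ^ 2) Ω := by
  rw [integrableOn_image_iff_integrableOn_abs_det_fderiv_smul volume hΩ.measurableSet
    (f' := fun z => (deriv g z • (1 : ℂ →L[ℂ] ℂ)).restrictScalars ℝ) (fun z hz =>
      (hasFDerivAt_restrictScalars_smul_one
        (hg.differentiableAt (hΩ.mem_nhds hz))).hasFDerivWithinAt) hinj]
  simp only [abs_det_restrictScalars_smul_one, norm_mul, mul_pow, smul_eq_mul, mul_comm]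

theorem isQuadratureDomain_of_integral_conj_deriv {Ω : Set ℂ} (hΩ : IsOpen Ω)
    (hb : Bornology.IsBounded Ω) (hne : Ω.Nonempty) {g : ℂ → ℂ} (hg : DifferentiableOn ℂ g Ω)
    (hinj : InjOn g Ω) (s : Finset ℂ) (hs : ∀ w ∈ s, w ∈ Ω) (c : ℂ → ℂ)
    (hq : ∀ h : ℂ → ℂ, DifferentiableOn ℂ h Ω → IntegrableOn h Ω →
      ∫ z in Ω, h z * conj (deriv g z) = ∑ w ∈ s, c w * h w) :
    IsQuadratureDomain (g '' Ω) := by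
  classical
  obtain ⟨w₀, hw₀⟩ := hne
  let S := insert w₀ s
  have hS : ∀ w ∈ S, w ∈ Ω := by
    intro w hw
    rcases Finset.mem_insert.1 hw with rfl | h
    · exact hw₀
    · exact hs w h
  let e := S.equivFin
  refine ⟨S.card, Finset.card_pos.2 ⟨w₀, Finset.mem_insert_self _ _⟩, fun j => g (e.symm j),
    fun _ => 0, fun j _ => if (e.symm j : ℂ) ∈ s then c (e.symm j) * deriv g (e.symm j) else 0,
    fun j => mem_image_of_mem _ (hS _ (e.symm j).2), ?_⟩
  rintro f ⟨hfd, hfi⟩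
  have hd : DifferentiableOn ℂ (fun z => f (g z) * deriv g z) Ω :=
    (hfd.comp hg (mapsTo_image g Ω)).mul (hg.deriv hΩ)
  have hi : IntegrableOn (fun z => f (g z) * deriv g z) Ω := by
    rw [integrableOn_image_iff hΩ hg hinj] at hfi
    refine Integrable.mono' (Integrable.add (integrableOn_const (C := (1 : ℝ))
      hb.measure_lt_top.ne) hfi)
      (hd.continuousOn.aestronglyMeasurable hΩ.measurableSet) (.of_forall fun z => ?_)
    simp only [Pi.add_apply]
    nlinarith [sq_nonneg (‖f (g z) * deriv g z‖ - 1)]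
  rw [setIntegral_image_eq hΩ hg hinj, hq _ hd hi]
  simp only [zero_add, Finset.sum_range_one, iteratedDerivWithin_zero]
  rw [e.symm.sum_comp (fun x : S => (if (x : ℂ) ∈ s then c x * deriv g x else 0) * f (g x)),
    Finset.sum_coe_sort S (fun x => (if x ∈ s then c x * deriv g x else 0) * f (g x)),
    ← Finset.sum_subset (Finset.subset_insert w₀ s)]
  · refine Finset.sum_congr rfl fun x hx => ?_
    rw [if_pos hx]
    ring
  · intro x _ hx
    rw [if_neg hx, zero_mul]

theorem isQuadratureDomain_of_frontier {Ω : Set ℂ} (hΩ : IsOpen Ω) (hb : Bornology.IsBounded Ω)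
    (hne : Ω.Nonempty) {g M : ℂ → ℂ} (hg : ContDiff ℝ 1 g) (hM : ContDiff ℝ 1 M)
    (hgΩ : DifferentiableOn ℂ g Ω) (hMΩ : DifferentiableOn ℂ M Ω) (hinj : InjOn g Ω)
    (s : Finset ℂ) (hs : ∀ w ∈ s, w ∉ frontier Ω) (c : ℂ → ℂ)
    (hgM : ∀ z ∈ frontier Ω, conj (g z) = M z + ∑ w ∈ s, c w * (z - w)⁻¹) :
    IsQuadratureDomain (g '' Ω) := by
  classical
  have hr : ∀ w : ℂ, ∃ r : ℂ → ℂ, ContDiff ℝ 1 r ∧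
      (w ∉ frontier Ω → ∀ z ∈ frontier Ω, r z = (z - w)⁻¹) := by
    intro w
    by_cases hw : w ∈ frontier Ω
    · exact ⟨fun _ => 0, contDiff_const, fun h => absurd hw h⟩
    · obtain ⟨r, h1, h2⟩ := exists_contDiff_eq_inv isClosed_frontier hw
      exact ⟨r, h1, fun _ => h2⟩
  choose r hr1 hr2 using hr
  have hfin : volume Ω ≠ ⊤ := hb.measure_lt_top.ne
  refine isQuadratureDomain_of_integral_conj_deriv hΩ hb hne hgΩ hinj (s.filter (· ∈ Ω))
    (fun w hw => (Finset.mem_filter.1 hw).2) (fun w => 2⁻¹ * c w * ∫ z in Ω, dbar (r w) z) ?_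
  intro h hh hi
  let Sr : ℂ → ℂ := fun z => ∑ w ∈ s, (-c w) * r w z
  have hS : ContDiff ℝ 1 Sr := ContDiff.sum fun w _ => contDiff_const.mul (hr1 w)
  have hcg : ContDiff ℝ 1 (fun z => conj (g z)) :=
    (conjCLE : ℂ →L[ℝ] ℂ).contDiff.comp hg
  let χ : ℂ → ℂ := fun z => conj (g z) + ((-1) * M z + Sr z)
  have hχ : ContDiff ℝ 1 χ := hcg.add ((contDiff_const.mul hM).add hS)
  have h0 := integral_mul_dbar_eq_zero_of_frontier hΩ hb hh hi hχ (by
    intro z hz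
    have : Sr z = -∑ w ∈ s, c w * (z - w)⁻¹ := by
      simp only [Sr, ← Finset.sum_neg_distrib]
      exact Finset.sum_congr rfl fun w hw => by rw [hr2 w (hs w hw) z hz, neg_mul]
    simp only [χ, hgM z hz, this]
    ring)
  have hSd : ∀ z, dbar Sr z = ∑ w ∈ s, (-c w) * dbar (r w) z := by
    intro z
    have : fderiv ℝ Sr z = ∑ w ∈ s, (-c w) • fderiv ℝ (r w) z := by
      simp only [Sr]
      rw [fderiv_fun_sum fun w _ =>
        ((hr1 w).differentiable (by norm_num) z).const_mul (-c w)]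
      exact Finset.sum_congr rfl fun w _ =>
        fderiv_const_mul ((hr1 w).differentiable (by norm_num) z) _
    simp only [dbar, this, sum_apply, smul_apply, smul_eq_mul,
      Finset.mul_sum, ← Finset.sum_add_distrib]
    exact Finset.sum_congr rfl fun w _ => by ring
  have hd : ∀ z ∈ Ω, h z * dbar χ z =
      2 * (h z * conj (deriv g z)) + ∑ w ∈ s, (-c w) * (h z * dbar (r w) z) := by
    intro z hz
    have e1 := hcg.differentiable (by norm_num) z
    have e2 := hM.differentiable (by norm_num) z
    have e3 := hS.differentiable (by norm_num) z
    simp only [χ]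
    rw [dbar_add (g := fun z => -1 * M z + Sr z) e1 ((e2.const_mul (-1)).add e3),
      dbar_add (e2.const_mul (-1)) e3,
      dbar_eq_zero ((hMΩ.differentiableAt (hΩ.mem_nhds hz)).const_mul (-1)),
      dbar_conj (hgΩ.differentiableAt (hΩ.mem_nhds hz)), hSd, zero_add, mul_add, Finset.mul_sum]
    congr 1
    · ring
    · exact Finset.sum_congr rfl fun w _ => by ring
  have hinteg : ∀ w, IntegrableOn (fun z => h z * dbar (r w) z) Ω := fun w =>
    integrableOn_mul_continuous hΩ hb hi (continuous_dbar (hr1 w))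
  have hinteg2 : IntegrableOn (fun z => ∑ w ∈ s, (-c w) * (h z * dbar (r w) z)) Ω :=
    integrable_finsetSum _ fun w _ => (hinteg w).const_mul _
  have hinteg3 : IntegrableOn (fun z => 2 * (h z * conj (deriv g z))) Ω := by
    refine ((integrableOn_mul_continuous hΩ hb hi (continuous_dbar hχ)).sub hinteg2).congr ?_
    filter_upwards [ae_restrict_mem hΩ.measurableSet] with z hz
    simp only [Pi.sub_apply, hd z hz]
    ring
  rw [setIntegral_congr_fun hΩ.measurableSet hd, integral_add hinteg3 hinteg2,
    integral_const_mul, integral_finsetSum _ fun w _ => (hinteg w).const_mul _] at h0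
  have hout : ∀ w ∈ s, w ∉ Ω → ∫ z in Ω, h z * dbar (r w) z = 0 := by
    intro w hw hwΩ
    have hupd : ∀ z ∈ Ω, Function.update h w 0 z = h z := fun z hz =>
      Function.update_of_ne (fun e : z = w => hwΩ (e ▸ hz)) _ _
    have := integral_mul_dbar_eq_mul_apply hΩ hb (hs w hw) (hr1 w) (hr2 w (hs w hw))
      (h := Function.update h w 0) (hh.congr hupd)
      (hi.congr_fun (fun z hz => (hupd z hz).symm) hΩ.measurableSet)
    rw [Function.update_self, zero_mul] at this
    rw [← this]
    exact setIntegral_congr_fun hΩ.measurableSet fun z hz => by simp only [hupd z hz]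
  have hsum : ∑ w ∈ s, ∫ z in Ω, (-c w) * (h z * dbar (r w) z) =
      -2 * ∑ w ∈ s.filter (· ∈ Ω), 2⁻¹ * c w * (∫ z in Ω, dbar (r w) z) * h w := by
    rw [Finset.sum_filter, Finset.mul_sum]
    refine Finset.sum_congr rfl fun w hw => ?_
    rw [integral_const_mul]
    split_ifs with hwΩ
    · rw [integral_mul_dbar_eq_mul_apply hΩ hb (hs w hw) (hr1 w) (hr2 w (hs w hw)) hh hi]
      ring
    · rw [hout w hw hwΩ]
      ring
  rw [hsum] at h0
  linear_combination 2⁻¹ * h0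

/-- Smooth functions all of whose derivatives are bounded. -/
def SmoothBdd {E F : Type*} [NormedAddCommGroup E] [NormedSpace ℝ E] [NormedAddCommGroup F]
    [NormedSpace ℝ F] (f : E → F) : Prop :=
  ContDiff ℝ ∞ f ∧ ∀ k : ℕ, ∃ C : ℝ, ∀ x, ‖iteratedFDeriv ℝ k f x‖ ≤ C

theorem SmoothBdd.mul {E : Type*} [NormedAddCommGroup E] [NormedSpace ℝ E] {f g : E → ℂ}
    (hf : SmoothBdd f) (hg : SmoothBdd g) : SmoothBdd fun x => f x * g x := by
  refine ⟨hf.1.mul hg.1, fun k => ?_⟩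
  choose A hA using hf.2
  choose B hB using hg.2
  refine ⟨∑ i ∈ Finset.range (k + 1), (k.choose i : ℝ) * A i * B (k - i), fun x => ?_⟩
  refine (norm_iteratedFDeriv_mul_le hf.1 hg.1 x (by exact_mod_cast le_top)).trans
    (Finset.sum_le_sum fun i _ => ?_)
  have hA0 : 0 ≤ A i := (norm_nonneg _).trans (hA i x)
  gcongr
  exacts [hA i x, hB (k - i) x]

theorem SmoothBdd.comp_clm {E G F : Type*} [NormedAddCommGroup E] [NormedSpace ℝ E]
    [NormedAddCommGroup G] [NormedSpace ℝ G] [NormedAddCommGroup F]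
    [NormedSpace ℝ F] {f : E → F} (hf : SmoothBdd f) (L : G →L[ℝ] E) :
    SmoothBdd fun x => f (L x) := by
  refine ⟨hf.1.comp L.contDiff, fun k => ?_⟩
  obtain ⟨A, hA⟩ := hf.2 k
  refine ⟨A * ∏ _i : Fin k, ‖L‖, fun x => ?_⟩
  have := L.iteratedFDeriv_comp_right hf.1 x (i := k) (by exact_mod_cast le_top)
  rw [show (fun x => f (L x)) = f ∘ L from rfl, this]
  refine (ContinuousMultilinearMap.norm_compContinuousLinearMap_le _ _).trans ?_
  gcongr
  exact hA _

theorem smoothBdd_of_hasCompactSupport {E F : Type*} [NormedAddCommGroup E] [NormedSpace ℝ E]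
    [NormedAddCommGroup F] [NormedSpace ℝ F] {f : E → F} (hf : ContDiff ℝ ∞ f)
    (hc : HasCompactSupport f) : SmoothBdd f :=
  ⟨hf, fun k => (hf.continuous_iteratedFDeriv
    (by exact_mod_cast le_top)).bounded_above_of_compact_support
    (hc.iteratedFDeriv (𝕜 := ℝ) k)⟩

theorem smoothBdd_of_periodic {F : Type*} [NormedAddCommGroup F] [NormedSpace ℝ F] {f : ℝ → F}
    (hf : ContDiff ℝ ∞ f) {T : ℝ} (hT : T ≠ 0) (hp : Function.Periodic f T) : SmoothBdd f := by
  refine ⟨hf, fun k => ?_⟩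
  have hper : Function.Periodic (iteratedFDeriv ℝ k f) T := by
    intro x
    rw [← iteratedFDeriv_comp_add_right k T x]
    congr 2
    exact funext hp
  obtain ⟨C, hC⟩ := (hper.isBounded_of_continuous hT
    (hf.continuous_iteratedFDeriv (by exact_mod_cast le_top))).exists_norm_le
  exact ⟨C, fun x => hC _ (mem_range_self x)⟩

/-- Weighted `ℓ¹` norm of a sequence of Fourier coefficients. -/
def wnorm (k : ℕ) (a : ℤ → ℂ) : ℝ := ∑' n, ‖a n‖ * (1 + |(n : ℝ)|) ^ k

/-- Rapidly decreasing sequences. -/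
def RapidDecay (a : ℤ → ℂ) : Prop := ∀ k : ℕ, Summable fun n => ‖a n‖ * (1 + |(n : ℝ)|) ^ k

theorem wnorm_nonneg (k : ℕ) (a : ℤ → ℂ) : 0 ≤ wnorm k a := tsum_nonneg fun n => by positivity

theorem RapidDecay.mul_int {a : ℤ → ℂ} (ha : RapidDecay a) (c : ℂ) :
    RapidDecay fun n => c * n * a n := by
  intro k
  refine ((ha (k + 1)).mul_left ‖c‖).of_nonneg_of_le (fun n => by positivity) fun n => ?_
  rw [norm_mul, norm_mul, norm_intCast, pow_succ]
  have : |(n : ℝ)| ≤ 1 + |(n : ℝ)| := by linarith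
  calc ‖c‖ * |(n : ℝ)| * ‖a n‖ * (1 + |(n : ℝ)|) ^ k
      = ‖c‖ * (‖a n‖ * ((1 + |(n : ℝ)|) ^ k * |(n : ℝ)|)) := by ring
    _ ≤ _ := by gcongr

theorem RapidDecay.wnorm_mul_int_le {a : ℤ → ℂ} (ha : RapidDecay a) (c : ℂ) (k : ℕ) :
    wnorm k (fun n => c * n * a n) ≤ ‖c‖ * wnorm (k + 1) a := by
  rw [wnorm, wnorm, ← tsum_mul_left]
  refine (ha.mul_int c k).tsum_le_tsum (fun n => ?_) ((ha (k + 1)).mul_left ‖c‖)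
  rw [norm_mul, norm_mul, norm_intCast, pow_succ]
  have : |(n : ℝ)| ≤ 1 + |(n : ℝ)| := by linarith
  calc ‖c‖ * |(n : ℝ)| * ‖a n‖ * (1 + |(n : ℝ)|) ^ k
      = ‖c‖ * (‖a n‖ * ((1 + |(n : ℝ)|) ^ k * |(n : ℝ)|)) := by ring
    _ ≤ _ := by gcongr

/-- The model function `(t, s) ↦ e^{it} φ(s)`. -/
def expProd (φ : ℝ → ℂ) (p : ℝ × ℝ) : ℂ := cexp (p.1 * I) * φ p.2

theorem smoothBdd_cexp : SmoothBdd fun t : ℝ => cexp (t * I) := by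
  refine smoothBdd_of_periodic ?_ Real.two_pi_pos.ne' ?_
  · exact (contDiff_exp.comp (ofRealCLM.contDiff.mul contDiff_const)).of_le le_top
  · intro t
    push_cast
    rw [add_mul, Complex.exp_add, exp_two_pi_mul_I, mul_one]

theorem smoothBdd_expProd {φ : ℝ → ℂ} (hφ : SmoothBdd φ) : SmoothBdd (expProd φ) :=
  (smoothBdd_cexp.comp_clm (ContinuousLinearMap.fst ℝ ℝ ℝ)).mul
    (hφ.comp_clm (ContinuousLinearMap.snd ℝ ℝ ℝ))

/-- The almost analytic extension `∑ aₙ e^{int} φ(ns)`. -/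
def aae (φ : ℝ → ℂ) (a : ℤ → ℂ) (t s : ℝ) : ℂ :=
  ∑' n : ℤ, a n * (cexp (n * t * I) * φ (n * s))

theorem contDiff_aae {φ : ℝ → ℂ} (hφ : SmoothBdd φ) {a : ℤ → ℂ} (ha : RapidDecay a) :
    ContDiff ℝ ∞ fun p : ℝ × ℝ => aae φ a p.1 p.2 := by
  have hΨ := smoothBdd_expProd hφ
  choose C hC using hΨ.2
  have heq : ∀ n : ℤ, (fun p : ℝ × ℝ => a n * (cexp (n * p.1 * I) * φ (n * p.2))) =
      fun p => a n • expProd φ ((n : ℝ) • p) := by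
    intro n
    ext p
    simp [expProd]
  have hsm : ∀ n : ℤ, ContDiff ℝ ∞ fun p : ℝ × ℝ => expProd φ ((n : ℝ) • p) := fun n =>
    hΨ.1.comp (contDiff_id.const_smul (n : ℝ))
  refine contDiff_tsum (v := fun k n => C k * (‖a n‖ * (1 + |(n : ℝ)|) ^ k)) (fun n => ?_)
    (fun k _ => (ha k).mul_left _) fun k n p _ => ?_
  · rw [heq]
    exact (hsm n).const_smul (a n)
  · rw [heq, iteratedFDeriv_const_smul_apply' ((hsm n).of_le (by exact_mod_cast le_top)).contDiffAt,
      iteratedFDeriv_comp_const_smul (n : ℝ) (hΨ.1.of_le (by exact_mod_cast le_top)), norm_smul,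
      norm_smul, norm_pow, Real.norm_eq_abs]
    have hC0 : 0 ≤ C k := (norm_nonneg _).trans (hC k 0)
    calc ‖a n‖ * (|(n : ℝ)| ^ k * ‖iteratedFDeriv ℝ k (expProd φ) ((n : ℝ) • p)‖)
        ≤ ‖a n‖ * ((1 + |(n : ℝ)|) ^ k * C k) := by
          gcongr
          · linarith
          · exact hC _ _
      _ = _ := by ring

theorem summable_aae {φ : ℝ → ℂ} {C : ℝ} (hφ : ∀ y, ‖φ y‖ ≤ C) {a : ℤ → ℂ} (ha : RapidDecay a)
    (t s : ℝ) : Summable fun n : ℤ => a n * (cexp (n * t * I) * φ (n * s)) := by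
  refine Summable.of_norm_bounded ((ha 0).mul_left C) fun n => ?_
  have : (n : ℂ) * t * I = ((n * t : ℝ) : ℂ) * I := by push_cast; ring
  rw [norm_mul, norm_mul, this, norm_exp_ofReal_mul_I, pow_zero, one_mul, mul_one, mul_comm]
  gcongr
  exact hφ _

theorem norm_aae_le {φ : ℝ → ℂ} {C : ℝ} {k : ℕ} (hC : 0 ≤ C) (hφ : ∀ y, ‖φ y‖ ≤ C * |y| ^ k)
    {a : ℤ → ℂ} (ha : RapidDecay a) (t s : ℝ) : ‖aae φ a t s‖ ≤ C * |s| ^ k * wnorm k a := by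
  rw [aae, wnorm, ← tsum_mul_left]
  refine tsum_of_norm_bounded ((ha k).mul_left (C * |s| ^ k)).hasSum fun n => ?_
  have : (n : ℂ) * t * I = ((n * t : ℝ) : ℂ) * I := by push_cast; ring
  rw [norm_mul, norm_mul, this, norm_exp_ofReal_mul_I, one_mul]
  calc ‖a n‖ * ‖φ (n * s)‖ ≤ ‖a n‖ * (C * |n * s| ^ k) := by gcongr; exact hφ _
    _ = C * |s| ^ k * (‖a n‖ * |(n : ℝ)| ^ k) := by rw [abs_mul, mul_pow]; ring
    _ ≤ _ := by
      gcongr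
      linarith

theorem hasDerivAt_aae_left {φ : ℝ → ℂ} {C : ℝ} (hφ : ∀ y, ‖φ y‖ ≤ C) {a : ℤ → ℂ}
    (ha : RapidDecay a) (t s : ℝ) :
    HasDerivAt (fun t => aae φ a t s) (aae φ (fun n => I * n * a n) t s) t := by
  have hu : Summable fun n : ℤ => C * (‖I * n * a n‖ * (1 + |(n : ℝ)|) ^ 0) :=
    (ha.mul_int I 0).mul_left C
  refine hasDerivAt_tsum (𝕜 := ℝ) (y₀ := 0)
    (g := fun (n : ℤ) (t : ℝ) => a n * (cexp (n * t * I) * φ (n * s)))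
    (g' := fun (n : ℤ) (t : ℝ) => I * n * a n * (cexp (n * t * I) * φ (n * s)))
    hu (fun n t => ?_) (fun n t => ?_) (summable_aae hφ ha 0 s) t
  · have h1 : HasDerivAt (fun t : ℝ => (n : ℂ) * t * I) (n * I) t := by
      simpa using (ofRealCLM.hasDerivAt (x := t)).const_mul (n : ℂ) |>.mul_const I
    refine (((h1.cexp).mul_const (φ (n * s))).const_mul (a n)).congr_deriv ?_
    ring
  · have : (n : ℂ) * t * I = ((n * t : ℝ) : ℂ) * I := by push_cast; ring
    rw [norm_mul, norm_mul _ (φ _), this, norm_exp_ofReal_mul_I, pow_zero, one_mul, mul_one,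
      mul_comm]
    gcongr
    exact hφ _

theorem hasDerivAt_aae_right {φ : ℝ → ℂ} {C C' : ℝ} (hφ : ∀ y, ‖φ y‖ ≤ C)
    (hφd : Differentiable ℝ φ) (hφ' : ∀ y, ‖deriv φ y‖ ≤ C') {a : ℤ → ℂ}
    (ha : RapidDecay a) (t s : ℝ) :
    HasDerivAt (fun s => aae φ a t s) (aae (deriv φ) (fun n => 1 * n * a n) t s) s := by
  have hu : Summable fun n : ℤ => C' * (‖1 * n * a n‖ * (1 + |(n : ℝ)|) ^ 0) :=
    (ha.mul_int 1 0).mul_left C'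
  refine hasDerivAt_tsum (𝕜 := ℝ) (y₀ := 0)
    (g := fun (n : ℤ) (s : ℝ) => a n * (cexp (n * t * I) * φ (n * s)))
    (g' := fun (n : ℤ) (s : ℝ) => 1 * n * a n * (cexp (n * t * I) * deriv φ (n * s)))
    hu (fun n s => ?_) (fun n s => ?_) (summable_aae hφ ha t 0) s
  · have h1 : HasDerivAt (fun s : ℝ => (n : ℝ) * s) n s := by
      simpa using (hasDerivAt_id s).const_mul (n : ℝ)
    have h2 := (hφd (n * s)).hasDerivAt.scomp s h1
    refine ((h2.const_mul (cexp (n * t * I))).const_mul (a n)).congr_deriv ?_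
    rw [real_smul, ofReal_intCast]
    ring
  · have : (n : ℂ) * t * I = ((n * t : ℝ) : ℂ) * I := by push_cast; ring
    rw [norm_mul, norm_mul _ (deriv φ _), this, norm_exp_ofReal_mul_I, pow_zero, mul_one,
      one_mul ‖deriv φ _‖, mul_comm]
    gcongr
    exact hφ' _

theorem aae_periodic (φ : ℝ → ℂ) (a : ℤ → ℂ) (t s : ℝ) :
    aae φ a (t + 2 * Real.pi) s = aae φ a t s := by
  refine tsum_congr fun n => ?_
  have : (n : ℂ) * ((t + 2 * Real.pi : ℝ) : ℂ) * I = n * t * I + n * (2 * Real.pi * I) := by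
    push_cast; ring
  rw [this, Complex.exp_add, exp_int_mul_two_pi_mul_I, mul_one]

/-- Fourier coefficients of a `2π`-periodic function. -/
def fcoeff (ρ : ℝ → ℂ) (n : ℤ) : ℂ :=
  (2 * Real.pi : ℂ)⁻¹ * ∫ t in (0 : ℝ)..2 * Real.pi, ρ t * cexp (-(n * t * I))

theorem norm_cexp_int_mul (n : ℤ) (t : ℝ) : ‖cexp (n * t * I)‖ = 1 := by
  have : (n : ℂ) * t * I = ((n * t : ℝ) : ℂ) * I := by push_cast; ring
  rw [this, norm_exp_ofReal_mul_I]

theorem norm_cexp_neg_int_mul (n : ℤ) (t : ℝ) : ‖cexp (-(n * t * I))‖ = 1 := by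
  rw [Complex.exp_neg, norm_inv, norm_cexp_int_mul, inv_one]

theorem norm_fcoeff_le {ρ : ℝ → ℂ} {A : ℝ} (hA : ∀ t, ‖ρ t‖ ≤ A) (n : ℤ) : ‖fcoeff ρ n‖ ≤ A := by
  have h := intervalIntegral.norm_integral_le_of_norm_le_const (a := 0) (b := 2 * Real.pi)
    (f := fun t => ρ t * cexp (-(n * t * I))) (C := A) fun t _ => by
      rw [norm_mul, norm_cexp_neg_int_mul, mul_one]; exact hA t
  have hpi := Real.pi_pos
  rw [fcoeff, norm_mul, norm_inv]
  have h2 : ‖(2 * Real.pi : ℂ)‖ = 2 * Real.pi := by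
    rw [norm_mul, norm_real, Real.norm_of_nonneg hpi.le]; norm_num
  rw [h2, inv_mul_le_iff₀ (by positivity)]
  rw [sub_zero, abs_of_pos (by positivity)] at h
  linarith

theorem fcoeff_deriv {ρ : ℝ → ℂ} (hρ : ContDiff ℝ 1 ρ) (hp : Function.Periodic ρ (2 * Real.pi))
    (n : ℤ) : fcoeff (deriv ρ) n = I * n * fcoeff ρ n := by
  have hv : ∀ t : ℝ, HasDerivAt (fun t : ℝ => cexp (-(n * t * I)))
      (-(I * n) * cexp (-(n * t * I))) t := by
    intro t
    have h1 : HasDerivAt (fun t : ℝ => -((n : ℂ) * t * I)) (-(n * I)) t := by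
      refine (((ofRealCLM.hasDerivAt (x := t)).const_mul (n : ℂ)).mul_const I).neg.congr_deriv ?_
      simp
    refine h1.cexp.congr_deriv ?_
    ring
  have hd : ∀ t, HasDerivAt ρ (deriv ρ t) t := fun t =>
    (hρ.differentiable (by norm_num) t).hasDerivAt
  have hcv : Continuous fun t : ℝ => cexp (-(n * t * I)) := by fun_prop
  have key := intervalIntegral.integral_deriv_mul_eq_sub (a := 0) (b := 2 * Real.pi)
    (fun t _ => hd t) (fun t _ => hv t)
    ((hρ.continuous_deriv le_rfl).intervalIntegrable _ _)
    ((continuous_const.mul hcv).intervalIntegrable _ _)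
  rw [intervalIntegral.integral_add (f := fun t => deriv ρ t * cexp (-(n * t * I)))
    (g := fun t => ρ t * (-(I * n) * cexp (-(n * t * I))))
    (((hρ.continuous_deriv le_rfl).mul hcv).intervalIntegrable _ _)
    ((hρ.continuous.mul (continuous_const.mul hcv)).intervalIntegrable _ _)] at key
  have e1 : ρ (2 * Real.pi) = ρ 0 := by simpa using hp 0
  have e2 : cexp (-(n * (2 * Real.pi : ℝ) * I)) = 1 := by
    rw [Complex.exp_neg]
    have : (n : ℂ) * (2 * Real.pi : ℝ) * I = n * (2 * Real.pi * I) := by push_cast; ring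
    rw [this, exp_int_mul_two_pi_mul_I, inv_one]
  have e3 : ∫ t in (0 : ℝ)..2 * Real.pi, ρ t * (-(I * n) * cexp (-(n * t * I))) =
      -(I * n) * ∫ t in (0 : ℝ)..2 * Real.pi, ρ t * cexp (-(n * t * I)) := by
    rw [← intervalIntegral.integral_const_mul]
    exact intervalIntegral.integral_congr fun t _ => by ring
  rw [e1, e2, e3] at key
  simp only [ofReal_zero, mul_zero, zero_mul, neg_zero, Complex.exp_zero, sub_self] at key
  rw [fcoeff, fcoeff]
  linear_combination (2 * Real.pi : ℂ)⁻¹ * key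

theorem periodic_iteratedDeriv {F : Type*} [NormedAddCommGroup F] [NormedSpace ℝ F] {f : ℝ → F}
    {T : ℝ} (hp : Function.Periodic f T) (k : ℕ) : Function.Periodic (iteratedDeriv k f) T := by
  intro x
  have := congrFun (iteratedDeriv_comp_add_const k f T) x
  rw [← this]
  congr 2
  exact funext hp

theorem fcoeff_iteratedDeriv {ρ : ℝ → ℂ} (hρ : ContDiff ℝ ∞ ρ)
    (hp : Function.Periodic ρ (2 * Real.pi)) (k : ℕ) (n : ℤ) :
    fcoeff (iteratedDeriv k ρ) n = (I * n) ^ k * fcoeff ρ n := by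
  induction k with
  | zero => simp
  | succ k ih =>
    have hk : ContDiff ℝ 1 (iteratedDeriv k ρ) := by
      rw [iteratedDeriv_eq_iterate]
      exact (hρ.iterate_deriv k).of_le (by exact_mod_cast le_top)
    rw [iteratedDeriv_succ, fcoeff_deriv hk (periodic_iteratedDeriv hp k), ih, pow_succ]
    ring

theorem norm_fcoeff_mul_pow_le {ρ : ℝ → ℂ} (hρ : ContDiff ℝ ∞ ρ)
    (hp : Function.Periodic ρ (2 * Real.pi)) {k : ℕ} {A : ℝ}
    (hA : ∀ l ≤ k, ∀ t, ‖iteratedDeriv l ρ t‖ ≤ A) (n : ℤ) :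
    ‖fcoeff ρ n‖ * (1 + |(n : ℝ)|) ^ k ≤ 2 ^ k * A := by
  have h0 : ‖fcoeff ρ n‖ ≤ A := norm_fcoeff_le (by simpa using hA 0 (Nat.zero_le _)) n
  have hk : ‖fcoeff ρ n‖ * |(n : ℝ)| ^ k ≤ A := by
    have := norm_fcoeff_le (hA k le_rfl) n
    rw [fcoeff_iteratedDeriv hρ hp, norm_mul, norm_pow, norm_mul, norm_I, one_mul,
      norm_intCast] at this
    linarith
  rcases le_total |(n : ℝ)| 1 with h | h
  · calc ‖fcoeff ρ n‖ * (1 + |(n : ℝ)|) ^ k ≤ A * 2 ^ k := by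
          have := (norm_nonneg _).trans h0
          gcongr
          linarith
      _ = _ := mul_comm _ _
  · calc ‖fcoeff ρ n‖ * (1 + |(n : ℝ)|) ^ k ≤ ‖fcoeff ρ n‖ * (2 * |(n : ℝ)|) ^ k := by
          gcongr
          linarith
      _ = 2 ^ k * (‖fcoeff ρ n‖ * |(n : ℝ)| ^ k) := by ring
      _ ≤ _ := by gcongr

theorem summable_inv_one_add_abs_sq : Summable fun n : ℤ => ((1 + |(n : ℝ)|) ^ 2)⁻¹ := by
  have h1 : Summable fun n : ℕ => ((1 + |((n : ℤ) : ℝ)|) ^ 2)⁻¹ := by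
    have := (summable_nat_add_iff 1).2 (Real.summable_nat_pow_inv.2 (one_lt_two))
    refine this.congr fun n => ?_
    rw [Int.cast_natCast, Nat.abs_cast]
    push_cast
    ring
  exact Summable.of_nat_of_neg h1 (by simpa using h1)

theorem norm_fcoeff_mul_pow_le' {ρ : ℝ → ℂ} (hρ : ContDiff ℝ ∞ ρ)
    (hp : Function.Periodic ρ (2 * Real.pi)) {k : ℕ} {A : ℝ}
    (hA : ∀ l ≤ k + 2, ∀ t, ‖iteratedDeriv l ρ t‖ ≤ A) (n : ℤ) :
    ‖fcoeff ρ n‖ * (1 + |(n : ℝ)|) ^ k ≤ 2 ^ (k + 2) * A * ((1 + |(n : ℝ)|) ^ 2)⁻¹ := by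
  have := norm_fcoeff_mul_pow_le hρ hp hA n
  rw [pow_add, ← mul_assoc] at this
  rwa [← div_eq_mul_inv, le_div_iff₀ (by positivity)]

theorem wnorm_fcoeff_le (k : ℕ) : ∃ C, 0 ≤ C ∧ ∀ ρ : ℝ → ℂ, ContDiff ℝ ∞ ρ →
    Function.Periodic ρ (2 * Real.pi) → ∀ A, (∀ l ≤ k + 2, ∀ t, ‖iteratedDeriv l ρ t‖ ≤ A) →
    wnorm k (fcoeff ρ) ≤ C * A := by
  refine ⟨2 ^ (k + 2) * ∑' n : ℤ, ((1 + |(n : ℝ)|) ^ 2)⁻¹, mul_nonneg (by positivity)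
    (tsum_nonneg fun n => by positivity), fun ρ hρ hp A hA => ?_⟩
  have hs := summable_inv_one_add_abs_sq.mul_left (2 ^ (k + 2) * A)
  have := (hs.of_nonneg_of_le (fun n => by positivity)
    (norm_fcoeff_mul_pow_le' hρ hp hA)).tsum_le_tsum (norm_fcoeff_mul_pow_le' hρ hp hA) hs
  rw [tsum_mul_left] at this
  exact this.trans_eq (by ring)

theorem exists_iteratedDeriv_bound {ρ : ℝ → ℂ} (hρ : ContDiff ℝ ∞ ρ)
    (hp : Function.Periodic ρ (2 * Real.pi)) (k : ℕ) :
    ∃ A, ∀ l ≤ k, ∀ t, ‖iteratedDeriv l ρ t‖ ≤ A := by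
  choose C hC using (smoothBdd_of_periodic hρ Real.two_pi_pos.ne' hp).2
  refine ⟨∑ l ∈ Finset.range (k + 1), C l, fun l hl t => ?_⟩
  rw [← norm_iteratedFDeriv_eq_norm_iteratedDeriv]
  exact (hC l t).trans (Finset.single_le_sum (f := C)
    (fun i _ => (norm_nonneg _).trans (hC i 0)) (Finset.mem_range.2 (by omega)))

theorem rapidDecay_fcoeff {ρ : ℝ → ℂ} (hρ : ContDiff ℝ ∞ ρ)
    (hp : Function.Periodic ρ (2 * Real.pi)) : RapidDecay (fcoeff ρ) := by
  intro k
  obtain ⟨A, hA⟩ := exists_iteratedDeriv_bound hρ hp (k + 2)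
  exact (summable_inv_one_add_abs_sq.mul_left (2 ^ (k + 2) * A)).of_nonneg_of_le
    (fun n => by positivity) (norm_fcoeff_mul_pow_le' hρ hp hA)

theorem hasSum_fcoeff {ρ : ℝ → ℂ} (hρ : ContDiff ℝ ∞ ρ)
    (hp : Function.Periodic ρ (2 * Real.pi)) (t : ℝ) :
    HasSum (fun n : ℤ => fcoeff ρ n * cexp (n * t * I)) (ρ t) := by
  have : Fact (0 < 2 * Real.pi) := ⟨Real.two_pi_pos⟩
  have hpi : (Real.pi : ℂ) ≠ 0 := ofReal_ne_zero.2 Real.pi_ne_zero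
  let f : C(AddCircle (2 * Real.pi), ℂ) :=
    ⟨hp.lift, continuous_coinduced_dom.2 hρ.continuous⟩
  have hf : ∀ n, fourierCoeff f n = fcoeff ρ n := by
    intro n
    rw [fourierCoeff_eq_intervalIntegral f n 0, zero_add, fcoeff, real_smul]
    congr 1
    · push_cast; ring
    · refine intervalIntegral.integral_congr fun t _ => ?_
      simp only [smul_eq_mul, fourier_coe_apply]
      rw [mul_comm]
      congr 1
      congr 1
      push_cast
      field_simp
  have hs : Summable (fourierCoeff f) := by
    have := rapidDecay_fcoeff hρ hp 0
    simp only [pow_zero, mul_one] at this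
    rw [funext hf]
    exact this.of_norm
  have := has_pointwise_sum_fourier_series_of_summable hs (t : AddCircle (2 * Real.pi))
  simp only [hf, fourier_coe_apply, smul_eq_mul] at this
  have hft : f t = ρ t := hp.lift_coe t
  rw [hft] at this
  convert this using 4 with n
  push_cast
  field_simp

theorem aae_fcoeff {φ : ℝ → ℂ} (h0 : φ 0 = 1) {ρ : ℝ → ℂ} (hρ : ContDiff ℝ ∞ ρ)
    (hp : Function.Periodic ρ (2 * Real.pi)) (t : ℝ) : aae φ (fcoeff ρ) t 0 = ρ t := by
  rw [← (hasSum_fcoeff hρ hp t).tsum_eq, aae]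
  simp [h0]

/-- The Jacobian `∂ₜf ∂ₛΓ - ∂ₛf ∂ₜΓ`, i.e. the coefficient of `df ∧ dΓ`. -/
def jac (f Γ : ℝ × ℝ → ℂ) (p : ℝ × ℝ) : ℂ :=
  fderiv ℝ f p (1, 0) * fderiv ℝ Γ p (0, 1) - fderiv ℝ f p (0, 1) * fderiv ℝ Γ p (1, 0)

theorem hasFDerivAt_fderiv_apply {Γ : ℝ × ℝ → ℂ} (hΓ : ContDiff ℝ ∞ Γ) (v p : ℝ × ℝ) :
    HasFDerivAt (fun p => fderiv ℝ Γ p v) ((fderiv ℝ (fderiv ℝ Γ) p).flip v) p := by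
  have h : ContDiff ℝ 1 (fderiv ℝ Γ) := hΓ.fderiv_right (by norm_cast)
  have := ((h.differentiable (by norm_num)) p).hasFDerivAt.clm_apply (hasFDerivAt_const v p)
  refine this.congr_fderiv ?_
  ext <;> simp

theorem hasFDerivAt_form {f Γ : ℝ × ℝ → ℂ} (hf : ContDiff ℝ ∞ f) (hΓ : ContDiff ℝ ∞ Γ) {z : ℂ}
    {p : ℝ × ℝ} (hz : z - Γ p ≠ 0) (v : ℝ × ℝ) :
    ∃ D : ℝ × ℝ →L[ℝ] ℂ, HasFDerivAt (fun p => f p * fderiv ℝ Γ p v * (z - Γ p)⁻¹) D p ∧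
      ∀ w, D w = (fderiv ℝ f p w * fderiv ℝ Γ p v + f p * fderiv ℝ (fderiv ℝ Γ) p w v)
        * (z - Γ p)⁻¹ + f p * fderiv ℝ Γ p v * (fderiv ℝ Γ p w * ((z - Γ p)⁻¹) ^ 2) := by
  have h1 : HasFDerivAt f (fderiv ℝ f p) p := ((hf.differentiable (by simp)) p).hasFDerivAt
  have h2 : HasFDerivAt Γ (fderiv ℝ Γ p) p := ((hΓ.differentiable (by simp)) p).hasFDerivAt
  have h3 := (hasDerivAt_inv hz).comp_hasFDerivAt_of_eq p (h2.const_sub z) rfl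
  refine ⟨_, (h1.mul (hasFDerivAt_fderiv_apply hΓ v p)).mul h3, fun w => ?_⟩
  simp
  ring

theorem continuous_fderiv_apply {Γ : ℝ × ℝ → ℂ} (hΓ : ContDiff ℝ ∞ Γ) (v : ℝ × ℝ) :
    Continuous fun p => fderiv ℝ Γ p v :=
  (hΓ.continuous_fderiv (by simp)).clm_apply continuous_const

theorem continuous_jac {f Γ : ℝ × ℝ → ℂ} (hf : ContDiff ℝ ∞ f) (hΓ : ContDiff ℝ ∞ Γ) :
    Continuous (jac f Γ) :=
  ((continuous_fderiv_apply hf _).mul (continuous_fderiv_apply hΓ _)).sub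
    ((continuous_fderiv_apply hf _).mul (continuous_fderiv_apply hΓ _))

theorem fderiv_periodic_fst {Γ : ℝ × ℝ → ℂ} {T : ℝ} (hp : ∀ t s, Γ (t + T, s) = Γ (t, s))
    (t s : ℝ) : fderiv ℝ Γ (t + T, s) = fderiv ℝ Γ (t, s) := by
  have : (fun p : ℝ × ℝ => Γ (p + (T, 0))) = Γ := by
    funext ⟨t, s⟩
    simpa using hp t s
  have h2 := fderiv_comp_add_right (𝕜 := ℝ) (f := Γ) (x := (t, s)) (T, 0)
  rw [this] at h2
  simpa using h2.symm

/-- Stokes' theorem for the form `f dΓ / (z - Γ)` on a periodic strip. -/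
theorem integral_jac_div_eq {f Γ : ℝ × ℝ → ℂ} (hf : ContDiff ℝ ∞ f) (hΓ : ContDiff ℝ ∞ Γ)
    {T ε : ℝ} (hT : 0 ≤ T) (hε : 0 ≤ ε) (hfp : ∀ t s, f (t + T, s) = f (t, s))
    (hΓp : ∀ t s, Γ (t + T, s) = Γ (t, s)) (hfε : ∀ t, f (t, ε) = 0) {z : ℂ}
    (hz : ∀ t ∈ Icc 0 T, ∀ s ∈ Icc 0 ε, Γ (t, s) ≠ z) :
    ∫ t in (0 : ℝ)..T, ∫ s in (0 : ℝ)..ε, jac f Γ (t, s) * (z - Γ (t, s))⁻¹ =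
      ∫ t in (0 : ℝ)..T, f (t, 0) * fderiv ℝ Γ (t, 0) (1, 0) * (z - Γ (t, 0))⁻¹ := by
  have hz' : ∀ p ∈ Icc 0 T ×ˢ Icc 0 ε, z - Γ p ≠ 0 := fun p hp =>
    sub_ne_zero.2 (hz p.1 hp.1 p.2 hp.2).symm
  have hcinv : ContinuousOn (fun p => (z - Γ p)⁻¹) (Icc 0 T ×ˢ Icc 0 ε) :=
    (continuous_const.sub hΓ.continuous).continuousOn.inv₀ hz'
  have hcform : ∀ v : ℝ × ℝ, ContinuousOn (fun p => f p * fderiv ℝ Γ p v * (z - Γ p)⁻¹)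
      (Icc 0 T ×ˢ Icc 0 ε) := fun v =>
    (hf.continuous.mul (continuous_fderiv_apply hΓ v)).continuousOn.mul hcinv
  have hd : ∀ v : ℝ × ℝ, ∃ D : ℝ × ℝ → ℝ × ℝ →L[ℝ] ℂ, ∀ p ∈ Icc 0 T ×ˢ Icc 0 ε,
      HasFDerivAt (fun p => f p * fderiv ℝ Γ p v * (z - Γ p)⁻¹) (D p) p ∧
      ∀ w, D p w = (fderiv ℝ f p w * fderiv ℝ Γ p v + f p * fderiv ℝ (fderiv ℝ Γ) p w v)
        * (z - Γ p)⁻¹ + f p * fderiv ℝ Γ p v * (fderiv ℝ Γ p w * ((z - Γ p)⁻¹) ^ 2) := by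
    intro v
    have : ∀ p : ℝ × ℝ, ∃ D : ℝ × ℝ →L[ℝ] ℂ, p ∈ Icc 0 T ×ˢ Icc 0 ε →
      HasFDerivAt (fun p => f p * fderiv ℝ Γ p v * (z - Γ p)⁻¹) D p ∧
      ∀ w, D w = (fderiv ℝ f p w * fderiv ℝ Γ p v + f p * fderiv ℝ (fderiv ℝ Γ) p w v)
        * (z - Γ p)⁻¹ + f p * fderiv ℝ Γ p v * (fderiv ℝ Γ p w * ((z - Γ p)⁻¹) ^ 2) := by
      intro p
      by_cases hp : p ∈ Icc 0 T ×ˢ Icc 0 ε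
      · obtain ⟨D, hD⟩ := hasFDerivAt_form hf hΓ (hz' p hp) v
        exact ⟨D, fun _ => hD⟩
      · exact ⟨0, fun h => absurd h hp⟩
    choose D hD using this
    exact ⟨D, hD⟩
  obtain ⟨DQ, hDQ⟩ := hd (0, 1)
  obtain ⟨DP, hDP⟩ := hd (1, 0)
  have hkey : ∀ p ∈ Icc 0 T ×ˢ Icc 0 ε, DQ p (1, 0) + (-DP p) (0, 1) =
      jac f Γ p * (z - Γ p)⁻¹ := by
    intro p hp
    have hsymm := (hΓ.contDiffAt (x := p)).isSymmSndFDerivAt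
      (by simpa using (by norm_cast : ((2 : ℕ∞) : WithTop ℕ∞) ≤ ∞)) (1, 0) (0, 1)
    rw [_root_.neg_apply, (hDQ p hp).2, (hDP p hp).2, jac, hsymm]
    ring
  have hsub : Ioo (min 0 T) (max 0 T) ×ˢ Ioo (min 0 ε) (max 0 ε) ⊆ Icc 0 T ×ˢ Icc 0 ε := by
    rw [min_eq_left hT, max_eq_right hT, min_eq_left hε, max_eq_right hε]
    exact prod_mono Ioo_subset_Icc_self Ioo_subset_Icc_self
  have main := integral2_divergence_prod_of_hasFDerivAt
    (fun p => f p * fderiv ℝ Γ p (0, 1) * (z - Γ p)⁻¹)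
    (fun p => -(f p * fderiv ℝ Γ p (1, 0) * (z - Γ p)⁻¹)) DQ (fun p => -DP p) 0 0 T ε
    (by rw [uIcc_of_le hT, uIcc_of_le hε]; exact hcform _)
    (by rw [uIcc_of_le hT, uIcc_of_le hε]; exact (hcform _).neg)
    (fun p hp => (hDQ p (hsub hp)).1) (fun p hp => (hDP p (hsub hp)).1.neg)
    (by
      rw [uIcc_of_le hT, uIcc_of_le hε]
      refine IntegrableOn.congr_fun (f := fun p => jac f Γ p * (z - Γ p)⁻¹) ?_
        (fun p hp => (hkey p hp).symm) (measurableSet_Icc.prod measurableSet_Icc)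
      exact ((continuous_jac hf hΓ).continuousOn.mul hcinv).integrableOn_compact
        (isCompact_Icc.prod isCompact_Icc))
  have hL : ∫ t in (0 : ℝ)..T, ∫ s in (0 : ℝ)..ε, jac f Γ (t, s) * (z - Γ (t, s))⁻¹ =
      ∫ t in (0 : ℝ)..T, ∫ s in (0 : ℝ)..ε, DQ (t, s) (1, 0) + (-DP (t, s)) (0, 1) := by
    refine intervalIntegral.integral_congr fun t ht => intervalIntegral.integral_congr
      fun s hs => ?_
    rw [uIcc_of_le hT] at ht
    rw [uIcc_of_le hε] at hs
    exact (hkey (t, s) ⟨ht, hs⟩).symm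
  have hper : ∀ s, f (T, s) * fderiv ℝ Γ (T, s) (0, 1) * (z - Γ (T, s))⁻¹ =
      f (0, s) * fderiv ℝ Γ (0, s) (0, 1) * (z - Γ (0, s))⁻¹ := by
    intro s
    have h1 := hfp 0 s
    have h2 := hΓp 0 s
    have h3 := fderiv_periodic_fst hΓp 0 s
    rw [zero_add] at h1 h2 h3
    rw [h1, h2, h3]
  rw [hL, main]
  simp only [hper, hfε, zero_mul, neg_zero, intervalIntegral.integral_zero,
    intervalIntegral.integral_neg]
  ring

/-- A smooth bump on `ℝ`, equal to `1` on `[-1/2, 1/2]` and supported in `[-1, 1]`. -/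
def cutoffBump : ContDiffBump (0 : ℝ) := ⟨1 / 2, 1, by norm_num, by norm_num⟩

/-- The bump function as a complex-valued function. -/
def cutoff (y : ℝ) : ℂ := (cutoffBump y : ℂ)

theorem contDiff_cutoff : ContDiff ℝ ∞ cutoff :=
  ofRealCLM.contDiff.comp cutoffBump.contDiff

theorem cutoff_eq_one {y : ℝ} (hy : |y| ≤ 1 / 2) : cutoff y = 1 := by
  rw [cutoff, cutoffBump.one_of_mem_closedBall (by simpa [cutoffBump] using hy), ofReal_one]

theorem cutoff_eq_zero {y : ℝ} (hy : 1 ≤ |y|) : cutoff y = 0 := by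
  rw [cutoff, cutoffBump.zero_of_le_dist (by simpa [cutoffBump] using hy), ofReal_zero]

theorem norm_cutoff_le (y : ℝ) : ‖cutoff y‖ ≤ 1 := by
  rw [cutoff, norm_real, Real.norm_of_nonneg cutoffBump.nonneg]
  exact cutoffBump.le_one

theorem hasCompactSupport_cutoff : HasCompactSupport cutoff :=
  HasCompactSupport.intro (isCompact_closedBall (0 : ℝ) 1) fun y hy => cutoff_eq_zero (by
    simp only [mem_closedBall, dist_zero_right, Real.norm_eq_abs, not_le] at hy
    exact hy.le)

theorem deriv_cutoff_eq_zero {y : ℝ} (hy : |y| < 1 / 2) : deriv cutoff y = 0 := by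
  have : cutoff =ᶠ[nhds y] fun _ => 1 := by
    filter_upwards [continuous_abs.continuousAt.eventually_lt continuousAt_const hy] with x hx
    exact cutoff_eq_one hx.le
  rw [this.deriv_eq, deriv_const]

theorem exists_norm_le_mul_abs_pow {f : ℝ → ℂ} {A : ℝ} (hA : ∀ y, ‖f y‖ ≤ A)
    (h0 : ∀ y, |y| < 1 / 2 → f y = 0) (k : ℕ) (y : ℝ) : ‖f y‖ ≤ A * 2 ^ k * |y| ^ k := by
  have hA0 : 0 ≤ A := (norm_nonneg _).trans (hA 0)
  rcases lt_or_ge |y| (1 / 2) with h | h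
  · rw [h0 y h, norm_zero]; positivity
  · rw [mul_assoc, ← mul_pow]
    exact (hA y).trans (le_mul_of_one_le_right hA0 (one_le_pow₀ (by linarith)))

/-- The profile `e^{-σy}` cut off. -/
def profile (σ y : ℝ) : ℂ := cexp (-(σ * y : ℝ)) * cutoff y

/-- The error `φ' + σφ` of the profile `φ`. -/
def profileErr (σ y : ℝ) : ℂ := cexp (-(σ * y : ℝ)) * deriv cutoff y

theorem contDiff_cexp_neg (σ : ℝ) : ContDiff ℝ ∞ fun y : ℝ => cexp (-(σ * y : ℝ)) :=
  (contDiff_exp.comp (ofRealCLM.contDiff.comp (contDiff_const.mul contDiff_id)).neg).of_le le_top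

theorem smoothBdd_profile (σ : ℝ) : SmoothBdd (profile σ) :=
  smoothBdd_of_hasCompactSupport ((contDiff_cexp_neg σ).mul contDiff_cutoff)
    hasCompactSupport_cutoff.mul_left

theorem smoothBdd_profileErr (σ : ℝ) : SmoothBdd (profileErr σ) :=
  smoothBdd_of_hasCompactSupport ((contDiff_cexp_neg σ).mul
    (contDiff_infty_iff_deriv.1 contDiff_cutoff).2) hasCompactSupport_cutoff.deriv.mul_left

theorem SmoothBdd.exists_bound {f : ℝ → ℂ} (hf : SmoothBdd f) : ∃ C, 0 ≤ C ∧ ∀ y, ‖f y‖ ≤ C := by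
  obtain ⟨C, hC⟩ := hf.2 0
  simp only [norm_iteratedFDeriv_zero] at hC
  exact ⟨C, (norm_nonneg _).trans (hC 0), hC⟩

theorem SmoothBdd.exists_bound_deriv {f : ℝ → ℂ} (hf : SmoothBdd f) :
    ∃ C, ∀ y, ‖deriv f y‖ ≤ C := by
  obtain ⟨C, hC⟩ := hf.2 1
  simp only [norm_iteratedFDeriv_eq_norm_iteratedDeriv, iteratedDeriv_one] at hC
  exact ⟨C, hC⟩

theorem profile_zero (σ : ℝ) : profile σ 0 = 1 := by
  simp [profile, cutoff_eq_one (y := 0)]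

theorem hasDerivAt_profile (σ y : ℝ) :
    HasDerivAt (profile σ) (-σ * profile σ y + profileErr σ y) y := by
  have h1 : HasDerivAt (fun y : ℝ => cexp (-(σ * y : ℝ))) (cexp (-(σ * y : ℝ)) * -σ) y := by
    refine HasDerivAt.cexp ?_
    refine (((hasDerivAt_id y).const_mul σ).ofReal_comp).neg.congr_deriv ?_
    simp
  refine (h1.mul ((contDiff_cutoff.differentiable (by simp)) y).hasDerivAt).congr_deriv ?_
  rw [profile, profileErr]; ring

theorem exists_norm_profileErr_le (σ : ℝ) (k : ℕ) :
    ∃ C, 0 ≤ C ∧ ∀ y, ‖profileErr σ y‖ ≤ C * |y| ^ k := by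
  obtain ⟨A, hA0, hA⟩ := (smoothBdd_profileErr σ).exists_bound
  exact ⟨A * 2 ^ k, by positivity, exists_norm_le_mul_abs_pow hA (fun y hy => by
    rw [profileErr, deriv_cutoff_eq_zero hy, mul_zero]) k⟩

theorem wnorm_mono {a : ℤ → ℂ} (ha : RapidDecay a) {j k : ℕ} (h : j ≤ k) :
    wnorm j a ≤ wnorm k a := by
  refine (ha j).tsum_le_tsum (fun n => ?_) (ha k)
  gcongr
  linarith [abs_nonneg (n : ℝ)]

/-- The almost holomorphic extension to the side `σ` of the strip. -/
def stripExt (σ : ℝ) (a : ℤ → ℂ) (p : ℝ × ℝ) : ℂ := aae (profile σ) a p.1 p.2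

/-- The flat error term of the almost holomorphic extension. -/
def extErr (σ : ℝ) (a : ℤ → ℂ) (p : ℝ × ℝ) : ℂ :=
  aae (profileErr σ) (fun n => 1 * n * a n) p.1 p.2

theorem contDiff_ext (σ : ℝ) {a : ℤ → ℂ} (ha : RapidDecay a) : ContDiff ℝ ∞ (stripExt σ a) :=
  contDiff_aae (smoothBdd_profile σ) ha

theorem ext_periodic (σ : ℝ) (a : ℤ → ℂ) (t s : ℝ) :
    stripExt σ a (t + 2 * Real.pi, s) = stripExt σ a (t, s) := aae_periodic _ _ _ _

theorem fderiv_ext_fst (σ : ℝ) {a : ℤ → ℂ} (ha : RapidDecay a) (p : ℝ × ℝ) :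
    fderiv ℝ (stripExt σ a) p (1, 0) = stripExt σ (fun n => I * n * a n) p := by
  obtain ⟨C, -, hC⟩ := (smoothBdd_profile σ).exists_bound
  have h1 := hasDerivAt_aae_left hC ha p.1 p.2
  have h2 : HasFDerivAt (stripExt σ a) (fderiv ℝ (stripExt σ a) p) p :=
    (((contDiff_ext σ ha).differentiable (by simp)) p).hasFDerivAt
  have h3 : HasDerivAt (fun t : ℝ => (t, p.2)) ((1 : ℝ), (0 : ℝ)) p.1 :=
    (hasDerivAt_id _).prodMk (hasDerivAt_const _ _)
  exact (h2.comp_hasDerivAt_of_eq p.1 h3 rfl).unique h1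

theorem fderiv_ext_snd (σ : ℝ) {a : ℤ → ℂ} (ha : RapidDecay a) (p : ℝ × ℝ) :
    fderiv ℝ (stripExt σ a) p (0, 1) =
      I * σ * stripExt σ (fun n => I * n * a n) p + extErr σ a p := by
  obtain ⟨C, -, hC⟩ := (smoothBdd_profile σ).exists_bound
  obtain ⟨C2, -, hC2⟩ := (smoothBdd_profileErr σ).exists_bound
  obtain ⟨C', hC'⟩ := (smoothBdd_profile σ).exists_bound_deriv
  have h1 := hasDerivAt_aae_right hC ((smoothBdd_profile σ).1.differentiable (by simp)) hC' ha
    p.1 p.2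
  have h2 : HasFDerivAt (stripExt σ a) (fderiv ℝ (stripExt σ a) p) p :=
    (((contDiff_ext σ ha).differentiable (by simp)) p).hasFDerivAt
  have h3 : HasDerivAt (fun s : ℝ => (p.1, s)) ((0 : ℝ), (1 : ℝ)) p.2 :=
    (hasDerivAt_const _ _).prodMk (hasDerivAt_id _)
  refine ((h2.comp_hasDerivAt_of_eq p.2 h3 rfl).unique h1).trans ?_
  have hd : deriv (profile σ) = fun y => -σ * profile σ y + profileErr σ y :=
    funext fun y => (hasDerivAt_profile σ y).deriv
  rw [stripExt, extErr, aae, aae, aae, hd, ← tsum_mul_left, ← Summable.tsum_add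
    ((summable_aae hC (ha.mul_int I) _ _).mul_left _) (summable_aae hC2 (ha.mul_int 1) _ _)]
  refine tsum_congr fun n => ?_
  ring_nf
  rw [I_sq]
  ring

theorem exists_norm_ext_le (σ : ℝ) : ∃ C, 0 ≤ C ∧ ∀ a, RapidDecay a → ∀ p,
    ‖stripExt σ a p‖ ≤ C * wnorm 0 a := by
  obtain ⟨C, hC0, hC⟩ := (smoothBdd_profile σ).exists_bound
  exact ⟨C, hC0, fun a ha p =>
    (norm_aae_le hC0 (k := 0) (by simpa using hC) ha p.1 p.2).trans_eq (by simp)⟩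

theorem exists_norm_extErr_le (σ : ℝ) (k : ℕ) : ∃ C, 0 ≤ C ∧ ∀ a, RapidDecay a → ∀ p : ℝ × ℝ,
    ‖extErr σ a p‖ ≤ C * |p.2| ^ k * wnorm (k + 1) a := by
  obtain ⟨C, hC0, hC⟩ := exists_norm_profileErr_le σ k
  refine ⟨C, hC0, fun a ha p => (norm_aae_le hC0 hC (ha.mul_int 1) p.1 p.2).trans ?_⟩
  gcongr
  simpa using ha.wnorm_mul_int_le 1 k

theorem norm_ext_mul_int_le {σ C : ℝ} (hC : 0 ≤ C)
    (h : ∀ a, RapidDecay a → ∀ p, ‖stripExt σ a p‖ ≤ C * wnorm 0 a) {a : ℤ → ℂ} (ha : RapidDecay a)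
    (p : ℝ × ℝ) : ‖stripExt σ (fun n => I * n * a n) p‖ ≤ C * wnorm 1 a := by
  refine (h _ (ha.mul_int I) p).trans ?_
  gcongr
  simpa using ha.wnorm_mul_int_le I 0

/-- The extension cut off at height `ε`. -/
def extCut (ε σ : ℝ) (a : ℤ → ℂ) (p : ℝ × ℝ) : ℂ := cutoff (ε⁻¹ * p.2) * stripExt σ a p

theorem contDiff_extCut (ε σ : ℝ) {a : ℤ → ℂ} (ha : RapidDecay a) :
    ContDiff ℝ ∞ (extCut ε σ a) :=
  (contDiff_cutoff.comp (contDiff_const.mul contDiff_snd)).mul (contDiff_ext σ ha)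

theorem fderiv_extCut (ε σ : ℝ) {a : ℤ → ℂ} (ha : RapidDecay a) (p v : ℝ × ℝ) :
    fderiv ℝ (extCut ε σ a) p v = cutoff (ε⁻¹ * p.2) * fderiv ℝ (stripExt σ a) p v +
      (ε⁻¹ : ℝ) * v.2 * deriv cutoff (ε⁻¹ * p.2) * stripExt σ a p := by
  have h1 : HasFDerivAt (stripExt σ a) (fderiv ℝ (stripExt σ a) p) p :=
    (((contDiff_ext σ ha).differentiable (by simp)) p).hasFDerivAt
  have h2 : HasDerivAt cutoff (deriv cutoff (ε⁻¹ * p.2)) (ε⁻¹ * p.2) :=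
    ((contDiff_cutoff.differentiable (by simp)) _).hasDerivAt
  have h3 : HasFDerivAt (fun p : ℝ × ℝ => ε⁻¹ * p.2) (ε⁻¹ • ContinuousLinearMap.snd ℝ ℝ ℝ) p :=
    hasFDerivAt_snd.const_mul ε⁻¹
  have h4 : HasFDerivAt (fun p : ℝ × ℝ => cutoff (ε⁻¹ * p.2))
      ((ε⁻¹ • ContinuousLinearMap.snd ℝ ℝ ℝ).smulRight (deriv cutoff (ε⁻¹ * p.2))) p :=
    (HasFDerivAt.comp (g := cutoff) (f := fun p : ℝ × ℝ => ε⁻¹ * p.2) p h2.hasFDerivAt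
      h3).congr_fderiv (by ext <;> simp)
  have h5 : HasFDerivAt (extCut ε σ a) _ p := h4.mul h1
  rw [h5.fderiv]
  simp [real_smul]
  ring

theorem jac_extCut (ε σ : ℝ) {a b : ℤ → ℂ} (ha : RapidDecay a) (hb : RapidDecay b) (p : ℝ × ℝ) :
    jac (extCut ε σ a) (stripExt σ b) p =
      cutoff (ε⁻¹ * p.2) * (stripExt σ (fun n => I * n * a n) p * extErr σ b p
        - extErr σ a p * stripExt σ (fun n => I * n * b n) p)
      - (ε⁻¹ : ℝ) * deriv cutoff (ε⁻¹ * p.2) * stripExt σ a p *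
          stripExt σ (fun n => I * n * b n) p := by
  rw [jac, fderiv_extCut ε σ ha, fderiv_extCut ε σ ha, fderiv_ext_fst σ ha, fderiv_ext_snd σ ha,
    fderiv_ext_fst σ hb, fderiv_ext_snd σ hb]
  push_cast
  ring

theorem exists_norm_jac_extCut_le {ε : ℝ} (hε : 0 < ε) (σ : ℝ) {b : ℤ → ℂ} (hb : RapidDecay b)
    (k : ℕ) : ∃ C, 0 ≤ C ∧ ∀ a, RapidDecay a → ∀ p : ℝ × ℝ,
      ‖jac (extCut ε σ a) (stripExt σ b) p‖ ≤ C * |p.2| ^ k * wnorm (k + 1) a := by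
  obtain ⟨E, hE0, hE⟩ := exists_norm_ext_le σ
  obtain ⟨F, hF0, hF⟩ := exists_norm_extErr_le σ k
  obtain ⟨A, hA⟩ := (smoothBdd_of_hasCompactSupport contDiff_cutoff
    hasCompactSupport_cutoff).exists_bound_deriv
  have hA0 : 0 ≤ A := (norm_nonneg _).trans (hA 0)
  have hA' := exists_norm_le_mul_abs_pow hA (fun y => deriv_cutoff_eq_zero) k
  have hw1 := wnorm_nonneg 1 b
  have hwk := wnorm_nonneg (k + 1) b
  refine ⟨E * (F * wnorm (k + 1) b) + F * (E * wnorm 1 b) +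
    ε⁻¹ * (A * 2 ^ k * ε⁻¹ ^ k) * E * (E * wnorm 1 b), by positivity, fun a ha p => ?_⟩
  rw [jac_extCut ε σ ha hb]
  have a0 := wnorm_mono ha (Nat.zero_le (k + 1))
  have a1 := wnorm_mono ha (Nat.le_add_left 1 k)
  have w0 := wnorm_nonneg 0 a
  have w1 := wnorm_nonneg 1 a
  have w2 := wnorm_nonneg (k + 1) a
  have e1 : ‖stripExt σ (fun n => I * n * a n) p‖ ≤ E * wnorm (k + 1) a :=
    (norm_ext_mul_int_le hE0 hE ha p).trans (by gcongr)
  have e2 := norm_ext_mul_int_le hE0 hE hb p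
  have e3 : ‖stripExt σ a p‖ ≤ E * wnorm (k + 1) a := (hE a ha p).trans (by gcongr)
  have f1 := hF a ha p
  have f2 := hF b hb p
  have c1 := norm_cutoff_le (ε⁻¹ * p.2)
  have c2 : ‖deriv cutoff (ε⁻¹ * p.2)‖ ≤ A * 2 ^ k * (ε⁻¹ ^ k * |p.2| ^ k) := by
    have := hA' (ε⁻¹ * p.2)
    rwa [abs_mul, mul_pow, abs_of_pos (inv_pos.2 hε)] at this
  have n1 : ‖((ε⁻¹ : ℝ) : ℂ)‖ = ε⁻¹ := by rw [norm_real, Real.norm_of_nonneg (by positivity)]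
  calc _ ≤ ‖cutoff (ε⁻¹ * p.2)‖ * (‖stripExt σ (fun n => I * n * a n) p‖ * ‖extErr σ b p‖
        + ‖extErr σ a p‖ * ‖stripExt σ (fun n => I * n * b n) p‖)
      + ‖((ε⁻¹ : ℝ) : ℂ)‖ * ‖deriv cutoff (ε⁻¹ * p.2)‖ * ‖stripExt σ a p‖ *
        ‖stripExt σ (fun n => I * n * b n) p‖ := by
        refine (norm_sub_le _ _).trans ?_
        simp only [norm_mul]
        gcongr
        refine (norm_sub_le _ _).trans ?_
        simp only [norm_mul, le_refl]
    _ ≤ 1 * ((E * wnorm (k + 1) a) * (F * |p.2| ^ k * wnorm (k + 1) b)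
        + (F * |p.2| ^ k * wnorm (k + 1) a) * (E * wnorm 1 b))
      + ε⁻¹ * (A * 2 ^ k * (ε⁻¹ ^ k * |p.2| ^ k)) * (E * wnorm (k + 1) a) * (E * wnorm 1 b) := by
        rw [n1]
        gcongr
    _ = _ := by ring

/-- The standard parametrization of the unit circle. -/
def circ (t : ℝ) : ℂ := cexp (t * I)

theorem smoothBdd_circ : SmoothBdd circ := smoothBdd_cexp

theorem norm_circ (t : ℝ) : ‖circ t‖ = 1 := norm_exp_ofReal_mul_I t

theorem circ_ne_zero (t : ℝ) : circ t ≠ 0 := exp_ne_zero _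

theorem circ_add_two_pi (t : ℝ) : circ (t + 2 * Real.pi) = circ t := by
  rw [circ, circ]
  push_cast
  rw [add_mul, Complex.exp_add, exp_two_pi_mul_I, mul_one]

theorem circ_periodic : Function.Periodic circ (2 * Real.pi) := circ_add_two_pi

theorem circ_int_mul (n : ℤ) (t : ℝ) : cexp (n * t * I) = circ t ^ n := by
  rw [circ, ← exp_int_mul, mul_assoc]

theorem hasDerivAt_circ (t : ℝ) : HasDerivAt circ (I * circ t) t := by
  have h : HasDerivAt (fun t : ℝ => (t : ℂ) * I) I t :=
    (ofRealCLM.hasDerivAt.mul_const I).congr_deriv (by simp)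
  exact h.cexp.congr_deriv (by rw [circ]; ring)

/-- Points on the circle are as close as representatives of their arguments. -/
theorem exists_int_abs_sub_le (s t : ℝ) :
    ∃ k : ℤ, |s - t - k * (2 * Real.pi)| ≤ Real.pi / 2 * ‖circ s - circ t‖ := by
  have hpi := Real.pi_pos
  refine ⟨round ((s - t) / (2 * Real.pi)), ?_⟩
  set k := round ((s - t) / (2 * Real.pi)) with hk
  set u := s - t - k * (2 * Real.pi) with hu
  have hu1 : |u| ≤ Real.pi := by
    have h := abs_sub_round ((s - t) / (2 * Real.pi))
    have : u = ((s - t) / (2 * Real.pi) - k) * (2 * Real.pi) := by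
      rw [hu]; field_simp
    rw [this, abs_mul, abs_of_pos (by positivity : 0 < 2 * Real.pi)]
    nlinarith
  have h1 : ‖circ s - circ t‖ = ‖cexp (I * u) - 1‖ := by
    have : circ s = circ t * cexp (I * u) := by
      rw [circ, circ, ← Complex.exp_add, exp_eq_exp_iff_exists_int]
      exact ⟨k, by rw [hu]; push_cast; ring⟩
    rw [this, ← mul_sub_one, norm_mul, norm_circ, one_mul]
  rw [h1, norm_exp_I_mul_ofReal_sub_one, Real.norm_eq_abs, abs_mul, abs_two]
  have h2 : |u / 2| ≤ Real.pi / 2 := by rw [abs_div, abs_two]; linarith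
  have h3 := Real.mul_abs_le_abs_sin h2
  rw [abs_div, abs_two] at h3
  calc |u| = Real.pi / 2 * (2 * (2 / Real.pi * (|u| / 2))) := by field_simp
    _ ≤ _ := by gcongr

theorem exists_int_of_circ_eq {s t : ℝ} (h : circ s = circ t) :
    ∃ k : ℤ, s = t + k * (2 * Real.pi) := by
  obtain ⟨k, hk⟩ := exists_int_abs_sub_le s t
  rw [h, sub_self, norm_zero, mul_zero] at hk
  exact ⟨k, by linarith [abs_nonpos_iff.1 hk]⟩

/-- A periodic function with bounded derivative is Lipschitz for the distance on the circle. -/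
theorem norm_sub_le_of_periodic {f : ℝ → ℂ} (hf : Differentiable ℝ f)
    (hp : Function.Periodic f (2 * Real.pi)) {A : ℝ} (hA : ∀ t, ‖deriv f t‖ ≤ A) (s t : ℝ) :
    ‖f s - f t‖ ≤ A * (Real.pi / 2) * ‖circ s - circ t‖ := by
  obtain ⟨k, hk⟩ := exists_int_abs_sub_le s t
  have h1 : f s = f (s - k * (2 * Real.pi)) := (hp.sub_int_mul_eq k).symm
  have hA0 : 0 ≤ A := (norm_nonneg _).trans (hA 0)
  rw [h1]
  have := convex_univ.norm_image_sub_le_of_norm_deriv_le (𝕜 := ℝ) (f := f) (C := A)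
    (fun x _ => hf x) (fun x _ => hA x) (mem_univ t) (mem_univ (s - k * (2 * Real.pi)))
  refine this.trans ?_
  rw [mul_assoc]
  gcongr
  rw [Real.norm_eq_abs, sub_right_comm]
  exact hk

/-- Exponents occurring in the divided difference of `zⁿ`. -/
def ddExp (n : ℤ) (l : ℕ) : ℤ × ℤ := if 0 ≤ n then (l, n - 1 - l) else (l + n, -1 - l)

/-- The linear form with the coefficients `ddExp`. -/
def ddLin (n : ℤ) (l : ℕ) : ℝ × ℝ →L[ℝ] ℝ :=
  ((ddExp n l).1 : ℝ) • ContinuousLinearMap.fst ℝ ℝ ℝ +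
    ((ddExp n l).2 : ℝ) • ContinuousLinearMap.snd ℝ ℝ ℝ

/-- The divided difference of `zⁿ` at two points on the circle. -/
def ddPow (n : ℤ) (p : ℝ × ℝ) : ℂ :=
  (n.sign : ℂ) * ∑ l ∈ Finset.range n.natAbs, circ (ddLin n l p)

theorem circ_ddLin (n : ℤ) (l : ℕ) (p : ℝ × ℝ) :
    circ (ddLin n l p) = circ p.1 ^ (ddExp n l).1 * circ p.2 ^ (ddExp n l).2 := by
  rw [← circ_int_mul, ← circ_int_mul, ← Complex.exp_add, circ, ddLin]
  congr 1
  simp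
  ring

theorem sub_mul_ddPow (n : ℤ) (p : ℝ × ℝ) :
    (circ p.1 - circ p.2) * ddPow n p = circ p.1 ^ n - circ p.2 ^ n := by
  simp only [ddPow, circ_ddLin]
  have hx := circ_ne_zero p.1
  have hy := circ_ne_zero p.2
  generalize circ p.1 = x at *
  generalize circ p.2 = y at *
  have hg := fun m => geom_sum₂_mul x y m
  rcases le_or_gt 0 n with h | h
  · obtain ⟨m, rfl⟩ := Int.eq_ofNat_of_zero_le h
    rcases Nat.eq_zero_or_pos m with rfl | hm
    · simp
    have h1 : ∑ l ∈ Finset.range m, x ^ (ddExp m l).1 * y ^ (ddExp m l).2 =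
        ∑ l ∈ Finset.range m, x ^ l * y ^ (m - 1 - l) := by
      refine Finset.sum_congr rfl fun l hl => ?_
      have hl := Finset.mem_range.1 hl
      have : (m : ℤ) - 1 - l = ((m - 1 - l : ℕ) : ℤ) := by omega
      simp only [ddExp, h, if_true]
      rw [this, zpow_natCast, zpow_natCast]
    rw [Int.natAbs_natCast, h1, Int.sign_eq_one_of_pos (by omega), zpow_natCast, zpow_natCast,
      ← hg]
    push_cast
    ring
  · obtain ⟨m, hm⟩ := Int.eq_ofNat_of_zero_le (show 0 ≤ -n by omega)
    obtain rfl : n = -m := by omega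
    have h1 : ∑ l ∈ Finset.range m, x ^ (ddExp (-m) l).1 * y ^ (ddExp (-m) l).2 =
        x ^ (-(m : ℤ)) * y ^ (-(m : ℤ)) * ∑ l ∈ Finset.range m, x ^ l * y ^ (m - 1 - l) := by
      rw [Finset.mul_sum]
      refine Finset.sum_congr rfl fun l hl => ?_
      have hl := Finset.mem_range.1 hl
      have : -1 - (l : ℤ) = -m + ((m - 1 - l : ℕ) : ℤ) := by omega
      simp only [ddExp, not_le.2 h, if_false]
      rw [this, zpow_add₀ hx, zpow_add₀ hy, zpow_natCast, zpow_natCast]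
      ring
    rw [Int.natAbs_neg, Int.natAbs_natCast, h1, Int.sign_eq_neg_one_of_neg h]
    have h2 : x ^ (-(m : ℤ)) * x ^ m = 1 := by
      rw [zpow_neg, zpow_natCast, inv_mul_cancel₀ (pow_ne_zero _ hx)]
    have h3 : y ^ (-(m : ℤ)) * y ^ m = 1 := by
      rw [zpow_neg, zpow_natCast, inv_mul_cancel₀ (pow_ne_zero _ hy)]
    push_cast
    linear_combination (-(x ^ (-(m : ℤ)) * y ^ (-(m : ℤ)))) * hg m - y ^ (-(m : ℤ)) * h2 +
      x ^ (-(m : ℤ)) * h3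

theorem norm_ddLin_le {n : ℤ} {l : ℕ} (hl : l < n.natAbs) : ‖ddLin n l‖ ≤ 2 * (1 + |(n : ℝ)|) := by
  have h : |((ddExp n l).1 : ℝ)| ≤ 1 + |(n : ℝ)| ∧ |((ddExp n l).2 : ℝ)| ≤ 1 + |(n : ℝ)| := by
    have : |(ddExp n l).1| ≤ 1 + |n| ∧ |(ddExp n l).2| ≤ 1 + |n| := by
      rw [ddExp]
      rcases abs_cases n with ⟨e, _⟩ | ⟨e, _⟩ <;> rw [e] <;> split_ifs <;> simp only [abs_le] <;>
        omega
    exact_mod_cast this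
  refine (norm_add_le _ _).trans ?_
  rw [norm_smul, norm_smul, Real.norm_eq_abs, Real.norm_eq_abs]
  have h1 := ContinuousLinearMap.norm_fst_le ℝ ℝ ℝ
  have h2 := ContinuousLinearMap.norm_snd_le ℝ ℝ ℝ
  calc _ ≤ (1 + |(n : ℝ)|) * 1 + (1 + |(n : ℝ)|) * 1 := by
        gcongr
        · exact h.1
        · exact h.2
    _ = _ := by ring

/-- The divided difference `(f(s) - f(t)) / (e^{is} - e^{it})` of a periodic function, in terms of
its Fourier coefficients. -/
def divDiff (a : ℤ → ℂ) (p : ℝ × ℝ) : ℂ := ∑' n : ℤ, a n * ddPow n p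

theorem contDiff_ddPow (n : ℤ) : ContDiff ℝ ∞ (ddPow n) :=
  contDiff_const.mul (ContDiff.sum fun l _ => smoothBdd_circ.1.comp (ddLin n l).contDiff)

theorem exists_norm_iteratedFDeriv_ddPow_le (k : ℕ) : ∃ C, 0 ≤ C ∧ ∀ (n : ℤ) (p : ℝ × ℝ),
    ‖iteratedFDeriv ℝ k (ddPow n) p‖ ≤ C * (1 + |(n : ℝ)|) ^ (k + 1) := by
  obtain ⟨C, hC⟩ := smoothBdd_circ.2 k
  have hC0 : 0 ≤ C := (norm_nonneg _).trans (hC 0)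
  refine ⟨C * 2 ^ k, by positivity, fun n p => ?_⟩
  have hk : (k : ℕ∞ω) ≤ ∞ := by exact_mod_cast le_top
  have h0 : ∀ l, ContDiff ℝ k fun p => circ (ddLin n l p) := fun l =>
    (smoothBdd_circ.1.comp (ddLin n l).contDiff).of_le hk
  have h1 : ddPow n = fun p => (n.sign : ℂ) • (∑ l ∈ Finset.range n.natAbs,
      fun p => circ (ddLin n l p)) p := by
    funext p
    rw [ddPow, Finset.sum_apply, smul_eq_mul]
  have hs : ContDiff ℝ k (∑ l ∈ Finset.range n.natAbs, fun p => circ (ddLin n l p)) := by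
    have := ContDiff.sum (s := Finset.range n.natAbs) (fun l _ => h0 l)
    convert this using 1
    funext p
    rw [Finset.sum_apply]
  have hsign : ‖(n.sign : ℂ)‖ ≤ 1 := by
    rw [norm_intCast]
    have : |n.sign| ≤ 1 := by
      rcases lt_trichotomy n 0 with h | h | h
      · rw [Int.sign_eq_neg_one_of_neg h]; norm_num
      · rw [h]; simp
      · rw [Int.sign_eq_one_of_pos h]; norm_num
    exact_mod_cast this
  rw [h1, iteratedFDeriv_const_smul_apply' hs.contDiffAt, norm_smul,
    iteratedFDeriv_sum_apply fun l _ => (h0 l).contDiffAt]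
  have hterm : ∀ l ∈ Finset.range n.natAbs,
      ‖iteratedFDeriv ℝ k (fun p => circ (ddLin n l p)) p‖ ≤ C * (2 * (1 + |(n : ℝ)|)) ^ k := by
    intro l hl
    have := (ddLin n l).iteratedFDeriv_comp_right smoothBdd_circ.1 p hk
    rw [Function.comp_def] at this
    rw [this]
    refine (ContinuousMultilinearMap.norm_compContinuousLinearMap_le _ _).trans ?_
    rw [Finset.prod_const, Finset.card_univ, Fintype.card_fin]
    gcongr
    · exact hC _
    · exact norm_ddLin_le (Finset.mem_range.1 hl)
  calc _ ≤ 1 * ∑ l ∈ Finset.range n.natAbs, C * (2 * (1 + |(n : ℝ)|)) ^ k := by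
        gcongr
        exact norm_sum_le_of_le _ hterm
    _ = |(n : ℝ)| * (C * (2 * (1 + |(n : ℝ)|)) ^ k) := by
        rw [one_mul, Finset.sum_const, Finset.card_range, nsmul_eq_mul, Nat.cast_natAbs,
          Int.cast_abs]
    _ ≤ (1 + |(n : ℝ)|) * (C * (2 * (1 + |(n : ℝ)|)) ^ k) := by
        gcongr
        linarith
    _ = _ := by rw [mul_pow]; ring

theorem contDiff_divDiff {a : ℤ → ℂ} (ha : RapidDecay a) : ContDiff ℝ ∞ (divDiff a) := by
  choose C hC0 hC using exists_norm_iteratedFDeriv_ddPow_le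
  refine contDiff_tsum (v := fun k n => C k * (‖a n‖ * (1 + |(n : ℝ)|) ^ (k + 1)))
    (fun n => contDiff_const.mul (contDiff_ddPow n)) (fun k _ => (ha (k + 1)).mul_left _)
    fun k n p _ => ?_
  have : (fun p => a n * ddPow n p) = fun p => a n • ddPow n p := rfl
  rw [this, iteratedFDeriv_const_smul_apply'
    ((contDiff_ddPow n).of_le (by exact_mod_cast le_top)).contDiffAt, norm_smul]
  calc _ ≤ ‖a n‖ * (C k * (1 + |(n : ℝ)|) ^ (k + 1)) := by gcongr; exact hC k n p
    _ = _ := by ring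

theorem summable_divDiff {a : ℤ → ℂ} (ha : RapidDecay a) (p : ℝ × ℝ) :
    Summable fun n => a n * ddPow n p := by
  obtain ⟨C, -, hC⟩ := exists_norm_iteratedFDeriv_ddPow_le 0
  refine Summable.of_norm_bounded ((ha 1).mul_left C) fun n => ?_
  have := hC n p
  rw [norm_iteratedFDeriv_zero] at this
  rw [norm_mul]
  calc _ ≤ ‖a n‖ * (C * (1 + |(n : ℝ)|) ^ (0 + 1)) := by gcongr
    _ = _ := by ring

theorem sub_mul_divDiff {ρ : ℝ → ℂ} (hρ : ContDiff ℝ ∞ ρ)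
    (hp : Function.Periodic ρ (2 * Real.pi)) (s t : ℝ) :
    (circ s - circ t) * divDiff (fcoeff ρ) (s, t) = ρ s - ρ t := by
  have h1 := (summable_divDiff (rapidDecay_fcoeff hρ hp) (s, t)).hasSum.mul_left (circ s - circ t)
  have h2 := (hasSum_fcoeff hρ hp s).sub (hasSum_fcoeff hρ hp t)
  refine h1.unique ?_
  refine h2.congr_fun fun n => ?_
  rw [circ_int_mul, circ_int_mul]
  linear_combination fcoeff ρ n * sub_mul_ddPow n (s, t)

theorem ddPow_periodic_fst (n : ℤ) (s t : ℝ) : ddPow n (s + 2 * Real.pi, t) = ddPow n (s, t) := by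
  simp only [ddPow, circ_ddLin, circ_add_two_pi]

theorem ddPow_periodic_snd (n : ℤ) (s t : ℝ) : ddPow n (s, t + 2 * Real.pi) = ddPow n (s, t) := by
  simp only [ddPow, circ_ddLin, circ_add_two_pi]

theorem divDiff_periodic_fst (a : ℤ → ℂ) (s t : ℝ) :
    divDiff a (s + 2 * Real.pi, t) = divDiff a (s, t) := by
  simp only [divDiff, ddPow_periodic_fst]

theorem divDiff_periodic_snd (a : ℤ → ℂ) (s t : ℝ) :
    divDiff a (s, t + 2 * Real.pi) = divDiff a (s, t) := by
  simp only [divDiff, ddPow_periodic_snd]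

/-- Smooth regular `2π`-periodic parametrizations of Jordan curves. -/
structure SmoothJordan (γ : ℝ → ℂ) : Prop where
  smooth : ContDiff ℝ ∞ γ
  periodic : Function.Periodic γ (2 * Real.pi)
  inj : InjOn γ (Ico 0 (2 * Real.pi))
  deriv_ne : ∀ t, deriv γ t ≠ 0

/-- The divided difference of a curve relative to the unit circle. -/
def dq (γ : ℝ → ℂ) : ℝ × ℝ → ℂ := divDiff (fcoeff γ)

theorem exists_Ico_circ (t : ℝ) : ∃ k : ℤ, t - k * (2 * Real.pi) ∈ Ico 0 (2 * Real.pi) := by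
  refine ⟨toIcoDiv Real.two_pi_pos 0 t, ?_⟩
  have := sub_toIcoDiv_zsmul_mem_Ico Real.two_pi_pos 0 t
  simpa using this

theorem fst_periodic_int {E : Type*} {F : ℝ × ℝ → E}
    (h1 : ∀ s t, F (s + 2 * Real.pi, t) = F (s, t)) (k : ℤ)
    (s t : ℝ) : F (s - k * (2 * Real.pi), t) = F (s, t) := by
  have : Function.Periodic (fun s => F (s, t)) (2 * Real.pi) := fun s => h1 s t
  exact this.sub_int_mul_eq k

theorem snd_periodic_int {E : Type*} {F : ℝ × ℝ → E}
    (h2 : ∀ s t, F (s, t + 2 * Real.pi) = F (s, t)) (k : ℤ)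
    (s t : ℝ) : F (s, t - k * (2 * Real.pi)) = F (s, t) := by
  have : Function.Periodic (fun t => F (s, t)) (2 * Real.pi) := fun t => h2 s t
  exact this.sub_int_mul_eq k

theorem exists_bound_of_periodic₂ {E : Type*} [SeminormedAddCommGroup E] {F : ℝ × ℝ → E}
    (hF : Continuous F)
    (h1 : ∀ s t, F (s + 2 * Real.pi, t) = F (s, t))
    (h2 : ∀ s t, F (s, t + 2 * Real.pi) = F (s, t)) :
    ∃ A, ∀ p, ‖F p‖ ≤ A := by
  obtain ⟨A, hA⟩ := (isCompact_Icc.prod isCompact_Icc :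
    IsCompact (Icc 0 (2 * Real.pi) ×ˢ Icc 0 (2 * Real.pi))).exists_bound_of_continuousOn
    hF.continuousOn
  refine ⟨A, fun ⟨s, t⟩ => ?_⟩
  obtain ⟨k, hk⟩ := exists_Ico_circ s
  obtain ⟨l, hl⟩ := exists_Ico_circ t
  rw [← fst_periodic_int h1 k, ← snd_periodic_int h2 l]
  exact hA _ ⟨Ico_subset_Icc_self hk, Ico_subset_Icc_self hl⟩

namespace SmoothJordan

variable {γ : ℝ → ℂ} (hγ : SmoothJordan γ)
include hγ

theorem rapidDecay : RapidDecay (fcoeff γ) := rapidDecay_fcoeff hγ.smooth hγ.periodic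

theorem contDiff_dq : ContDiff ℝ ∞ (dq γ) := contDiff_divDiff hγ.rapidDecay

theorem hasDerivAt (t : ℝ) : HasDerivAt γ (deriv γ t) t :=
  (hγ.smooth.differentiable (by simp) t).hasDerivAt

theorem continuous_deriv : Continuous (deriv γ) := hγ.smooth.continuous_deriv (by simp)

theorem sub_mul_dq (s t : ℝ) : (circ s - circ t) * dq γ (s, t) = γ s - γ t :=
  sub_mul_divDiff hγ.smooth hγ.periodic s t

theorem circ_eq {s t : ℝ} (h : γ s = γ t) : circ s = circ t := by
  obtain ⟨k, hk⟩ := exists_Ico_circ s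
  obtain ⟨l, hl⟩ := exists_Ico_circ t
  rw [← hγ.periodic.sub_int_mul_eq k, ← hγ.periodic.sub_int_mul_eq (x := t) l] at h
  rw [← circ_periodic.sub_int_mul_eq k, ← circ_periodic.sub_int_mul_eq (x := t) l]
  exact congrArg circ (hγ.inj hk hl h)

theorem deriv_eq (s t : ℝ) : deriv γ s = I * circ s * dq γ (s, t) +
    (circ s - circ t) * fderiv ℝ (dq γ) (s, t) (1, 0) := by
  have h1 : HasDerivAt (fun s => dq γ (s, t)) (fderiv ℝ (dq γ) (s, t) (1, 0)) s :=
    ((hγ.contDiff_dq.differentiable (by simp) (s, t)).hasFDerivAt).comp_hasDerivAt_of_eq s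
      ((hasDerivAt_id s).prodMk (hasDerivAt_const s t)) rfl
  have h2 := (((hasDerivAt_circ s).sub_const (circ t)).mul h1).add_const (γ t)
  have h3 : γ = fun s => (circ s - circ t) * dq γ (s, t) + γ t := by
    funext s
    rw [hγ.sub_mul_dq, sub_add_cancel]
  exact (h2.congr_of_eventuallyEq (f₁ := γ)
    (Filter.Eventually.of_forall fun x => congrFun h3 x)).deriv

theorem dq_diag (t : ℝ) : I * circ t * dq γ (t, t) = deriv γ t := by
  rw [hγ.deriv_eq t t, sub_self, zero_mul, add_zero]

theorem dq_ne_zero (p : ℝ × ℝ) : dq γ p ≠ 0 := by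
  obtain ⟨s, t⟩ := p
  by_cases h : circ s = circ t
  · obtain ⟨k, rfl⟩ := exists_int_of_circ_eq h
    rw [← fst_periodic_int (F := dq γ) (divDiff_periodic_fst _) k, add_sub_cancel_right]
    intro h0
    apply hγ.deriv_ne t
    rw [← hγ.dq_diag, h0, mul_zero]
  · intro h0
    have := hγ.sub_mul_dq s t
    rw [h0, mul_zero, eq_comm, sub_eq_zero] at this
    exact h (hγ.circ_eq this)

theorem exists_le_norm_dq : ∃ q, 0 < q ∧ ∀ p, q ≤ ‖dq γ p‖ := by
  obtain ⟨A, hA⟩ := exists_bound_of_periodic₂ (F := fun p => (dq γ p)⁻¹)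
    (hγ.contDiff_dq.continuous.inv₀ hγ.dq_ne_zero)
    (fun s t => by rw [dq, divDiff_periodic_fst]) (fun s t => by rw [dq, divDiff_periodic_snd])
  have hA0 : 0 < A := (norm_pos_iff.2 (inv_ne_zero (hγ.dq_ne_zero 0))).trans_le (hA 0)
  refine ⟨A⁻¹, inv_pos.2 hA0, fun p => ?_⟩
  have := hA p
  rw [norm_inv] at this
  exact inv_le_of_inv_le₀ (norm_pos_iff.2 (hγ.dq_ne_zero p)) this

theorem exists_norm_dq_sub_le : ∃ C, 0 ≤ C ∧ ∀ t u,
    ‖dq γ (t, u) - dq γ (t, t)‖ ≤ C * ‖circ t - circ u‖ := by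
  have hdf := hγ.contDiff_dq.differentiable (by simp)
  have p1 : ∀ s t, dq γ (s + 2 * Real.pi, t) = dq γ (s, t) := divDiff_periodic_fst _
  have p2 : ∀ s t, dq γ (s, t + 2 * Real.pi) = dq γ (s, t) := divDiff_periodic_snd _
  have h1 : ∀ s t, HasDerivAt (fun u => dq γ (s, u)) (fderiv ℝ (dq γ) (s, t) (0, 1)) t := fun s t =>
    ((hdf (s, t)).hasFDerivAt).comp_hasDerivAt_of_eq t
      ((hasDerivAt_const t s).prodMk (hasDerivAt_id t)) rfl
  obtain ⟨A, hA⟩ := exists_bound_of_periodic₂ (F := fun p => fderiv ℝ (dq γ) p (0, 1))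
    (continuous_fderiv_apply hγ.contDiff_dq _)
    (fun s t => by rw [fderiv_periodic_fst p1])
    (fun s t => by
      rw [← (h1 s _).deriv, ← (h1 s _).deriv]
      have := deriv_comp_add_const (fun u => dq γ (s, u)) (2 * Real.pi) t
      simp only [p2] at this
      exact this.symm)
  refine ⟨A * (Real.pi / 2), mul_nonneg ((norm_nonneg _).trans (hA 0)) (by positivity),
    fun t u => ?_⟩
  rw [norm_sub_rev (circ t)]
  exact norm_sub_le_of_periodic (f := fun u => dq γ (t, u)) (fun u => (h1 t u).differentiableAt)
    (fun u => p2 t u) (fun u => by rw [(h1 t u).deriv]; exact hA _) u t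

end SmoothJordan

theorem exists_norm_profile_sub_le (σ : ℝ) : ∃ C, 0 ≤ C ∧ ∀ y : ℝ,
    ‖profile σ y - 1 + σ * y‖ ≤ C * |y| ^ 2 := by
  obtain ⟨A, hA0, hA⟩ := (smoothBdd_profile σ).exists_bound
  have hsm : ContDiff ℝ ∞ (fun y : ℝ => profile σ y - 1 + σ * y) :=
    ((smoothBdd_profile σ).1.sub contDiff_const).add
      (contDiff_const.mul ofRealCLM.contDiff)
  have hd : ∀ y, HasDerivAt (fun y : ℝ => profile σ y - 1 + σ * y)
      (-σ * profile σ y + profileErr σ y + σ) y := fun y => by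
    refine (((hasDerivAt_profile σ y).sub_const 1).add
      ((ofRealCLM.hasDerivAt (x := y)).const_mul (σ : ℂ))).congr_deriv ?_
    simp
  obtain ⟨B, hB⟩ := (smoothBdd_profile σ).exists_bound_deriv
  obtain ⟨D, hD⟩ := (isCompact_Icc (a := (-1 : ℝ)) (b := 1)).exists_bound_of_continuousOn
    (f := deriv (deriv fun y : ℝ => profile σ y - 1 + σ * y))
    ((contDiff_infty_iff_deriv.1 (contDiff_infty_iff_deriv.1 hsm).2).2.continuous.continuousOn)
  have hsm' := contDiff_infty_iff_deriv.1 hsm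
  have hD0 : 0 ≤ D := (norm_nonneg _).trans (hD 0 (by simp))
  have h0 : deriv (fun y : ℝ => profile σ y - 1 + σ * y) 0 = 0 := by
    rw [(hd 0).deriv, profile_zero, profileErr, deriv_cutoff_eq_zero (by simp)]
    ring
  have hseg : ∀ y : ℝ, |y| ≤ 1 → ∀ u ∈ uIcc 0 y, u ∈ Icc (-1 : ℝ) 1 ∧ |u| ≤ |y| := by
    intro y hy u hu
    have hu' : |u| ≤ |y| := by
      simpa using abs_sub_left_of_mem_uIcc hu
    exact ⟨abs_le.1 (hu'.trans hy), hu'⟩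
  have hfirst : ∀ u : ℝ, |u| ≤ 1 →
      ‖deriv (fun y : ℝ => profile σ y - 1 + σ * y) u‖ ≤ D * |u| := by
    intro u hu
    have := (convex_uIcc 0 u).norm_image_sub_le_of_norm_deriv_le (𝕜 := ℝ)
      (f := deriv fun y : ℝ => profile σ y - 1 + σ * y) (C := D)
      (fun x _ => hsm'.2.differentiable (by simp) x)
      (fun x hx => hD x (hseg u hu x hx).1) left_mem_uIcc right_mem_uIcc
    rwa [h0, sub_zero, sub_zero, Real.norm_eq_abs] at this
  refine ⟨D + A + 1 + |σ|, by positivity, fun y => ?_⟩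
  rcases le_or_gt |y| 1 with h | h
  · have := (convex_uIcc 0 y).norm_image_sub_le_of_norm_deriv_le (𝕜 := ℝ)
      (f := fun y : ℝ => profile σ y - 1 + σ * y) (C := D * |y|)
      (fun x _ => (hd x).differentiableAt)
      (fun x hx => (hfirst x ((hseg y h x hx).2.trans h)).trans (by
        exact mul_le_mul_of_nonneg_left (hseg y h x hx).2 hD0)) left_mem_uIcc right_mem_uIcc
    simp only [profile_zero, sub_self, ofReal_zero, mul_zero, add_zero, sub_zero,
      Real.norm_eq_abs] at this
    refine this.trans ?_
    rw [mul_assoc, ← sq]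
    gcongr
    have := abs_nonneg σ
    linarith
  · have h2 : |y| ≤ |y| ^ 2 := by nlinarith
    have h3 : 1 ≤ |y| ^ 2 := by nlinarith
    calc ‖profile σ y - 1 + σ * y‖ ≤ ‖profile σ y‖ + ‖(1 : ℂ)‖ + ‖(σ : ℂ) * y‖ :=
          (norm_add_le _ _).trans (by gcongr; exact norm_sub_le _ _)
      _ ≤ A + 1 + |σ| * |y| := by
          rw [norm_mul, norm_real, norm_real, Real.norm_eq_abs, Real.norm_eq_abs, norm_one]
          gcongr
          exact hA y
      _ ≤ A * |y| ^ 2 + 1 * |y| ^ 2 + |σ| * |y| ^ 2 := by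
          gcongr
          · nlinarith
          · linarith
      _ ≤ _ := by nlinarith [sq_nonneg |y|]

/-- First-order expansion of the almost holomorphic extension at the curve. -/
theorem exists_norm_stripExt_sub_le (σ : ℝ) {ρ : ℝ → ℂ} (hρ : ContDiff ℝ ∞ ρ)
    (hp : Function.Periodic ρ (2 * Real.pi)) : ∃ C, 0 ≤ C ∧ ∀ t s : ℝ,
      ‖stripExt σ (fcoeff ρ) (t, s) - ρ t - I * σ * s * deriv ρ t‖ ≤ C * s ^ 2 := by
  obtain ⟨C, hC0, hC⟩ := exists_norm_profile_sub_le σ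
  obtain ⟨A, hA0, hA⟩ := (smoothBdd_profile σ).exists_bound
  have ha := rapidDecay_fcoeff hρ hp
  refine ⟨C * wnorm 2 (fcoeff ρ), mul_nonneg hC0 (wnorm_nonneg _ _), fun t s => ?_⟩
  have h1 := (summable_aae hA ha t s).hasSum
  have h2 := hasSum_fcoeff hρ hp t
  have hρ' : ContDiff ℝ ∞ (deriv ρ) := (contDiff_infty_iff_deriv.1 hρ).2
  have hp' : Function.Periodic (deriv ρ) (2 * Real.pi) := by
    simpa using periodic_iteratedDeriv hp 1
  have h3 := (hasSum_fcoeff hρ' hp' t).mul_left (I * σ * s)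
  have h4 := ((h1.sub h2).sub h3).tsum_eq
  have h5 : stripExt σ (fcoeff ρ) (t, s) - ρ t - I * σ * s * deriv ρ t =
      aae (fun y => profile σ y - 1 + σ * y) (fcoeff ρ) t s := by
    rw [stripExt, aae]
    refine h4.symm.trans (tsum_congr fun n => ?_)
    rw [fcoeff_deriv (hρ.of_le (by exact_mod_cast le_top)) hp]
    push_cast
    linear_combination (-σ * s * n * fcoeff ρ n * cexp (n * t * I)) * I_sq
  rw [h5]
  refine (norm_aae_le hC0 hC ha t s).trans_eq ?_
  rw [sq_abs]
  ring

/-- Near the curve, `Γ(t,s) - γ(u)` is comparable to `(1 - σs)e^{it} - e^{iu}`. -/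
theorem SmoothJordan.exists_norm_stripExt_sub_dq_le {γ : ℝ → ℂ} (hγ : SmoothJordan γ) {σ : ℝ}
    (hσ : |σ| = 1) : ∃ C, 0 ≤ C ∧ ∀ s ∈ Icc (0 : ℝ) 1, ∀ t u : ℝ,
      ‖stripExt σ (fcoeff γ) (t, s) - γ u - ((1 - σ * s) * circ t - circ u) * dq γ (t, u)‖ ≤
        C * s * ‖(1 - σ * s) * circ t - circ u‖ ∧ s ≤ ‖(1 - σ * s) * circ t - circ u‖ ∧
        ‖circ t - circ u‖ ≤ 2 * ‖(1 - σ * s) * circ t - circ u‖ := by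
  obtain ⟨C, hC0, hC⟩ := exists_norm_stripExt_sub_le σ hγ.smooth hγ.periodic
  obtain ⟨D, hD0, hD⟩ := hγ.exists_norm_dq_sub_le
  refine ⟨2 * D + C, by positivity, fun s hs t u => ?_⟩
  set X := (1 - σ * s) * circ t - circ u with hX
  have hσs : ‖(σ : ℂ) * s‖ = s := by
    rw [norm_mul, norm_real, norm_real, Real.norm_eq_abs, Real.norm_eq_abs, hσ, one_mul,
      abs_of_nonneg hs.1]
  have h1 : s ≤ ‖X‖ := by
    have e1 : ‖(1 - σ * s) * circ t‖ = 1 - σ * s := by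
      rw [norm_mul, norm_circ, mul_one]
      have : (1 : ℂ) - σ * s = ((1 - σ * s : ℝ) : ℂ) := by push_cast; rfl
      rw [this, norm_real, Real.norm_of_nonneg]
      have : |σ * s| ≤ 1 := by rw [abs_mul, hσ, one_mul, abs_of_nonneg hs.1]; exact hs.2
      linarith [le_abs_self (σ * s)]
    have := abs_norm_sub_norm_le ((1 - σ * s) * circ t) (circ u)
    rw [e1, norm_circ, ← hX] at this
    have e2 : |1 - σ * s - 1| = s := by
      rw [sub_sub_cancel_left, abs_neg, abs_mul, hσ, one_mul, abs_of_nonneg hs.1]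
    rwa [e2] at this
  have h2 : ‖circ t - circ u‖ ≤ 2 * ‖X‖ := by
    have : circ t - circ u = X + σ * s * circ t := by rw [hX]; ring
    rw [this]
    refine (norm_add_le _ _).trans ?_
    rw [norm_mul, hσs, norm_circ]
    linarith
  refine ⟨?_, h1, h2⟩
  have h3 : stripExt σ (fcoeff γ) (t, s) - γ u - X * dq γ (t, u) =
      (stripExt σ (fcoeff γ) (t, s) - γ t - I * σ * s * deriv γ t) +
        σ * s * (circ t * (dq γ (t, u) - dq γ (t, t))) := by
    rw [← hγ.dq_diag, hX]
    linear_combination -hγ.sub_mul_dq t u + (σ * s * circ t * dq γ (t, t)) * I_sq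
  rw [h3]
  calc _ ≤ C * s ^ 2 + s * (1 * (D * ‖circ t - circ u‖)) := by
        refine (norm_add_le _ _).trans ?_
        rw [norm_mul ((σ : ℂ) * s), norm_mul (circ t), hσs, norm_circ]
        gcongr
        · exact hC t s
        · exact hs.1
        · exact hD t u
    _ ≤ C * (s * ‖X‖) + s * (1 * (D * (2 * ‖X‖))) := by
        have := hs.1
        rw [sq]
        gcongr
    _ = _ := by ring

theorem intervalIntegral_logDeriv_eq_of_div_mem_slitPlane {f g f' g' : ℝ → ℂ} {a b : ℝ}
    (hf : ∀ u, HasDerivAt f (f' u) u) (hg : ∀ u, HasDerivAt g (g' u) u)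
    (hf' : Continuous f') (hg' : Continuous g') (hf0 : ∀ u, f u ≠ 0) (hg0 : ∀ u, g u ≠ 0)
    (hfab : f a = f b) (hgab : g a = g b) (h : ∀ u, f u / g u ∈ slitPlane) :
    ∫ u in a..b, f' u / f u = ∫ u in a..b, g' u / g u := by
  have hfc : Continuous f := continuous_iff_continuousAt.2 fun u => (hf u).continuousAt
  have hgc : Continuous g := continuous_iff_continuousAt.2 fun u => (hg u).continuousAt
  have c1 : Continuous fun u => f' u / f u := hf'.div hfc hf0
  have c2 : Continuous fun u => g' u / g u := hg'.div hgc hg0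
  have hd : ∀ u, HasDerivAt (fun u => log (f u / g u)) (f' u / f u - g' u / g u) u := fun u => by
    refine (((hf u).div (hg u) (hg0 u)).clog_real (h u)).congr_deriv ?_
    have := hf0 u
    have := hg0 u
    rw [Pi.div_apply]
    field_simp
  have := intervalIntegral.integral_eq_sub_of_hasDerivAt (a := a) (b := b) (fun u _ => hd u)
    ((c1.sub c2).intervalIntegrable _ _)
  rw [intervalIntegral.integral_sub (c1.intervalIntegrable _ _) (c2.intervalIntegrable _ _),
    hfab, hgab, sub_self, sub_eq_zero] at this
  exact this

theorem mem_slitPlane_of_norm_sub_one_lt {z : ℂ} (h : ‖z - 1‖ < 1) : z ∈ slitPlane := by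
  refine Or.inl ?_
  have := (abs_re_le_norm (z - 1)).trans_lt h
  rw [sub_re, one_re] at this
  linarith [(abs_lt.1 this).1]

theorem integral_circ_div_sub_of_norm_lt {w : ℂ} (hw : ‖w‖ < 1) :
    ∫ u in (0 : ℝ)..2 * Real.pi, I * circ u / (circ u - w) = 2 * Real.pi * I := by
  have := circleIntegral.integral_sub_inv_of_mem_ball (c := 0) (R := 1) (w := w) (by simpa using hw)
  rw [← this, circleIntegral]
  refine intervalIntegral.integral_congr fun u _ => ?_
  simp only [deriv_circleMap, circleMap, circ, ofReal_one, smul_eq_mul]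
  ring_nf

theorem integral_circ_div_sub_of_lt_norm {w : ℂ} (hw : 1 < ‖w‖) :
    ∫ u in (0 : ℝ)..2 * Real.pi, I * circ u / (circ u - w) = 0 := by
  have : (∮ z in C((0 : ℂ), 1), (z - w)⁻¹) = 0 := by
    refine DiffContOnCl.circleIntegral_eq_zero zero_le_one (DifferentiableOn.diffContOnCl ?_)
    intro z hz
    have hz' : z ≠ w := by
      rintro rfl
      have := closure_ball_subset_closedBall hz
      rw [mem_closedBall_zero_iff] at this
      linarith
    exact ((differentiableAt_id.sub_const w).inv (sub_ne_zero.2 hz')).differentiableWithinAt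
  rw [← this, circleIntegral]
  refine intervalIntegral.integral_congr fun u _ => ?_
  simp only [deriv_circleMap, circleMap, circ, ofReal_one, smul_eq_mul]
  ring_nf

/-- `2πi` times the winding number of `γ` about `z`. -/
def wind (γ : ℝ → ℂ) (z : ℂ) : ℂ := ∫ u in (0 : ℝ)..2 * Real.pi, deriv γ u / (γ u - z)

/-- The total logarithmic variation of the divided difference `dq γ (t, ·)`. -/
def dqWind (γ : ℝ → ℂ) (t : ℝ) : ℂ :=
  ∫ u in (0 : ℝ)..2 * Real.pi, deriv (fun u => dq γ (t, u)) u / dq γ (t, u)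

namespace SmoothJordan

variable {γ : ℝ → ℂ} (hγ : SmoothJordan γ)
include hγ

theorem continuous : Continuous γ := hγ.smooth.continuous

theorem isCompact_range : IsCompact (range γ) :=
  hγ.periodic.compact_of_continuous Real.two_pi_pos.ne' hγ.continuous

theorem wind_eq_of_norm_lt {z w : ℂ} (hz : z ∉ range γ) (hw : w ∉ range γ)
    (h : ∀ u, ‖w - z‖ < ‖γ u - z‖) : wind γ z = wind γ w := by
  have h0 : ∀ {z}, z ∉ range γ → ∀ u, γ u - z ≠ 0 := fun hz u hu =>
    hz ⟨u, sub_eq_zero.1 hu⟩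
  have hp : γ 0 = γ (2 * Real.pi) := by simpa using (hγ.periodic 0).symm
  refine (intervalIntegral_logDeriv_eq_of_div_mem_slitPlane
    (fun u => (hγ.hasDerivAt u).sub_const w) (fun u => (hγ.hasDerivAt u).sub_const z)
    hγ.continuous_deriv hγ.continuous_deriv (h0 hw) (h0 hz) (by rw [hp]) (by rw [hp])
    fun u => mem_slitPlane_of_norm_sub_one_lt ?_).symm
  have e : (γ u - w) / (γ u - z) - 1 = -((w - z) / (γ u - z)) := by
    have := h0 hz u
    field_simp
    ring
  rw [e, norm_neg, norm_div, div_lt_one (norm_pos_iff.2 (h0 hz u))]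
  exact h u

theorem wind_eq_of_isPreconnected {S : Set ℂ} (hS : IsPreconnected S) (hd : Disjoint S (range γ))
    {z w : ℂ} (hz : z ∈ S) (hw : w ∈ S) : wind γ z = wind γ w := by
  refine hS.induction₂ (fun z w => wind γ z = wind γ w) (fun x hx => ?_)
    (fun _ _ _ _ _ _ h1 h2 => h1.trans h2) (fun _ _ _ _ h => h.symm) hz hw
  have hx' : x ∉ range γ := disjoint_left.1 hd hx
  obtain ⟨r, hr, hrs⟩ := Metric.isOpen_iff.1 hγ.isCompact_range.isClosed.isOpen_compl x hx'
  filter_upwards [self_mem_nhdsWithin, mem_nhdsWithin_of_mem_nhds (ball_mem_nhds x hr)]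
    with y hy hyr
  refine hγ.wind_eq_of_norm_lt hx' (disjoint_left.1 hd hy) fun u => ?_
  have h1 : r ≤ ‖γ u - x‖ := by
    by_contra! hlt
    exact hrs (mem_ball_iff_norm.2 hlt) ⟨u, rfl⟩
  exact (mem_ball_iff_norm.1 hyr).trans_le h1

theorem dq_symm (s t : ℝ) : dq γ (s, t) = dq γ (t, s) := by
  by_cases h : circ s = circ t
  · obtain ⟨k, rfl⟩ := exists_int_of_circ_eq h
    have h1 := fst_periodic_int (F := dq γ) (divDiff_periodic_fst _) k (t + k * (2 * Real.pi)) t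
    have h2 := snd_periodic_int (F := dq γ) (divDiff_periodic_snd _) k t (t + k * (2 * Real.pi))
    rw [add_sub_cancel_right] at h1 h2
    rw [← h1, ← h2]
  · have h1 := hγ.sub_mul_dq s t
    have h2 := hγ.sub_mul_dq t s
    have h3 : (circ s - circ t) * (dq γ (s, t) - dq γ (t, s)) = 0 := by
      linear_combination h1 + h2
    exact sub_eq_zero.1 ((mul_eq_zero.1 h3).resolve_left (sub_ne_zero.2 h))

theorem hasDerivAt_dq_snd (t u : ℝ) :
    HasDerivAt (fun u => dq γ (t, u)) (fderiv ℝ (dq γ) (t, u) (0, 1)) u :=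
  ((hγ.contDiff_dq.differentiable (by simp) (t, u)).hasFDerivAt).comp_hasDerivAt_of_eq u
    ((hasDerivAt_const u t).prodMk (hasDerivAt_id u)) rfl

/-- Quantitative collar: both one-sided strips stay away from the curve, and the winding numbers
on the two sides differ by one. -/
theorem exists_collar : ∃ ε c : ℝ, 0 < ε ∧ ε ≤ 1 / 2 ∧ 0 < c ∧ ∀ σ : ℝ, σ = 1 ∨ σ = -1 →
    ∀ s ∈ Icc 0 ε, ∀ t : ℝ, (∀ u, c * s ≤ ‖stripExt σ (fcoeff γ) (t, s) - γ u‖ ∧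
      c * ‖circ t - circ u‖ ≤ ‖stripExt σ (fcoeff γ) (t, s) - γ u‖) ∧
      (0 < s → wind γ (stripExt σ (fcoeff γ) (t, s)) = (1 + σ) * (Real.pi * I) + dqWind γ t) := by
  obtain ⟨q, hq, hQ⟩ := hγ.exists_le_norm_dq
  obtain ⟨C₁, hC₁, h₁⟩ := hγ.exists_norm_stripExt_sub_dq_le (σ := 1) (by simp)
  obtain ⟨C₂, hC₂, h₂⟩ := hγ.exists_norm_stripExt_sub_dq_le (σ := -1) (by simp)
  set C := C₁ + C₂ + 1 with hC
  have hC0 : 0 < C := by positivity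
  refine ⟨min (1 / 2) (q / (2 * C)), q / 4, by positivity, min_le_left _ _, by positivity,
    fun σ hσ s hs t => ?_⟩
  have hs1 : s ∈ Icc (0 : ℝ) 1 := ⟨hs.1, hs.2.trans ((min_le_left _ _).trans (by norm_num))⟩
  have hs2 : s ≤ 1 / 2 := hs.2.trans (min_le_left _ _)
  have hsC : C * s ≤ q / 2 := by
    have := hs.2.trans (min_le_right _ _)
    rw [le_div_iff₀ (by positivity)] at this
    linarith
  set Γ := stripExt σ (fcoeff γ) (t, s) with hΓ
  have key : ∀ u : ℝ, ‖Γ - γ u - ((1 - σ * s) * circ t - circ u) * dq γ (t, u)‖ ≤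
        C * s * ‖(1 - σ * s) * circ t - circ u‖ ∧ s ≤ ‖(1 - σ * s) * circ t - circ u‖ ∧
        ‖circ t - circ u‖ ≤ 2 * ‖(1 - σ * s) * circ t - circ u‖ := by
    intro u
    have hs0 := hs.1
    rcases hσ with rfl | rfl
    · refine ⟨(h₁ s hs1 t u).1.trans ?_, (h₁ s hs1 t u).2⟩
      gcongr
      linarith
    · refine ⟨(h₂ s hs1 t u).1.trans ?_, (h₂ s hs1 t u).2⟩
      gcongr
      linarith
  have low : ∀ u : ℝ, q / 2 * ‖(1 - σ * s) * circ t - circ u‖ ≤ ‖Γ - γ u‖ := by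
    intro u
    set X := (1 - σ * s) * circ t - circ u
    have h1 : q * ‖X‖ ≤ ‖X * dq γ (t, u)‖ := by
      rw [norm_mul, mul_comm]
      gcongr
      exact hQ _
    have h2 := norm_sub_norm_le (X * dq γ (t, u)) (Γ - γ u)
    rw [norm_sub_rev (X * dq γ (t, u))] at h2
    have h3 := (key u).1
    have h4 : C * s * ‖X‖ ≤ q / 2 * ‖X‖ := by gcongr
    linarith
  refine ⟨fun u => ⟨?_, ?_⟩, fun hs0 => ?_⟩
  · refine le_trans ?_ (low u)
    have := (key u).2.1
    have := hs.1
    nlinarith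
  · refine le_trans ?_ (low u)
    have := (key u).2.2
    nlinarith
  · set w : ℂ := (1 - σ * s) * circ t with hw
    have hX0 : ∀ u, circ u - w ≠ 0 := fun u h => by
      have := (key u).2.1
      rw [← norm_neg, neg_sub, h, norm_zero] at this
      linarith
    have hΓ0 : ∀ u, γ u - Γ ≠ 0 := fun u h => by
      have := low u
      rw [← norm_neg (Γ - γ u), neg_sub, h, norm_zero] at this
      have h5 : 0 < ‖w - circ u‖ := norm_pos_iff.2 fun h' => hX0 u (by rw [← neg_sub, h', neg_zero])
      nlinarith
    have hcirc : ∀ u, HasDerivAt circ (I * circ u) u := hasDerivAt_circ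
    have hcc : Continuous circ := smoothBdd_circ.1.continuous
    have hQd := fun u => hγ.hasDerivAt_dq_snd t u
    have hQc : Continuous fun u => dq γ (t, u) := hγ.contDiff_dq.continuous.comp (by fun_prop)
    have hQ'c : Continuous fun u => fderiv ℝ (dq γ) (t, u) (0, 1) :=
      (continuous_fderiv_apply hγ.contDiff_dq (0, 1)).comp (by fun_prop)
    have hper : γ 0 = γ (2 * Real.pi) := by simpa using (hγ.periodic 0).symm
    have hperc : circ 0 = circ (2 * Real.pi) := by simpa using (circ_periodic 0).symm
    have hperQ : dq γ (t, 0) = dq γ (t, 2 * Real.pi) := by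
      simpa [dq] using (divDiff_periodic_snd (fcoeff γ) t 0).symm
    have e1 : wind γ Γ = ∫ u in (0 : ℝ)..2 * Real.pi,
        (I * circ u * dq γ (t, u) + (circ u - w) * fderiv ℝ (dq γ) (t, u) (0, 1)) /
          ((circ u - w) * dq γ (t, u)) := by
      refine intervalIntegral_logDeriv_eq_of_div_mem_slitPlane
        (fun u => (hγ.hasDerivAt u).sub_const Γ)
        (fun u => ((hcirc u).sub_const w).mul (hQd u)) hγ.continuous_deriv
        (((continuous_const.mul hcc).mul hQc).add ((hcc.sub continuous_const).mul hQ'c)) hΓ0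
        (fun u => mul_ne_zero (hX0 u) (hγ.dq_ne_zero _)) (by rw [hper])
        (by rw [hperc, hperQ]) fun u => mem_slitPlane_of_norm_sub_one_lt ?_
      have hne : (circ u - w) * dq γ (t, u) ≠ 0 := mul_ne_zero (hX0 u) (hγ.dq_ne_zero _)
      have e2 : (γ u - Γ) / ((circ u - w) * dq γ (t, u)) - 1 =
          -(Γ - γ u - (w - circ u) * dq γ (t, u)) / ((circ u - w) * dq γ (t, u)) := by
        rw [div_sub_one hne]
        congr 1
        ring
      rw [e2, norm_div, norm_neg, div_lt_one (norm_pos_iff.2 hne), norm_mul]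
      have h5 : 0 < ‖circ u - w‖ := norm_pos_iff.2 (hX0 u)
      have h6 := (key u).1
      rw [norm_sub_rev w (circ u)] at h6
      have h7 := hQ (t, u)
      calc _ ≤ _ := h6
        _ ≤ q / 2 * ‖circ u - w‖ := by gcongr
        _ < ‖dq γ (t, u)‖ * ‖circ u - w‖ := by
          have : q / 2 < ‖dq γ (t, u)‖ := by linarith
          gcongr
        _ = _ := mul_comm _ _
    have e3 : ∫ u in (0 : ℝ)..2 * Real.pi, I * circ u / (circ u - w) =
        (1 + σ) * (Real.pi * I) := by
      have hnw : ‖w‖ = 1 - σ * s := by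
        rw [hw, norm_mul, norm_circ, mul_one]
        have : (1 : ℂ) - σ * s = ((1 - σ * s : ℝ) : ℂ) := by push_cast; rfl
        rw [this, norm_real, Real.norm_of_nonneg]
        rcases hσ with rfl | rfl <;> linarith
      rcases hσ with rfl | rfl
      · rw [integral_circ_div_sub_of_norm_lt (by rw [hnw]; linarith)]
        push_cast
        ring
      · rw [integral_circ_div_sub_of_lt_norm (by rw [hnw]; linarith)]
        push_cast
        ring
    have cA : Continuous fun u => I * circ u / (circ u - w) :=
      (continuous_const.mul hcc).div (hcc.sub continuous_const) hX0
    have cB : Continuous fun u => fderiv ℝ (dq γ) (t, u) (0, 1) / dq γ (t, u) :=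
      hQ'c.div hQc fun u => hγ.dq_ne_zero _
    rw [e1, ← e3, dqWind]
    simp only [fun u => (hQd u).deriv]
    rw [← intervalIntegral.integral_add (cA.intervalIntegrable _ _) (cB.intervalIntegrable _ _)]
    refine intervalIntegral.integral_congr fun u _ => ?_
    have := hX0 u
    have := hγ.dq_ne_zero (t, u)
    field_simp

end SmoothJordan

/-- A jointly continuous family can be discretized uniformly on compact sets. -/
theorem exists_simpleFunc_dist_le {X Y E : Type*} [PseudoMetricSpace X] [MeasurableSpace X]
    [OpensMeasurableSpace X] [PseudoMetricSpace Y] [PseudoMetricSpace E] {K : Set X} {Z : Set Y}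
    (hK : IsCompact K) (hKne : K.Nonempty) (hZ : IsCompact Z) {F : X → Y → E}
    (hF : Continuous (Function.uncurry F)) {ε : ℝ} (hε : 0 < ε) :
    ∃ π : SimpleFunc X X, (∀ x, π x ∈ K) ∧ ∀ x ∈ K, ∀ z ∈ Z, dist (F x z) (F (π x) z) ≤ ε := by
  have hu := (hK.prod hZ).uniformContinuousOn_of_continuous hF.continuousOn
  obtain ⟨d, hd, hdF⟩ := Metric.uniformContinuousOn_iff.1 hu ε hε
  obtain ⟨t, htK, htf, hcov⟩ := hK.finite_cover_balls hd
  obtain ⟨x₀, hx₀⟩ := hKne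
  obtain ⟨N, f, hf⟩ : ∃ (N : ℕ) (f : ℕ → X), (∀ n, f n ∈ K) ∧ ∀ y ∈ t, ∃ k ≤ N, f k = y := by
    classical
    let l := htf.toFinset.toList
    refine ⟨l.length, fun k => l.getD k x₀, fun n => ?_, fun y hy => ?_⟩
    · rcases lt_or_ge n l.length with h | h
      · show l.getD n x₀ ∈ K
        rw [List.getD_eq_getElem _ _ h]
        exact htK (htf.mem_toFinset.1 (Finset.mem_toList.1 (List.getElem_mem h)))
      · show l.getD n x₀ ∈ K
        rw [List.getD_eq_default _ _ h]
        exact hx₀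
    · have hy' : y ∈ l := by simpa [l] using hy
      obtain ⟨k, hk, rfl⟩ := List.getElem_of_mem hy'
      exact ⟨k, hk.le, List.getD_eq_getElem _ _ hk⟩
  refine ⟨SimpleFunc.nearestPt f N, fun x => ?_, fun x hx z hz => ?_⟩
  · rw [SimpleFunc.nearestPt, SimpleFunc.map_apply]
    exact hf.1 _
  · obtain ⟨y, hy, hxy⟩ := mem_iUnion₂.1 (hcov hx)
    obtain ⟨k, hk, rfl⟩ := hf.2 y hy
    have h1 := SimpleFunc.edist_nearestPt_le f x hk
    have h2 : dist (SimpleFunc.nearestPt f N x) x < d := by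
      rw [edist_dist, edist_dist, ENNReal.ofReal_le_ofReal_iff dist_nonneg] at h1
      exact h1.trans_lt (by rw [dist_comm]; exact hxy)
    have hmem : SimpleFunc.nearestPt f N x ∈ K := by
      rw [SimpleFunc.nearestPt, SimpleFunc.map_apply]
      exact hf.1 _
    refine (hdF (x, z) ⟨hx, hz⟩ (SimpleFunc.nearestPt f N x, z) ⟨hmem, hz⟩ ?_).le
    rw [Prod.dist_eq, dist_self, max_lt_iff, dist_comm]
    exact ⟨h2, hd⟩

theorem integral_smul_comp_simpleFunc {X E : Type*} [MeasurableSpace X] {μ : Measure X}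
    [NormedAddCommGroup E] [NormedSpace ℂ E] [NormedSpace ℝ E] [CompleteSpace E]
    (π : SimpleFunc X X)
    (G : X → E) {w : X → ℂ} (hw : Integrable w μ) :
    ∫ a, w a • G (π a) ∂μ = ∑ p ∈ π.range, (∫ a in π ⁻¹' {p}, w a ∂μ) • G p := by
  classical
  have h1 : ∀ a, w a • G (π a) =
      ∑ p ∈ π.range, (π ⁻¹' {p}).indicator w a • G p := by
    intro a
    rw [Finset.sum_eq_single (π a)]
    · rw [indicator_of_mem (by simp)]
    · intro p _ hp
      rw [indicator_of_notMem (by simpa using hp.symm), zero_smul]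
    · intro h
      exact absurd (SimpleFunc.mem_range_self π a) h
  simp_rw [h1]
  rw [integral_finsetSum]
  · refine Finset.sum_congr rfl fun p _ => ?_
    rw [integral_smul_const, integral_indicator (π.measurableSet_fiber p)]
  · intro p _
    exact (hw.indicator (π.measurableSet_fiber p)).smul_const _

theorem iteratedFDeriv_comp_smul_sub {E F : Type*} [NormedAddCommGroup E] [NormedSpace ℝ E]
    [NormedAddCommGroup F] [NormedSpace ℝ F] {f : E → F} (hf : ContDiff ℝ ∞ f) (r : ℝ) (a : E)
    (k : ℕ) (x : E) : iteratedFDeriv ℝ k (fun z => f (r • (z - a))) x =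
      r ^ k • iteratedFDeriv ℝ k f (r • (x - a)) := by
  have h1 := iteratedFDeriv_comp_sub (𝕜 := ℝ) (f := fun z => f (r • z)) k a x
  rw [h1, iteratedFDeriv_comp_const_smul r (hf.of_le (by exact_mod_cast le_top))]

/-- A globally smooth function with bounded derivatives equal to `w⁻¹` away from the origin. -/
theorem exists_smoothBdd_eq_inv {c : ℝ} (hc : 0 < c) :
    ∃ H : ℂ → ℂ, SmoothBdd H ∧ ∀ w, c ≤ ‖w‖ → H w = w⁻¹ := by
  let ψ : ContDiffBump (0 : ℂ) := ⟨c / 2, c, by positivity, by linarith⟩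
  set H : ℂ → ℂ := fun w => (1 - (ψ w : ℂ)) * w⁻¹ with hH
  have hHinv : ∀ w, c ≤ ‖w‖ → H w = w⁻¹ := fun w hw => by
    rw [hH]
    simp only
    rw [ψ.zero_of_le_dist (by simpa using hw), ofReal_zero, sub_zero, one_mul]
  have hsm : ContDiff ℝ ∞ H := by
    rw [contDiff_iff_contDiffAt]
    intro w
    by_cases hw : w = 0
    · subst hw
      have : H =ᶠ[nhds 0] fun _ => 0 := by
        filter_upwards [ψ.eventuallyEq_one] with y hy
        simp [hH, hy]
      exact contDiffAt_const.congr_of_eventuallyEq this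
    · exact (contDiffAt_const.sub (ofRealCLM.contDiff.contDiffAt.comp w ψ.contDiff.contDiffAt)).mul
        ((contDiffAt_inv ℂ hw).restrict_scalars ℝ)
  refine ⟨H, ⟨hsm, fun k => ?_⟩, hHinv⟩
  obtain ⟨A, hA⟩ := (isCompact_closedBall (0 : ℂ) (2 * c)).exists_bound_of_continuousOn
    (hsm.continuous_iteratedFDeriv (m := k) (by exact_mod_cast le_top)).continuousOn
  refine ⟨A, fun w => ?_⟩
  rcases le_or_gt ‖w‖ (2 * c) with h | h
  · exact hA w (by simpa using h)
  set r := 2 * c / ‖w‖ with hr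
  have hw0 : 0 < ‖w‖ := by linarith
  have hr0 : 0 < r := by positivity
  have hr1 : r ≤ 1 := (div_le_one hw0).2 h.le
  have hev : H =ᶠ[nhds w] fun z => r • H (r • (z - 0)) := by
    have ho : IsOpen {z : ℂ | c < ‖r • z‖ ∧ c < ‖z‖} :=
      (isOpen_lt continuous_const (continuous_const_smul r).norm).inter
        (isOpen_lt continuous_const continuous_norm)
    have hrw : ‖r • w‖ = 2 * c := by
      rw [norm_smul, Real.norm_of_nonneg hr0.le, hr, div_mul_cancel₀ _ hw0.ne']
    filter_upwards [ho.mem_nhds ⟨by rw [hrw]; linarith, by linarith⟩] with z hz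
    rw [sub_zero, hHinv z hz.2.le, hHinv _ hz.1.le, real_smul, real_smul, mul_inv,
      mul_inv_cancel_left₀ (ofReal_ne_zero.2 hr0.ne')]
  have hev' := (Filter.EventuallyEq.iteratedFDeriv ℝ hev k).eq_of_nhds
  rw [hev',
    iteratedFDeriv_const_smul_apply' (f := fun z => H (r • (z - 0)))
    (ContDiff.contDiffAt ((hsm.of_le (by exact_mod_cast le_top)).comp (by fun_prop))),
    iteratedFDeriv_comp_smul_sub hsm, norm_smul, norm_smul, norm_pow, Real.norm_of_nonneg hr0.le]
  have h3 : ‖iteratedFDeriv ℝ k H (r • (w - 0))‖ ≤ A := by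
    refine hA _ ?_
    rw [sub_zero, mem_closedBall_zero_iff, norm_smul, Real.norm_of_nonneg hr0.le, hr,
      div_mul_cancel₀ _ hw0.ne']
  have h4 : r ^ k ≤ 1 := pow_le_one₀ hr0.le hr1
  have hN := norm_nonneg (iteratedFDeriv ℝ k H (r • (w - 0)))
  calc _ ≤ 1 * (1 * ‖iteratedFDeriv ℝ k H (r • (w - 0))‖) := by gcongr
    _ ≤ A := by simpa using h3

/-- The span of the simple fractions with poles off `Z`. -/
def fracSpan (Z : Set ℂ) : Submodule ℂ (ℂ → ℂ) :=
  Submodule.span ℂ ((fun w z => (z - w)⁻¹) '' Zᶜ)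

/-- A mollified Cauchy kernel `B(p)/(z - Γ(p))`, regularized at scale `p.2`. -/
def layer (B Γ : ℝ × ℝ → ℂ) (H : ℂ → ℂ) (p : ℝ × ℝ) (z : ℂ) : ℂ :=
  (B p * ((p.2⁻¹ : ℝ) : ℂ)) • H (p.2⁻¹ • (z - Γ p))

/-- The potential of the mollified Cauchy kernel over `[0, T] × [0, ε]`. -/
def layerPot (T ε : ℝ) (B Γ : ℝ × ℝ → ℂ) (H : ℂ → ℂ) (z : ℂ) : ℂ :=
  ∫ p in Icc 0 T ×ˢ Icc 0 ε, layer B Γ H p z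

section

variable {B Γ : ℝ × ℝ → ℂ} {H : ℂ → ℂ}

theorem contDiff_layer (hH : SmoothBdd H) (p : ℝ × ℝ) : ContDiff ℝ ∞ (layer B Γ H p) :=
  (hH.1.comp (by fun_prop)).const_smul _

theorem iteratedFDeriv_layer (hH : SmoothBdd H) (k : ℕ) (p : ℝ × ℝ) (z : ℂ) :
    iteratedFDeriv ℝ k (layer B Γ H p) z =
      (B p * ((p.2⁻¹ : ℝ) : ℂ)) • (p.2⁻¹ ^ k • iteratedFDeriv ℝ k H (p.2⁻¹ • (z - Γ p))) := by
  rw [← iteratedFDeriv_comp_smul_sub hH.1]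
  exact iteratedFDeriv_const_smul_apply' (f := fun z => H (p.2⁻¹ • (z - Γ p)))
    (ContDiff.contDiffAt ((hH.1.of_le (by exact_mod_cast le_top)).comp (by fun_prop)))

theorem norm_iteratedFDeriv_layer_le (hH : SmoothBdd H) {k j : ℕ} {A b : ℝ} (hb : 0 ≤ b)
    (hA : ∀ w, ‖iteratedFDeriv ℝ k H w‖ ≤ A) {p : ℝ × ℝ} (hB : ‖B p‖ ≤ b * |p.2| ^ (k + 1 + j))
    (z : ℂ) : ‖iteratedFDeriv ℝ k (layer B Γ H p) z‖ ≤ b * A * |p.2| ^ j := by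
  have hA0 : 0 ≤ A := (norm_nonneg _).trans (hA 0)
  rw [iteratedFDeriv_layer hH, norm_smul, norm_smul, norm_mul, norm_real, norm_pow,
    Real.norm_eq_abs, abs_inv]
  rcases eq_or_ne p.2 0 with h | h
  · rw [h, abs_zero, inv_zero, mul_zero, zero_mul]
    positivity
  · have h' : |p.2| ≠ 0 := abs_ne_zero.2 h
    calc _ ≤ b * |p.2| ^ (k + 1 + j) * |p.2|⁻¹ * (|p.2|⁻¹ ^ k * A) := by
          gcongr
          exact hA _
      _ = b * A * |p.2| ^ j := by
          rw [pow_add, pow_add, pow_one, inv_pow]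
          field_simp

theorem continuous_iteratedFDeriv_layer (hH : SmoothBdd H) (hBc : Continuous B)
    (hΓ : Continuous Γ) {k : ℕ} {b : ℝ} (hb : 0 ≤ b) (hB : ∀ p, ‖B p‖ ≤ b * |p.2| ^ (k + 2)) :
    Continuous (Function.uncurry fun p z => iteratedFDeriv ℝ k (layer B Γ H p) z) := by
  obtain ⟨A, hA⟩ := hH.2 k
  rw [continuous_iff_continuousAt]
  rintro ⟨p, z⟩
  rcases eq_or_ne p.2 0 with h | h
  · have h0 : (Function.uncurry fun p z => iteratedFDeriv ℝ k (layer B Γ H p) z) (p, z) = 0 := by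
      show iteratedFDeriv ℝ k (layer B Γ H p) z = 0
      have := norm_iteratedFDeriv_layer_le (Γ := Γ) hH (j := 1) hb hA (hB p) z
      rw [h, abs_zero, pow_one, mul_zero] at this
      exact norm_le_zero_iff.1 this
    rw [ContinuousAt, h0, tendsto_zero_iff_norm_tendsto_zero]
    have hlim : Filter.Tendsto (fun q : (ℝ × ℝ) × ℂ => b * A * |q.1.2| ^ 1) (nhds (p, z))
        (nhds 0) := by
      have : Continuous fun q : (ℝ × ℝ) × ℂ => b * A * |q.1.2| ^ 1 := by fun_prop
      have := this.tendsto (p, z)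
      simpa [h] using this
    exact squeeze_zero (fun _ => norm_nonneg _)
      (fun q => norm_iteratedFDeriv_layer_le hH (j := 1) hb hA (hB q.1) q.2) hlim
  · simp only [iteratedFDeriv_layer hH]
    have hc : ContinuousAt (fun q : (ℝ × ℝ) × ℂ => q.1.2⁻¹) (p, z) :=
      ContinuousAt.inv₀ (by fun_prop) h
    have hk : Continuous (iteratedFDeriv ℝ k H) :=
      hH.1.continuous_iteratedFDeriv (m := k) (by exact_mod_cast le_top)
    have h1 : ContinuousAt (fun q : (ℝ × ℝ) × ℂ => q.1.2⁻¹ • (q.2 - Γ q.1)) (p, z) :=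
      hc.smul (Continuous.continuousAt (by fun_prop))
    have h2 : ContinuousAt (fun q : (ℝ × ℝ) × ℂ =>
        iteratedFDeriv ℝ k H (q.1.2⁻¹ • (q.2 - Γ q.1))) (p, z) :=
      ContinuousAt.comp (f := fun q : (ℝ × ℝ) × ℂ => q.1.2⁻¹ • (q.2 - Γ q.1))
        hk.continuousAt h1
    have h3 : ContinuousAt (fun q : (ℝ × ℝ) × ℂ => B q.1 * ((q.1.2⁻¹ : ℝ) : ℂ)) (p, z) :=
      (Continuous.continuousAt (by fun_prop)).mul
        (continuous_ofReal.continuousAt.comp hc)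
    exact h3.smul ((hc.pow k).smul h2)

variable {T ε : ℝ} {b : ℕ → ℝ}

theorem isCompact_rect (T ε : ℝ) : IsCompact (Icc 0 T ×ˢ Icc (0 : ℝ) ε : Set (ℝ × ℝ)) :=
  isCompact_Icc.prod isCompact_Icc

instance (T ε : ℝ) :
    IsFiniteMeasure ((volume : Measure (ℝ × ℝ)).restrict (Icc 0 T ×ˢ Icc (0 : ℝ) ε)) :=
  ⟨by rw [Measure.restrict_apply_univ]; exact (isCompact_rect T ε).measure_lt_top⟩

theorem layerPot_hyp (hH : SmoothBdd H) (hBc : Continuous B) (hΓ : Continuous Γ)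
    (hb : ∀ k, 0 ≤ b k) (hB : ∀ k p, ‖B p‖ ≤ b k * |p.2| ^ k) (k : ℕ) (z : ℂ) :
    AEStronglyMeasurable (fun p => iteratedFDeriv ℝ k (layer B Γ H p) z)
      ((volume : Measure (ℝ × ℝ)).restrict (Icc 0 T ×ˢ Icc (0 : ℝ) ε)) :=
  ((continuous_iteratedFDeriv_layer hH hBc hΓ (hb _) (hB (k + 2))).comp
    (by fun_prop : Continuous fun p : ℝ × ℝ => (p, z))).aestronglyMeasurable

theorem contDiff_layerPot (hH : SmoothBdd H) (hBc : Continuous B) (hΓ : Continuous Γ)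
    (hb : ∀ k, 0 ≤ b k) (hB : ∀ k p, ‖B p‖ ≤ b k * |p.2| ^ k) :
    ContDiff ℝ ∞ (layerPot T ε B Γ H) := by
  choose A hA using hH.2
  exact contDiff_integral_of_bounded (b := fun k _ => b (k + 1) * A k * 1)
    (Filter.Eventually.of_forall fun p => contDiff_layer hH p)
    (layerPot_hyp hH hBc hΓ hb hB) (fun k => integrable_const _)
    (fun k => Filter.Eventually.of_forall fun p z =>
      (norm_iteratedFDeriv_layer_le hH (j := 0) (hb _) (hA k) (hB (k + 1) p) z).trans_eq
        (by rw [pow_zero]))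

theorem iteratedFDeriv_layerPot (hH : SmoothBdd H) (hBc : Continuous B) (hΓ : Continuous Γ)
    (hb : ∀ k, 0 ≤ b k) (hB : ∀ k p, ‖B p‖ ≤ b k * |p.2| ^ k) (k : ℕ) (z : ℂ) :
    iteratedFDeriv ℝ k (layerPot T ε B Γ H) z =
      ∫ p in Icc 0 T ×ˢ Icc 0 ε, iteratedFDeriv ℝ k (layer B Γ H p) z := by
  choose A hA using hH.2
  exact iteratedFDeriv_integral_of_bounded (b := fun k _ => b (k + 1) * A k * 1)
    (Filter.Eventually.of_forall fun p => contDiff_layer hH p)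
    (layerPot_hyp hH hBc hΓ hb hB) (fun k => integrable_const _)
    (fun k => Filter.Eventually.of_forall fun p z =>
      (norm_iteratedFDeriv_layer_le hH (j := 0) (hb _) (hA k) (hB (k + 1) p) z).trans_eq
        (by rw [pow_zero])) k z

theorem norm_iteratedFDeriv_layerPot_le (hH : SmoothBdd H) (hBc : Continuous B)
    (hΓ : Continuous Γ) (hb : ∀ k, 0 ≤ b k) (hB : ∀ k p, ‖B p‖ ≤ b k * |p.2| ^ k) {k : ℕ} {A : ℝ}
    (hA : ∀ w, ‖iteratedFDeriv ℝ k H w‖ ≤ A) (z : ℂ) :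
    ‖iteratedFDeriv ℝ k (layerPot T ε B Γ H) z‖ ≤
      b (k + 1) * A * (volume : Measure (ℝ × ℝ)).real (Icc 0 T ×ˢ Icc (0 : ℝ) ε) := by
  rw [iteratedFDeriv_layerPot hH hBc hΓ hb hB]
  refine norm_setIntegral_le_of_norm_le_const (isCompact_rect T ε).measure_lt_top fun p _ => ?_
  exact (norm_iteratedFDeriv_layer_le hH (j := 0) (hb _) hA (hB (k + 1) p) z).trans_eq
    (by rw [pow_zero, mul_one])

theorem layer_eq_of_lt {c : ℝ} (hHinv : ∀ w, c ≤ ‖w‖ → H w = w⁻¹) {p : ℝ × ℝ} (hp : 0 < p.2)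
    {z : ℂ} (hz : c * p.2 ≤ ‖z - Γ p‖) : layer B Γ H p z = B p * (z - Γ p)⁻¹ := by
  have h1 : c ≤ ‖p.2⁻¹ • (z - Γ p)‖ := by
    rw [norm_smul, norm_inv, Real.norm_of_nonneg hp.le, ← div_eq_inv_mul, le_div_iff₀ hp]
    exact hz
  have hpc : (p.2 : ℂ) ≠ 0 := ofReal_ne_zero.2 hp.ne'
  rw [layer, hHinv _ h1, real_smul, smul_eq_mul, mul_inv, ofReal_inv, inv_inv]
  field_simp

/-- Uniform approximation of layer potentials, with derivatives, by simple fractions. -/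
theorem exists_fracSpan_near_layerPot {c : ℝ} (hc : 0 ≤ c) (hT : 0 ≤ T) (hε : 0 ≤ ε)
    (hH : SmoothBdd H) (hHinv : ∀ w, c ≤ ‖w‖ → H w = w⁻¹) (hBc : Continuous B)
    (hΓ : Continuous Γ) (hb : ∀ k, 0 ≤ b k) (hB : ∀ k p, ‖B p‖ ≤ b k * |p.2| ^ k) {Z : Set ℂ}
    (hZ : IsCompact Z)
    (hfar : ∀ p ∈ Icc 0 T ×ˢ Icc 0 ε, 0 < p.2 → ∀ z ∈ Z, c * p.2 < ‖z - Γ p‖) (P : ℕ) {η : ℝ}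
    (hη : 0 < η) : ∃ v ∈ fracSpan Z, ∀ k ≤ P, ∀ z ∈ Z,
      ‖iteratedFDeriv ℝ k (layerPot T ε B Γ H) z - iteratedFDeriv ℝ k v z‖ ≤ η := by
  set S : Set (ℝ × ℝ) := Icc 0 T ×ˢ Icc 0 ε with hS
  set V := (volume : Measure (ℝ × ℝ)).real S with hV
  have hV0 : 0 ≤ V := measureReal_nonneg
  let F : ℝ × ℝ → ℂ → (k : Fin (P + 1)) → ContinuousMultilinearMap ℝ (fun _ : Fin k => ℂ) ℂ :=
    fun p z k => iteratedFDeriv ℝ k (layer B Γ H p) z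
  have hF : Continuous (Function.uncurry F) := continuous_pi fun k =>
    continuous_iteratedFDeriv_layer hH hBc hΓ (hb _) (hB _)
  obtain ⟨π, hπS, hπ⟩ := exists_simpleFunc_dist_le (isCompact_rect T ε)
    ⟨(0, 0), ⟨le_rfl, hT⟩, ⟨le_rfl, hε⟩⟩ hZ hF (ε := η / (V + 1)) (by positivity)
  let μ := (volume : Measure (ℝ × ℝ)).restrict S
  let wt : ℝ × ℝ → ℂ := fun p => ∫ a in π ⁻¹' {p}, (1 : ℂ) ∂μ
  classical
  refine ⟨∑ p ∈ π.range.filter fun p => 0 < p.2, (wt p * B p) • fun z => (z - Γ p)⁻¹,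
    Submodule.sum_mem _ fun p hp => Submodule.smul_mem _ _ (Submodule.subset_span ⟨Γ p, ?_, rfl⟩),
    fun k hk z hz => ?_⟩
  · obtain ⟨hp1, hp2⟩ := Finset.mem_filter.1 hp
    obtain ⟨x, rfl⟩ := SimpleFunc.mem_range.1 hp1
    intro h
    have := hfar _ (hπS x) hp2 _ h
    rw [sub_self, norm_zero] at this
    exact absurd this (not_lt.2 (by positivity))
  have e1 : iteratedFDeriv ℝ k (∑ p ∈ π.range.filter fun p => 0 < p.2,
      (wt p * B p) • fun z => (z - Γ p)⁻¹) z =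
      iteratedFDeriv ℝ k (fun z => ∑ p ∈ π.range, wt p • layer B Γ H p z) z := by
    refine (Filter.EventuallyEq.iteratedFDeriv ℝ ?_ k).eq_of_nhds
    have hev : ∀ᶠ y in nhds z, ∀ p ∈ π.range.filter fun p => 0 < p.2,
        c * p.2 < ‖y - Γ p‖ := by
      rw [Filter.eventually_all_finset]
      intro p hp
      obtain ⟨hp1, hp2⟩ := Finset.mem_filter.1 hp
      obtain ⟨x, rfl⟩ := SimpleFunc.mem_range.1 hp1
      exact (isOpen_lt continuous_const (by fun_prop)).mem_nhds (hfar _ (hπS x) hp2 z hz)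
    filter_upwards [hev] with y hy
    rw [Finset.sum_apply, Finset.sum_filter]
    refine Finset.sum_congr rfl fun p hp => ?_
    split_ifs with hp2
    · rw [layer_eq_of_lt hHinv hp2 (hy p (Finset.mem_filter.2 ⟨hp, hp2⟩)).le]
      simp [mul_assoc]
    · obtain ⟨x, rfl⟩ := SimpleFunc.mem_range.1 hp
      have : (π x).2 = 0 := le_antisymm (not_lt.1 hp2) (hπS x).2.1
      simp [layer, this]
  have e2 : iteratedFDeriv ℝ k (fun z => ∑ p ∈ π.range, wt p • layer B Γ H p z) z =
      ∑ p ∈ π.range, wt p • iteratedFDeriv ℝ k (layer B Γ H p) z := by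
    have hcd : ∀ p, ContDiffAt ℝ k (layer B Γ H p) z := fun p =>
      ((contDiff_layer hH p).of_le (by exact_mod_cast le_top)).contDiffAt
    rw [iteratedFDeriv_fun_sum_apply (fun p _ => (hcd p).const_smul _)]
    exact Finset.sum_congr rfl fun p _ => iteratedFDeriv_const_smul_apply' (hcd p)
  rw [e1, e2, iteratedFDeriv_layerPot hH hBc hΓ hb hB]
  have e3 := integral_smul_comp_simpleFunc (μ := μ) π
    (fun p => iteratedFDeriv ℝ k (layer B Γ H p) z) (w := fun _ => 1) (integrable_const _)
  simp only [one_smul] at e3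
  rw [← e3]
  obtain ⟨A, hA⟩ := hH.2 k
  have hbd : ∀ p, ‖iteratedFDeriv ℝ k (layer B Γ H p) z‖ ≤ b (k + 1) * A * |p.2| ^ 0 := fun p =>
    norm_iteratedFDeriv_layer_le hH (j := 0) (hb _) hA (hB (k + 1) p) z
  simp only [pow_zero] at hbd
  have i1 : Integrable (fun p => iteratedFDeriv ℝ k (layer B Γ H p) z) μ :=
    Integrable.of_bound (layerPot_hyp hH hBc hΓ hb hB k z) _ (Filter.Eventually.of_forall hbd)
  have i2 : Integrable (fun p => iteratedFDeriv ℝ k (layer B Γ H (π p)) z) μ :=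
    Integrable.of_bound (π.map fun p => iteratedFDeriv ℝ k (layer B Γ H p) z).aestronglyMeasurable
      _ (Filter.Eventually.of_forall fun p => hbd (π p))
  rw [← integral_sub i1 i2]
  refine (norm_setIntegral_le_of_norm_le_const (C := η / (V + 1))
    (isCompact_rect T ε).measure_lt_top fun p hp => ?_).trans ?_
  · have h1 := hπ p hp z hz
    have h2 := dist_le_pi_dist (F p z) (F (π p) z) ⟨k, Nat.lt_succ_of_le hk⟩
    rw [← dist_eq_norm]
    exact h2.trans h1
  · rw [← hS, ← hV, div_mul_eq_mul_div, div_le_iff₀ (by positivity)]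
    nlinarith

end

/-- The Cauchy integral of a density on a closed curve. -/
def cauchyInt (γ ρ : ℝ → ℂ) (z : ℂ) : ℂ :=
  (2 * Real.pi * I)⁻¹ * ∫ u in (0 : ℝ)..2 * Real.pi, ρ u * deriv γ u / (γ u - z)

/-- The Jacobian density of the cut-off extension of `ρ` along the extension of `γ`. -/
def collarDensity (γ : ℝ → ℂ) (ε σ : ℝ) (ρ : ℝ → ℂ) : ℝ × ℝ → ℂ :=
  jac (extCut ε σ (fcoeff ρ)) (stripExt σ (fcoeff γ))

/-- The smooth extension of the Cauchy integral of `ρ` across `γ`, regularized in the collar on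
the side `σ`. -/
def collarPot (γ : ℝ → ℂ) (ε : ℝ) (H : ℂ → ℂ) (σ : ℝ) (ρ : ℝ → ℂ) (z : ℂ) : ℂ :=
  (-(2 * Real.pi * I)⁻¹ : ℂ) •
    layerPot (2 * Real.pi) ε (collarDensity γ ε σ ρ) (stripExt σ (fcoeff γ)) H z

theorem stripExt_zero (σ : ℝ) {ρ : ℝ → ℂ} (hρ : ContDiff ℝ ∞ ρ)
    (hp : Function.Periodic ρ (2 * Real.pi)) (t : ℝ) : stripExt σ (fcoeff ρ) (t, 0) = ρ t :=
  aae_fcoeff (by rw [profile_zero]) hρ hp t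

theorem extCut_zero (ε σ : ℝ) {ρ : ℝ → ℂ} (hρ : ContDiff ℝ ∞ ρ)
    (hp : Function.Periodic ρ (2 * Real.pi)) (t : ℝ) : extCut ε σ (fcoeff ρ) (t, 0) = ρ t := by
  rw [extCut, stripExt_zero σ hρ hp, mul_zero, cutoff_eq_one (by norm_num), one_mul]

theorem extCut_eq_zero {ε : ℝ} (hε : 0 < ε) (σ : ℝ) (a : ℤ → ℂ) (t : ℝ) :
    extCut ε σ a (t, ε) = 0 := by
  rw [extCut, cutoff_eq_zero (by simp [inv_mul_cancel₀ hε.ne']), zero_mul]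

theorem extCut_periodic (ε σ : ℝ) (a : ℤ → ℂ) (t s : ℝ) :
    extCut ε σ a (t + 2 * Real.pi, s) = extCut ε σ a (t, s) := by
  simp only [extCut, ext_periodic]

theorem contDiffAt_of_mem_fracSpan {Z : Set ℂ} {v : ℂ → ℂ} (hv : v ∈ fracSpan Z) {z : ℂ}
    (hz : z ∈ Z) {n : WithTop ℕ∞} : ContDiffAt ℝ n v z := by
  induction hv using Submodule.span_induction with
  | mem v hv =>
    obtain ⟨w, hw, rfl⟩ := hv
    exact (contDiffAt_id.sub contDiffAt_const).inv (sub_ne_zero.2 fun h => hw (h ▸ hz))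
  | zero => exact contDiffAt_const
  | add v w _ _ hv hw => exact hv.add hw
  | smul a v _ hv => exact hv.const_smul a

namespace SmoothJordan

variable {γ : ℝ → ℂ} (hγ : SmoothJordan γ) {ε c : ℝ} {H : ℂ → ℂ}
include hγ

theorem fderiv_stripExt_zero (σ t : ℝ) :
    fderiv ℝ (stripExt σ (fcoeff γ)) (t, 0) (1, 0) = deriv γ t := by
  have h1 : HasDerivAt (fun t => stripExt σ (fcoeff γ) (t, 0))
      (fderiv ℝ (stripExt σ (fcoeff γ)) (t, 0) (1, 0)) t :=
    (((contDiff_ext σ hγ.rapidDecay).differentiable (by simp)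
      (t, 0)).hasFDerivAt).comp_hasDerivAt_of_eq
      t ((hasDerivAt_id t).prodMk (hasDerivAt_const t 0)) rfl
  simp only [stripExt_zero σ hγ.smooth hγ.periodic] at h1
  exact h1.deriv.symm

theorem layerPot_collarDensity (hε : 0 < ε) (hc : 0 < c) (hHinv : ∀ w, c ≤ ‖w‖ → H w = w⁻¹)
    {σ : ℝ} {ρ : ℝ → ℂ} (hρ : ContDiff ℝ ∞ ρ) (hp : Function.Periodic ρ (2 * Real.pi)) {z : ℂ}
    (hz : z ∉ range γ)
    (hfar : ∀ t, ∀ s ∈ Ioc 0 ε, c * s ≤ ‖z - stripExt σ (fcoeff γ) (t, s)‖) :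
    collarPot γ ε H σ ρ z = cauchyInt γ ρ z := by
  have hb := hγ.rapidDecay
  have ha := rapidDecay_fcoeff hρ hp
  have hΓ := contDiff_ext σ hb
  have hne : ∀ t ∈ Icc 0 (2 * Real.pi), ∀ s ∈ Icc 0 ε, stripExt σ (fcoeff γ) (t, s) ≠ z := by
    intro t _ s hs h
    rcases hs.1.eq_or_lt with rfl | h0
    · rw [stripExt_zero σ hγ.smooth hγ.periodic] at h
      exact hz ⟨t, h⟩
    · have := hfar t s ⟨h0, hs.2⟩
      rw [h, sub_self, norm_zero] at this
      nlinarith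
  have h1 := integral_jac_div_eq (contDiff_extCut ε σ ha) hΓ Real.two_pi_pos.le hε.le
    (extCut_periodic ε σ _) (ext_periodic σ _) (extCut_eq_zero hε σ _) hne
  obtain ⟨C, hC0, hC⟩ := exists_norm_jac_extCut_le hε σ hb 1
  have h2 : ∀ p ∈ Icc 0 (2 * Real.pi) ×ˢ Icc 0 ε,
      layer (collarDensity γ ε σ ρ) (stripExt σ (fcoeff γ)) H p z =
      jac (extCut ε σ (fcoeff ρ)) (stripExt σ (fcoeff γ)) p *
        (z - stripExt σ (fcoeff γ) p)⁻¹ := by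
    rintro ⟨t, s⟩ ⟨_, hs⟩
    rcases hs.1.eq_or_lt with h | h0
    · have h := h.symm
      simp only at h
      subst h
      have h0 : jac (extCut ε σ (fcoeff ρ)) (stripExt σ (fcoeff γ)) (t, 0) = 0 := by
        have := hC _ ha (t, 0)
        simpa using this
      simp [layer, h0]
    · exact layer_eq_of_lt hHinv h0 (hfar t s ⟨h0, hs.2⟩)
  have hinteg : IntegrableOn (fun p : ℝ × ℝ =>
      jac (extCut ε σ (fcoeff ρ)) (stripExt σ (fcoeff γ)) p *
        (z - stripExt σ (fcoeff γ) p)⁻¹) (Icc 0 (2 * Real.pi) ×ˢ Icc 0 ε) := by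
    refine ContinuousOn.integrableOn_compact (isCompact_rect _ _) ?_
    refine (continuous_jac (contDiff_extCut ε σ ha) hΓ).continuousOn.mul (ContinuousOn.inv₀
      (continuous_const.sub hΓ.continuous).continuousOn fun p hp => ?_)
    exact sub_ne_zero.2 (hne p.1 hp.1 p.2 hp.2).symm
  rw [collarPot, layerPot, setIntegral_congr_fun (measurableSet_Icc.prod measurableSet_Icc) h2,
    Measure.volume_eq_prod, setIntegral_prod _ (by rwa [← Measure.volume_eq_prod]),
    integral_Icc_eq_integral_Ioc, ← intervalIntegral.integral_of_le Real.two_pi_pos.le]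
  simp only [integral_Icc_eq_integral_Ioc, ← intervalIntegral.integral_of_le hε.le]
  rw [h1, cauchyInt, smul_eq_mul, neg_mul, ← mul_neg, ← intervalIntegral.integral_neg]
  congr 1
  refine intervalIntegral.integral_congr fun u _ => ?_
  simp only [extCut_zero ε σ hρ hp, hγ.fderiv_stripExt_zero, stripExt_zero σ hγ.smooth hγ.periodic]
  rw [← neg_sub, inv_neg, div_eq_mul_inv]
  ring

theorem contDiff_collarPot (hε : 0 < ε) (hH : SmoothBdd H) (σ : ℝ) {ρ : ℝ → ℂ}
    (hρ : ContDiff ℝ ∞ ρ) (hp : Function.Periodic ρ (2 * Real.pi)) :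
    ContDiff ℝ ∞ (collarPot γ ε H σ ρ) := by
  have hb := hγ.rapidDecay
  have ha := rapidDecay_fcoeff hρ hp
  choose C hC0 hC using fun k => exists_norm_jac_extCut_le hε σ hb k
  exact (contDiff_layerPot hH (continuous_jac (contDiff_extCut ε σ ha) (contDiff_ext σ hb))
    (contDiff_ext σ hb).continuous (b := fun k => C k * wnorm (k + 1) (fcoeff ρ))
    (fun k => mul_nonneg (hC0 k) (wnorm_nonneg _ _))
    (fun k p => (hC k _ ha p).trans_eq (by ring))).const_smul _

theorem exists_norm_iteratedFDeriv_collarPot_le (hε : 0 < ε) (hH : SmoothBdd H) (σ : ℝ) (k : ℕ) :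
    ∃ C, 0 ≤ C ∧ ∀ ρ : ℝ → ℂ, ContDiff ℝ ∞ ρ → Function.Periodic ρ (2 * Real.pi) →
      ∀ A, (∀ l ≤ k + 4, ∀ t, ‖iteratedDeriv l ρ t‖ ≤ A) → ∀ z,
        ‖iteratedFDeriv ℝ k (collarPot γ ε H σ ρ) z‖ ≤ C * A := by
  have hb := hγ.rapidDecay
  choose C hC0 hC using fun k => exists_norm_jac_extCut_le hε σ hb k
  obtain ⟨E, hE0, hE⟩ := wnorm_fcoeff_le (k + 2)
  obtain ⟨B, hB⟩ := hH.2 k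
  have hB0 : 0 ≤ B := (norm_nonneg _).trans (hB 0)
  set V := (volume : Measure (ℝ × ℝ)).real (Icc 0 (2 * Real.pi) ×ˢ Icc (0 : ℝ) ε) with hV
  have hV0 : 0 ≤ V := measureReal_nonneg
  have hCk := hC0 (k + 1)
  refine ⟨‖(-(2 * Real.pi * I)⁻¹ : ℂ)‖ * (C (k + 1) * E * B * V), by positivity,
    fun ρ hρ hp A hA z => ?_⟩
  have ha := rapidDecay_fcoeff hρ hp
  have h1 : ContDiff ℝ ∞ (layerPot (2 * Real.pi) ε (collarDensity γ ε σ ρ)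
      (stripExt σ (fcoeff γ)) H) :=
    contDiff_layerPot hH (continuous_jac (contDiff_extCut ε σ ha) (contDiff_ext σ hb))
    (contDiff_ext σ hb).continuous (b := fun k => C k * wnorm (k + 1) (fcoeff ρ))
    (fun k => mul_nonneg (hC0 k) (wnorm_nonneg _ _))
    (fun k p => (hC k _ ha p).trans_eq (by ring))
  have h2 := norm_iteratedFDeriv_layerPot_le (T := 2 * Real.pi) (ε := ε) hH
    (continuous_jac (contDiff_extCut ε σ ha) (contDiff_ext σ hb))
    (contDiff_ext σ hb).continuous (b := fun k => C k * wnorm (k + 1) (fcoeff ρ))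
    (fun k => mul_nonneg (hC0 k) (wnorm_nonneg _ _))
    (fun k p => (hC k _ ha p).trans_eq (by ring)) hB z
  have h3 := hE ρ hρ hp A hA
  have h4 : iteratedFDeriv ℝ k (collarPot γ ε H σ ρ) z = (-(2 * Real.pi * I)⁻¹ : ℂ) •
      iteratedFDeriv ℝ k (layerPot (2 * Real.pi) ε (collarDensity γ ε σ ρ)
        (stripExt σ (fcoeff γ)) H) z :=
    iteratedFDeriv_const_smul_apply' ((h1.of_le (by exact_mod_cast le_top)).contDiffAt)
  rw [h4, norm_smul, mul_assoc ‖(-(2 * Real.pi * I)⁻¹ : ℂ)‖]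
  refine mul_le_mul_of_nonneg_left (le_trans h2 ?_) (norm_nonneg (-(2 * Real.pi * I)⁻¹ : ℂ))
  rw [← hV]
  calc _ ≤ C (k + 1) * (E * A) * B * V := by gcongr
    _ = _ := by ring

theorem exists_fracSpan_near_collarPot (hε : 0 < ε) (hc : 0 < c) (hH : SmoothBdd H)
    (hHinv : ∀ w, c ≤ ‖w‖ → H w = w⁻¹) (σ : ℝ) {ρ : ℝ → ℂ} (hρ : ContDiff ℝ ∞ ρ)
    (hp : Function.Periodic ρ (2 * Real.pi)) {Z : Set ℂ} (hZ : IsCompact Z)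
    (hfar : ∀ t, ∀ s ∈ Ioc 0 ε, ∀ z ∈ Z, c * s < ‖z - stripExt σ (fcoeff γ) (t, s)‖) (P : ℕ)
    {η : ℝ} (hη : 0 < η) : ∃ v ∈ fracSpan Z, ∀ k ≤ P, ∀ z ∈ Z,
      ContDiffAt ℝ ∞ v z ∧
      ‖iteratedFDeriv ℝ k (collarPot γ ε H σ ρ) z - iteratedFDeriv ℝ k v z‖ ≤ η := by
  have hb := hγ.rapidDecay
  have ha := rapidDecay_fcoeff hρ hp
  choose C hC0 hC using fun k => exists_norm_jac_extCut_le hε σ hb k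
  have h1 : ContDiff ℝ ∞ (layerPot (2 * Real.pi) ε (collarDensity γ ε σ ρ)
      (stripExt σ (fcoeff γ)) H) :=
    contDiff_layerPot hH (continuous_jac (contDiff_extCut ε σ ha) (contDiff_ext σ hb))
    (contDiff_ext σ hb).continuous (b := fun k => C k * wnorm (k + 1) (fcoeff ρ))
    (fun k => mul_nonneg (hC0 k) (wnorm_nonneg _ _))
    (fun k p => (hC k _ ha p).trans_eq (by ring))
  set a : ℂ := -(2 * Real.pi * I)⁻¹ with ha'
  have hη' : 0 < η / (‖a‖ + 1) := by positivity
  obtain ⟨v, hv, hv'⟩ := exists_fracSpan_near_layerPot hc.le Real.two_pi_pos.le hε.le hH hHinv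
    (continuous_jac (contDiff_extCut ε σ ha) (contDiff_ext σ hb))
    (contDiff_ext σ hb).continuous (b := fun k => C k * wnorm (k + 1) (fcoeff ρ))
    (fun k => mul_nonneg (hC0 k) (wnorm_nonneg _ _))
    (fun k p => (hC k _ ha p).trans_eq (by ring)) hZ
    (fun p hp h0 z hz => hfar p.1 p.2 ⟨h0, hp.2.2⟩ z hz) P hη'
  refine ⟨a • v, Submodule.smul_mem _ _ hv, fun k hk z hz =>
    ⟨(contDiffAt_of_mem_fracSpan hv hz).const_smul a, ?_⟩⟩
  have h4 : iteratedFDeriv ℝ k (collarPot γ ε H σ ρ) z = a •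
      iteratedFDeriv ℝ k (layerPot (2 * Real.pi) ε (collarDensity γ ε σ ρ)
        (stripExt σ (fcoeff γ)) H) z :=
    iteratedFDeriv_const_smul_apply' ((h1.of_le (by exact_mod_cast le_top)).contDiffAt)
  have h5 : iteratedFDeriv ℝ k (a • v) z = a • iteratedFDeriv ℝ k v z :=
    iteratedFDeriv_const_smul_apply (f := v) (a := a)
      ((contDiffAt_of_mem_fracSpan hv hz).of_le (by exact_mod_cast le_top))
  rw [h4, h5, ← smul_sub, norm_smul]
  calc ‖a‖ * _ ≤ (‖a‖ + 1) * (η / (‖a‖ + 1)) := by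
        gcongr
        · linarith
        · exact hv' k hk z hz
    _ = η := by field_simp

end SmoothJordan

section

open Filter Topology

/-- The regularized boundary value of the Cauchy integral. -/
def bdyInt (γ ρ : ℝ → ℂ) (t : ℝ) : ℂ :=
  ∫ u in (0 : ℝ)..2 * Real.pi, (ρ u - ρ t) * deriv γ u / (γ u - γ t)

namespace SmoothJordan

variable {γ : ℝ → ℂ} (hγ : SmoothJordan γ)
include hγ

theorem continuous_stripExt (σ : ℝ) : Continuous (stripExt σ (fcoeff γ)) :=
  (contDiff_ext σ hγ.rapidDecay).continuous

theorem dqWind_eq (t : ℝ) : dqWind γ t = dqWind γ 0 := by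
  obtain ⟨ε, c, hε, -, hc, h⟩ := hγ.exists_collar
  have hε' : ε ∈ Icc 0 ε := ⟨hε.le, le_rfl⟩
  have key : ∀ t, wind γ (stripExt (-1) (fcoeff γ) (t, ε)) = dqWind γ t := fun t => by
    simpa using (h (-1) (Or.inr rfl) ε hε' t).2 hε
  rw [← key, ← key]
  refine hγ.wind_eq_of_isPreconnected (S := range fun t => stripExt (-1) (fcoeff γ) (t, ε))
    (isPreconnected_range ((hγ.continuous_stripExt _).comp (by fun_prop))) ?_ ⟨t, rfl⟩ ⟨0, rfl⟩
  rw [disjoint_left]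
  rintro _ ⟨t, rfl⟩ ⟨u, hu⟩
  have := ((h (-1) (Or.inr rfl) ε hε' t).1 u).1
  simp only [hu, sub_self, norm_zero] at this
  nlinarith

theorem exists_norm_stripExt_sub_le_mul : ∃ L, 0 ≤ L ∧ ∀ σ : ℝ, σ = 1 ∨ σ = -1 →
    ∀ s ∈ Icc (0 : ℝ) 1, ∀ t, ‖stripExt σ (fcoeff γ) (t, s) - γ t‖ ≤ L * s := by
  have key : ∀ σ : ℝ, |σ| = 1 → ∃ L, 0 ≤ L ∧ ∀ s ∈ Icc (0 : ℝ) 1, ∀ t,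
      ‖stripExt σ (fcoeff γ) (t, s) - γ t‖ ≤ L * s := by
    intro σ hσ
    obtain ⟨C, hC0, hC⟩ := exists_norm_stripExt_sub_le σ hγ.smooth hγ.periodic
    obtain ⟨A, hA⟩ := exists_iteratedDeriv_bound hγ.smooth hγ.periodic 1
    have hA' : ∀ t, ‖deriv γ t‖ ≤ A := fun t => by simpa using hA 1 le_rfl t
    have hA0 : 0 ≤ A := (norm_nonneg _).trans (hA' 0)
    refine ⟨C + A, by positivity, fun s hs t => ?_⟩
    have h1 : ‖I * σ * s * deriv γ t‖ ≤ s * A := by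
      rw [norm_mul, norm_mul, norm_mul, norm_I, norm_real, norm_real, Real.norm_eq_abs, hσ,
        Real.norm_eq_abs, abs_of_nonneg hs.1, one_mul, one_mul]
      exact mul_le_mul_of_nonneg_left (hA' t) hs.1
    have h2 : C * s ^ 2 ≤ C * s :=
      mul_le_mul_of_nonneg_left (by nlinarith [hs.1, hs.2]) hC0
    calc _ = ‖(stripExt σ (fcoeff γ) (t, s) - γ t - I * σ * s * deriv γ t) +
          I * σ * s * deriv γ t‖ := by rw [sub_add_cancel]
      _ ≤ C * s ^ 2 + s * A := (norm_add_le _ _).trans (add_le_add (hC t s) h1)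
      _ ≤ _ := by linarith
  obtain ⟨L₁, h₁, h₁'⟩ := key 1 (by simp)
  obtain ⟨L₂, h₂, h₂'⟩ := key (-1) (by simp)
  refine ⟨L₁ + L₂, by positivity, ?_⟩
  rintro σ (rfl | rfl) s hs t
  · exact (h₁' s hs t).trans (by nlinarith [hs.1])
  · exact (h₂' s hs t).trans (by nlinarith [hs.1])

theorem exists_collar_of_disjoint {Z : Set ℂ} (hZ : IsCompact Z) (hd : Disjoint Z (range γ)) :
    ∃ ε c : ℝ, 0 < ε ∧ 0 < c ∧ ∀ σ : ℝ, σ = 1 ∨ σ = -1 → ∀ s ∈ Ioc 0 ε, ∀ t : ℝ,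
      (∀ u, c * ‖circ t - circ u‖ ≤ ‖stripExt σ (fcoeff γ) (t, s) - γ u‖) ∧
      stripExt σ (fcoeff γ) (t, s) ∉ range γ ∧
      wind γ (stripExt σ (fcoeff γ) (t, s)) = (1 + σ) * (Real.pi * I) + dqWind γ 0 ∧
      (∀ z ∈ Z ∪ range γ, c * s < ‖z - stripExt σ (fcoeff γ) (t, s)‖) ∧
      ∀ z ∉ range γ, wind γ z ≠ (1 + σ) * (Real.pi * I) + dqWind γ 0 →
        c * s < ‖z - stripExt σ (fcoeff γ) (t, s)‖ := by
  obtain ⟨ε, c, hε, hε1, hc, h⟩ := hγ.exists_collar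
  obtain ⟨L, hL0, hL⟩ := hγ.exists_norm_stripExt_sub_le_mul
  obtain ⟨r, hr, hrd⟩ := Metric.exists_pos_forall_lt_edist hZ hγ.isCompact_range.isClosed hd
  have hr' : (0 : ℝ) < r := hr
  refine ⟨min ε (r / (L + c)), c / 2, lt_min hε (by positivity), by positivity,
    fun σ hσ s hs t => ?_⟩
  have hs0 := hs.1
  have hsε : s ∈ Icc 0 ε := ⟨hs0.le, hs.2.trans (min_le_left _ _)⟩
  have hsr : (L + c) * s ≤ r := by
    have := hs.2.trans (min_le_right _ _)
    rwa [le_div_iff₀ (by positivity), mul_comm] at this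
  obtain ⟨h1, h2⟩ := h σ hσ s hsε t
  have h2 := h2 hs0
  rw [hγ.dqWind_eq] at h2
  have h3 : stripExt σ (fcoeff γ) (t, s) ∉ range γ := by
    rintro ⟨u, hu⟩
    have := (h1 u).1
    rw [hu, sub_self, norm_zero] at this
    nlinarith
  refine ⟨fun u => ?_, h3, h2, ?_, fun z hz hw => ?_⟩
  · have := (h1 u).2
    nlinarith [norm_nonneg (circ t - circ u)]
  · rintro z (hz | ⟨u, rfl⟩)
    · have h4 := hrd z hz (γ t) ⟨t, rfl⟩
      rw [edist_dist, ← ENNReal.ofReal_coe_nnreal,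
        ENNReal.ofReal_lt_ofReal_iff_of_nonneg r.coe_nonneg,
        dist_eq_norm] at h4
      have h5 := hL σ hσ s ⟨hs0.le, hsε.2.trans (by linarith)⟩ t
      have h6 := norm_sub_le_norm_sub_add_norm_sub z (stripExt σ (fcoeff γ) (t, s)) (γ t)
      nlinarith
    · rw [norm_sub_rev]
      have := (h1 u).1
      nlinarith
  · by_contra! hlt
    refine hw ((hγ.wind_eq_of_norm_lt h3 hz fun u => ?_).symm.trans h2)
    rw [norm_sub_rev (γ u)]
    have := (h1 u).1
    nlinarith

theorem cauchyInt_eq {ρ : ℝ → ℂ} (hρ : Continuous ρ) {z : ℂ} (hz : z ∉ range γ) (a : ℂ) :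
    cauchyInt γ ρ z = (2 * Real.pi * I)⁻¹ *
      ((∫ u in (0 : ℝ)..2 * Real.pi, (ρ u - a) * deriv γ u / (γ u - z)) + a * wind γ z) := by
  have h0 : ∀ u, γ u - z ≠ 0 := fun u hu => hz ⟨u, sub_eq_zero.1 hu⟩
  have h1 := hγ.continuous_deriv
  have h2 := hγ.continuous
  rw [cauchyInt, wind, ← intervalIntegral.integral_const_mul a, ← intervalIntegral.integral_add]
  · congr 1
    exact intervalIntegral.integral_congr fun u _ => by ring
  · exact (((hρ.sub continuous_const).mul h1).div (h2.sub continuous_const) h0).intervalIntegrable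
      _ _
  · exact (continuous_const.mul (h1.div (h2.sub continuous_const) h0)).intervalIntegrable _ _

theorem tendsto_bdyInt {ρ : ℝ → ℂ} (hρ : ContDiff ℝ ∞ ρ)
    (hp : Function.Periodic ρ (2 * Real.pi)) {w : ℝ → ℂ} {t c : ℝ} (hc : 0 < c)
    (hw : Tendsto w (𝓝[>] 0) (𝓝 (γ t)))
    (hw' : ∀ᶠ s in 𝓝[>] 0, w s ∉ range γ ∧ ∀ u, c * ‖circ t - circ u‖ ≤ ‖w s - γ u‖) :
    Tendsto (fun s => ∫ u in (0 : ℝ)..2 * Real.pi, (ρ u - ρ t) * deriv γ u / (γ u - w s))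
      (𝓝[>] 0) (𝓝 (bdyInt γ ρ t)) := by
  obtain ⟨A, hA⟩ := exists_iteratedDeriv_bound hρ hp 1
  have hA' : ∀ t, ‖deriv ρ t‖ ≤ A := fun t => by simpa using hA 1 le_rfl t
  have hA0 : 0 ≤ A := (norm_nonneg _).trans (hA' 0)
  obtain ⟨B, hB⟩ := exists_iteratedDeriv_bound hγ.smooth hγ.periodic 1
  have hB' : ∀ t, ‖deriv γ t‖ ≤ B := fun t => by simpa using hB 1 le_rfl t
  have hB0 : 0 ≤ B := (norm_nonneg _).trans (hB' 0)
  have hlip : ∀ u, ‖ρ u - ρ t‖ ≤ A * (Real.pi / 2) * ‖circ u - circ t‖ := fun u =>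
    norm_sub_le_of_periodic (hρ.differentiable (by simp)) hp hA' u t
  refine intervalIntegral.tendsto_integral_filter_of_dominated_convergence
    (fun _ => A * (Real.pi / 2) * B / c) ?_ ?_ intervalIntegrable_const ?_
  · filter_upwards [hw'] with s hs
    refine Continuous.aestronglyMeasurable (((hρ.continuous.sub continuous_const).mul
      hγ.continuous_deriv).div (hγ.continuous.sub continuous_const) fun u hu =>
        hs.1 ⟨u, sub_eq_zero.1 hu⟩)
  · filter_upwards [hw'] with s hs
    refine Eventually.of_forall fun u _ => ?_
    have h1 := hs.2 u
    rw [norm_div, norm_mul, norm_sub_rev (γ u)]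
    have h0 : 0 < ‖w s - γ u‖ := norm_pos_iff.2 fun h => hs.1 ⟨u, (sub_eq_zero.1 h).symm⟩
    rw [div_le_div_iff₀ h0 hc]
    have h2 := hlip u
    rw [norm_sub_rev (circ u)] at h2
    calc ‖ρ u - ρ t‖ * ‖deriv γ u‖ * c
        ≤ (A * (Real.pi / 2) * ‖circ t - circ u‖) * B * c := by
          gcongr
          exact hB' u
      _ = (A * (Real.pi / 2) * B) * (c * ‖circ t - circ u‖) := by ring
      _ ≤ _ := by gcongr
  · refine Eventually.of_forall fun u _ => ?_
    by_cases hu : γ u = γ t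
    · have h1 : ρ u - ρ t = 0 := by
        have := hlip u
        rw [hγ.circ_eq hu, sub_self, norm_zero, mul_zero] at this
        exact norm_le_zero_iff.1 this
      simp [h1]
    · exact tendsto_const_nhds.div (tendsto_const_nhds.sub hw) (sub_ne_zero.2 hu)

/-- A smooth continuation across `γ` of the Cauchy integral taken on one side of `γ`, given by
bounded operators and approximable near `γ` and `Z` by simple fractions. -/
theorem exists_operators {Z : Set ℂ} (hZ : IsCompact Z) (hd : Disjoint Z (range γ)) :
    ∃ N : ℝ → (ℝ → ℂ) → ℂ → ℂ, ∀ σ : ℝ, σ = 1 ∨ σ = -1 →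
      (∀ k, ∃ C, 0 ≤ C ∧ ∀ ρ : ℝ → ℂ, ContDiff ℝ ∞ ρ → Function.Periodic ρ (2 * Real.pi) →
        ∀ A, (∀ l ≤ k + 4, ∀ t, ‖iteratedDeriv l ρ t‖ ≤ A) → ∀ z,
          ‖iteratedFDeriv ℝ k (N σ ρ) z‖ ≤ C * A) ∧
      ∀ ρ : ℝ → ℂ, ContDiff ℝ ∞ ρ → Function.Periodic ρ (2 * Real.pi) →
        ContDiff ℝ ∞ (N σ ρ) ∧
        (∀ z ∈ Z, N σ ρ z = cauchyInt γ ρ z) ∧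
        (∀ z ∉ range γ, wind γ z ≠ (1 + σ) * (Real.pi * I) + dqWind γ 0 →
          N σ ρ z = cauchyInt γ ρ z) ∧
        (∀ t, N σ ρ (γ t) = (2 * Real.pi * I)⁻¹ *
          (bdyInt γ ρ t + ρ t * ((1 - σ) * (Real.pi * I) + dqWind γ 0))) ∧
        ∀ P : ℕ, ∀ η : ℝ, 0 < η → ∃ v ∈ fracSpan (Z ∪ range γ), ∀ k ≤ P, ∀ z ∈ Z ∪ range γ,
          ContDiffAt ℝ ∞ v z ∧ ‖iteratedFDeriv ℝ k (N σ ρ) z - iteratedFDeriv ℝ k v z‖ ≤ η := by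
  obtain ⟨ε, c, hε, hc, hcol⟩ := hγ.exists_collar_of_disjoint hZ hd
  obtain ⟨H, hH, hHinv⟩ := exists_smoothBdd_eq_inv hc
  refine ⟨fun σ => collarPot γ ε H σ, fun σ hσ =>
    ⟨fun k => hγ.exists_norm_iteratedFDeriv_collarPot_le hε hH σ k, fun ρ hρ hp => ?_⟩⟩
  have hsm := hγ.contDiff_collarPot hε hH σ hρ hp
  have hwind : ∀ z ∉ range γ, wind γ z ≠ (1 + σ) * (Real.pi * I) + dqWind γ 0 →
      collarPot γ ε H σ ρ z = cauchyInt γ ρ z := fun z hz hw =>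
    hγ.layerPot_collarDensity hε hc hHinv hρ hp hz fun t s hs =>
      ((hcol σ hσ s hs t).2.2.2.2 z hz hw).le
  refine ⟨hsm, fun z hz => hγ.layerPot_collarDensity hε hc hHinv hρ hp (disjoint_left.1 hd hz)
    fun t s hs => ((hcol σ hσ s hs t).2.2.2.1 z (Or.inl hz)).le, hwind, fun t => ?_,
    fun P η hη => hγ.exists_fracSpan_near_collarPot hε hc hH hHinv σ hρ hp
      (hZ.union hγ.isCompact_range) (fun t s hs => (hcol σ hσ s hs t).2.2.2.1) P hη⟩
  have hσ' : -σ = 1 ∨ -σ = -1 := by rcases hσ with rfl | rfl <;> simp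
  set w : ℝ → ℂ := fun s => stripExt (-σ) (fcoeff γ) (t, s) with hw
  have hwt : Tendsto w (𝓝[>] 0) (𝓝 (γ t)) := by
    have h1 : Continuous w := (hγ.continuous_stripExt _).comp (by fun_prop)
    have h2 := h1.tendsto 0
    rw [hw] at h2
    simp only [stripExt_zero (-σ) hγ.smooth hγ.periodic] at h2
    exact h2.mono_left nhdsWithin_le_nhds
  have hev : ∀ᶠ s in 𝓝[>] (0 : ℝ), s ∈ Ioc 0 ε := Ioc_mem_nhdsGT hε
  have h1 := hγ.tendsto_bdyInt hρ hp hc hwt (by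
    filter_upwards [hev] with s hs
    exact ⟨(hcol (-σ) hσ' s hs t).2.1, (hcol (-σ) hσ' s hs t).1⟩)
  have h2 := ((h1.add_const (ρ t * ((1 - σ) * (Real.pi * I) + dqWind γ 0))).const_mul
    ((2 * Real.pi * I)⁻¹ : ℂ))
  refine tendsto_nhds_unique ((hsm.continuous.tendsto _).comp hwt) (h2.congr' ?_)
  filter_upwards [hev] with s hs
  obtain ⟨-, h3, h4, -⟩ := hcol (-σ) hσ' s hs t
  have h5 : wind γ (w s) = (1 - σ) * (Real.pi * I) + dqWind γ 0 := by
    rw [hw]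
    simp only [h4]
    push_cast
    ring
  have hne : wind γ (w s) ≠ (1 + σ) * (Real.pi * I) + dqWind γ 0 := by
    rw [h5]
    intro h
    have h6 : (2 * Real.pi * I) * (σ : ℂ) = 0 := by linear_combination -h
    have h7 : (σ : ℂ) ≠ 0 := by rcases hσ with rfl | rfl <;> simp
    exact mul_ne_zero two_pi_I_ne_zero h7 h6
  rw [Function.comp_apply, hwind _ h3 hne, hγ.cauchyInt_eq hρ.continuous h3 (ρ t), h5]

end SmoothJordan

end

theorem contDiff_div_of_ne_zero {E : Type*} [NormedAddCommGroup E] [NormedSpace ℝ E] {f g : E → ℂ}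
    {n : WithTop ℕ∞} (hf : ContDiff ℝ n f) (hg : ContDiff ℝ n g) (h : ∀ x, g x ≠ 0) :
    ContDiff ℝ n fun x => f x / g x := by
  simp only [div_eq_mul_inv]
  exact hf.mul (hg.inv h)

theorem fderiv_periodic_snd {F : ℝ × ℝ → ℂ} {T : ℝ} (hp : ∀ t s, F (t, s + T) = F (t, s))
    (t s : ℝ) : fderiv ℝ F (t, s + T) = fderiv ℝ F (t, s) := by
  have : (fun p : ℝ × ℝ => F (p + (0, T))) = F := by
    funext ⟨t, s⟩
    simpa using hp t s
  have h := fderiv_comp_add_right (𝕜 := ℝ) (f := F) (x := (t, s)) (0, T)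
  rw [this] at h
  simpa using h.symm

theorem inv_two_pi_I_mul_add_conj (w : ℂ) :
    (2 * Real.pi * I)⁻¹ * w + conj ((2 * Real.pi * I)⁻¹ * w) = ((w.im / Real.pi : ℝ) : ℂ) := by
  have hpi : (Real.pi : ℂ) ≠ 0 := ofReal_ne_zero.2 Real.pi_ne_zero
  have h : conj w = w - 2 * w.im * I := by
    apply Complex.ext <;> simp
    ring
  rw [map_mul, map_inv₀, map_mul, map_mul, conj_I, conj_ofReal, map_ofNat, h, ofReal_div]
  field_simp
  ring

theorem integral_add_conj_integral {f w : ℝ → ℂ}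
    (h : IntervalIntegrable (fun u => f u * w u) volume 0 (2 * Real.pi))
    (h' : IntervalIntegrable (fun u => conj (f u) * w u) volume 0 (2 * Real.pi)) :
    (2 * Real.pi * I)⁻¹ * (∫ u in (0 : ℝ)..2 * Real.pi, f u * w u) +
      conj ((2 * Real.pi * I)⁻¹ * ∫ u in (0 : ℝ)..2 * Real.pi, conj (f u) * w u) =
    ∫ u in (0 : ℝ)..2 * Real.pi, (((w u).im / Real.pi : ℝ) : ℂ) * f u := by
  rw [← intervalIntegral.integral_const_mul, ← intervalIntegral.integral_const_mul,
    ← intervalIntegral.intervalIntegral_conj, ← intervalIntegral.integral_add]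
  · refine intervalIntegral.integral_congr fun u _ => ?_
    rw [← inv_two_pi_I_mul_add_conj]
    simp only [map_mul, conj_conj]
    ring
  · exact h.const_mul _
  · have h2 := h'.const_mul ((2 * Real.pi * I)⁻¹ : ℂ)
    rw [intervalIntegrable_iff] at h2 ⊢
    exact conjCLE.toContinuousLinearMap.integrable_comp h2

theorem im_circ_div_sub {u t : ℝ} (h : circ u ≠ circ t) :
    (I * circ u / (circ u - circ t)).im = 1 / 2 := by
  have h1 : circ u - circ t ≠ 0 := sub_ne_zero.2 h
  have key : circ u / (circ u - circ t) + conj (circ u / (circ u - circ t)) = 1 := by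
    have hc : ∀ s, conj (circ s) = (circ s)⁻¹ := fun s => by
      rw [← inv_eq_conj (norm_circ s)]
    have h2 : (circ u)⁻¹ - (circ t)⁻¹ ≠ 0 := sub_ne_zero.2 fun h' => h (inv_injective h')
    rw [map_div₀, map_sub, hc, hc]
    have := circ_ne_zero u
    have := circ_ne_zero t
    have h3 : circ t - circ u ≠ 0 := sub_ne_zero.2 h.symm
    have h4 : (circ u)⁻¹ - (circ t)⁻¹ = (circ t - circ u) / (circ u * circ t) := by field_simp
    rw [h4]
    field_simp
    ring
  rw [mul_div_assoc, I_mul_im]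
  have := congrArg re key
  rw [add_re, conj_re, one_re] at this
  linarith

namespace SmoothJordan

variable {γ : ℝ → ℂ} (hγ : SmoothJordan γ)
include hγ

theorem exists_kernel_cross {γ' : ℝ → ℂ} (hγ' : SmoothJordan γ')
    (hd : Disjoint (range γ) (range γ')) :
    ∃ k : ℝ × ℝ → ℂ, ContDiff ℝ ∞ k ∧ (∀ t u, k (t + 2 * Real.pi, u) = k (t, u)) ∧
      ∀ ρ : ℝ → ℂ, Continuous ρ → ∀ t,
        cauchyInt γ ρ (γ' t) + conj (cauchyInt γ (fun u => conj (ρ u)) (γ' t)) =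
          ∫ u in (0 : ℝ)..2 * Real.pi, k (t, u) * ρ u := by
  have hne : ∀ t u, γ u - γ' t ≠ 0 := fun t u h =>
    disjoint_left.1 hd ⟨u, sub_eq_zero.1 h⟩ ⟨t, rfl⟩
  refine ⟨fun p => (((deriv γ p.2 / (γ p.2 - γ' p.1)).im / Real.pi : ℝ) : ℂ), ?_, ?_, ?_⟩
  · have h1 : ContDiff ℝ ∞ fun p : ℝ × ℝ => deriv γ p.2 / (γ p.2 - γ' p.1) :=
      contDiff_div_of_ne_zero ((contDiff_infty_iff_deriv.1 hγ.smooth).2.comp contDiff_snd)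
        ((hγ.smooth.comp contDiff_snd).sub (hγ'.smooth.comp contDiff_fst)) fun p => hne p.1 p.2
    exact ofRealCLM.contDiff.comp ((imCLM.contDiff.comp h1).div_const _)
  · intro t u
    simp only [hγ'.periodic t]
  · intro ρ hρ t
    have hw : Continuous fun u => deriv γ u / (γ u - γ' t) :=
      hγ.continuous_deriv.div (hγ.continuous.sub continuous_const) (hne t)
    simp only [cauchyInt, mul_div_assoc]
    exact integral_add_conj_integral ((hρ.mul hw).intervalIntegrable _ _)
      (((continuous_conj.comp hρ).mul hw).intervalIntegrable _ _)

/-- The logarithmic derivative of the divided difference. -/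
theorem integral_fderiv_dq (t : ℝ) :
    ∫ u in (0 : ℝ)..2 * Real.pi, fderiv ℝ (dq γ) (u, t) (1, 0) / dq γ (u, t) = dqWind γ t := by
  refine intervalIntegral.integral_congr fun u _ => ?_
  rw [hγ.dq_symm t u]
  congr 1
  have h1 : HasDerivAt (fun s => dq γ (s, t)) (fderiv ℝ (dq γ) (u, t) (1, 0)) u :=
    ((hγ.contDiff_dq.differentiable (by simp) (u, t)).hasFDerivAt).comp_hasDerivAt_of_eq u
      ((hasDerivAt_id u).prodMk (hasDerivAt_const u t)) rfl
  rw [← h1.deriv]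
  congr 1
  funext s
  exact hγ.dq_symm _ _

theorem deriv_div_sub_eq {u t : ℝ} (h : circ u ≠ circ t) :
    deriv γ u / (γ u - γ t) =
      I * circ u / (circ u - circ t) + fderiv ℝ (dq γ) (u, t) (1, 0) / dq γ (u, t) := by
  have h1 : circ u - circ t ≠ 0 := sub_ne_zero.2 h
  have h2 := hγ.dq_ne_zero (u, t)
  rw [hγ.deriv_eq u t, ← hγ.sub_mul_dq u t]
  field_simp

theorem intervalIntegrable_sub_mul_deriv_div {ρ : ℝ → ℂ} (hρ : ContDiff ℝ ∞ ρ)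
    (hp : Function.Periodic ρ (2 * Real.pi)) (t : ℝ) :
    IntervalIntegrable (fun u => (ρ u - ρ t) * (deriv γ u / (γ u - γ t))) volume 0
      (2 * Real.pi) := by
  obtain ⟨A, hA⟩ := exists_iteratedDeriv_bound hρ hp 1
  have hA' : ∀ t, ‖deriv ρ t‖ ≤ A := fun t => by simpa using hA 1 le_rfl t
  have hA0 : 0 ≤ A := (norm_nonneg _).trans (hA' 0)
  obtain ⟨B, hB⟩ := exists_iteratedDeriv_bound hγ.smooth hγ.periodic 1
  have hB' : ∀ t, ‖deriv γ t‖ ≤ B := fun t => by simpa using hB 1 le_rfl t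
  have hB0 : 0 ≤ B := (norm_nonneg _).trans (hB' 0)
  obtain ⟨q, hq, hq'⟩ := hγ.exists_le_norm_dq
  have hmeas : Measurable fun u => (ρ u - ρ t) * (deriv γ u / (γ u - γ t)) :=
    (hρ.continuous.measurable.sub_const _).mul (hγ.continuous_deriv.measurable.div
      (hγ.continuous.measurable.sub_const _))
  refine (intervalIntegrable_const (c := A * (Real.pi / 2) * (B / q))).mono_fun
    hmeas.aestronglyMeasurable (Filter.Eventually.of_forall fun u => ?_)
  simp only
  rw [Real.norm_of_nonneg (by positivity), norm_mul]
  have hlip := norm_sub_le_of_periodic (hρ.differentiable (by simp)) hp hA' u t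
  by_cases h : circ u = circ t
  · rw [h, sub_self, norm_zero, mul_zero] at hlip
    rw [le_antisymm hlip (norm_nonneg _), zero_mul]
    positivity
  · have h1 : 0 < ‖circ u - circ t‖ := norm_pos_iff.2 (sub_ne_zero.2 h)
    rw [← hγ.sub_mul_dq, norm_div, norm_mul]
    calc ‖ρ u - ρ t‖ * (‖deriv γ u‖ / (‖circ u - circ t‖ * ‖dq γ (u, t)‖))
        ≤ (A * (Real.pi / 2) * ‖circ u - circ t‖) * (B / (‖circ u - circ t‖ * q)) := by
          gcongr
          · exact hB' u
          · exact hq' _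
      _ = _ := by field_simp

theorem exists_kernel_self : ∃ k : ℝ × ℝ → ℂ, ContDiff ℝ ∞ k ∧
    (∀ t u, k (t + 2 * Real.pi, u) = k (t, u)) ∧
      ∀ σ : ℝ, ∀ ρ : ℝ → ℂ, ContDiff ℝ ∞ ρ → Function.Periodic ρ (2 * Real.pi) → ∀ t,
        (2 * Real.pi * I)⁻¹ * (bdyInt γ ρ t + ρ t * ((1 - σ) * (Real.pi * I) + dqWind γ 0)) +
          conj ((2 * Real.pi * I)⁻¹ * (bdyInt γ (fun u => conj (ρ u)) t +
            conj (ρ t) * ((1 - σ) * (Real.pi * I) + dqWind γ 0))) =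
          -σ * ρ t + ∫ u in (0 : ℝ)..2 * Real.pi, k (t, u) * ρ u := by
  set q : ℝ × ℝ → ℂ := fun p => fderiv ℝ (dq γ) (p.2, p.1) (1, 0) / dq γ (p.2, p.1) with hq
  have hqs : ContDiff ℝ ∞ q := by
    have h1 : ContDiff ℝ ∞ fun p : ℝ × ℝ => fderiv ℝ (dq γ) (p.2, p.1) (1, 0) :=
      (((hγ.contDiff_dq.fderiv_right (m := ∞) (by simp)).comp
        (contDiff_snd.prodMk contDiff_fst)).clm_apply contDiff_const)
    exact contDiff_div_of_ne_zero h1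
      (hγ.contDiff_dq.comp (contDiff_snd.prodMk contDiff_fst)) fun p =>
      hγ.dq_ne_zero _
  set k : ℝ × ℝ → ℂ := fun p => (((1 / 2 + (q p).im) / Real.pi : ℝ) : ℂ) with hk
  have hks : ContDiff ℝ ∞ k := ofRealCLM.contDiff.comp
    ((contDiff_const.add (imCLM.contDiff.comp hqs)).div_const _)
  refine ⟨k, hks, fun t u => ?_, fun σ ρ hρ hp t => ?_⟩
  · have h1 := fun s t => divDiff_periodic_snd (fcoeff γ) s t
    simp only [hk, hq, dq, fderiv_periodic_snd h1, h1]
  set D := dqWind γ 0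
  set W : ℂ := (1 - σ) * (Real.pi * I) + D with hW
  have hpi : (Real.pi : ℂ) ≠ 0 := ofReal_ne_zero.2 Real.pi_ne_zero
  have hcp : ContDiff ℝ ∞ fun u => conj (ρ u) := conjCLE.contDiff.comp hρ
  have hpp : Function.Periodic (fun u => conj (ρ u)) (2 * Real.pi) := fun u => by
    simp only [hp u]
  have h1 : (2 * Real.pi * I)⁻¹ * bdyInt γ ρ t +
      conj ((2 * Real.pi * I)⁻¹ * bdyInt γ (fun u => conj (ρ u)) t) =
      ∫ u in (0 : ℝ)..2 * Real.pi, k (t, u) * (ρ u - ρ t) := by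
    have h2 := integral_add_conj_integral (hγ.intervalIntegrable_sub_mul_deriv_div hρ hp t)
      (by simpa only [map_sub] using hγ.intervalIntegrable_sub_mul_deriv_div hcp hpp t)
    simp only [map_sub] at h2
    simp only [bdyInt, mul_div_assoc]
    rw [h2]
    refine intervalIntegral.integral_congr fun u _ => ?_
    by_cases h : circ u = circ t
    · obtain ⟨m, rfl⟩ := exists_int_of_circ_eq h
      have h3 : ρ (t + m * (2 * Real.pi)) = ρ t := by
        rw [← hp.sub_int_mul_eq m, add_sub_cancel_right]
      simp only [h3, sub_self, mul_zero]
    · simp only [hk, hq]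
      rw [hγ.deriv_div_sub_eq h, add_im, im_circ_div_sub h]
  have hkt : Continuous fun u => k (t, u) := hks.continuous.comp (by fun_prop)
  have hqt : Continuous fun u => q (t, u) := hqs.continuous.comp (by fun_prop)
  have h2 : ∫ u in (0 : ℝ)..2 * Real.pi, k (t, u) * (ρ u - ρ t) =
      (∫ u in (0 : ℝ)..2 * Real.pi, k (t, u) * ρ u) -
        (∫ u in (0 : ℝ)..2 * Real.pi, k (t, u)) * ρ t := by
    rw [← intervalIntegral.integral_mul_const, ← intervalIntegral.integral_sub]
    · simp only [mul_sub]
    · exact (hkt.mul hρ.continuous).intervalIntegrable _ _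
    · exact (hkt.mul continuous_const).intervalIntegrable _ _
  have h3 : ∫ u in (0 : ℝ)..2 * Real.pi, k (t, u) = ((1 + D.im / Real.pi : ℝ) : ℂ) := by
    have h4 : ∫ u in (0 : ℝ)..2 * Real.pi, (q (t, u)).im = D.im := by
      have h5 := imCLM.intervalIntegral_comp_comm (μ := volume)
        (hqt.intervalIntegrable 0 (2 * Real.pi))
      rw [hγ.integral_fderiv_dq t, hγ.dqWind_eq t] at h5
      exact h5
    simp only [hk]
    rw [intervalIntegral.integral_ofReal, intervalIntegral.integral_div,
      intervalIntegral.integral_add intervalIntegrable_const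
        ((continuous_im.comp' hqt).intervalIntegrable _ _), h4, intervalIntegral.integral_const]
    congr 1
    simp only [smul_eq_mul]
    field_simp
    ring
  have h4 : W.im = (1 - σ) * Real.pi + D.im := by simp [hW]
  have h5 := inv_two_pi_I_mul_add_conj W
  rw [h4] at h5
  have h6 : (2 * Real.pi * I)⁻¹ * (bdyInt γ ρ t + ρ t * W) +
      conj ((2 * Real.pi * I)⁻¹ * (bdyInt γ (fun u => conj (ρ u)) t + conj (ρ t) * W)) =
      ((2 * Real.pi * I)⁻¹ * bdyInt γ ρ t +
        conj ((2 * Real.pi * I)⁻¹ * bdyInt γ (fun u => conj (ρ u)) t)) +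
      ρ t * ((2 * Real.pi * I)⁻¹ * W + conj ((2 * Real.pi * I)⁻¹ * W)) := by
    simp only [map_mul, map_add, conj_conj]
    ring
  rw [h6, h1, h2, h3, h5]
  push_cast
  field_simp
  ring

end SmoothJordan

section

open scoped BoundedContinuousFunction

theorem continuous_iteratedFDeriv_partial {k : ℝ × ℝ → ℂ} (hk : ContDiff ℝ ∞ k) (l : ℕ) :
    Continuous fun p : ℝ × ℝ => iteratedFDeriv ℝ l (fun t => k (t, p.2)) p.1 := by
  have key : ∀ p : ℝ × ℝ, iteratedFDeriv ℝ l (fun t => k (t, p.2)) p.1 =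
      (iteratedFDeriv ℝ l k p).compContinuousLinearMap
        fun _ => ContinuousLinearMap.inl ℝ ℝ ℝ := by
    rintro ⟨t, u⟩
    have h1 : (fun t => k (t, u)) =
        (fun q => k (q + (0, u))) ∘ ContinuousLinearMap.inl ℝ ℝ ℝ := by
      funext s
      simp
    have h2 : ContDiff ℝ ∞ fun q => k (q + (0, u)) := hk.comp (contDiff_id.add contDiff_const)
    rw [h1, ContinuousLinearMap.iteratedFDeriv_comp_right _ h2 _ (by exact_mod_cast le_top),
      iteratedFDeriv_comp_add_right]
    simp
  simp only [key]
  exact (ContinuousMultilinearMap.compContinuousLinearMapL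
    fun _ : Fin l => ContinuousLinearMap.inl ℝ ℝ ℝ).continuous.comp
      (hk.continuous_iteratedFDeriv (by exact_mod_cast le_top))

theorem exists_bound_partial {k : ℝ × ℝ → ℂ} (hk : ContDiff ℝ ∞ k)
    (hp : ∀ t u, k (t + 2 * Real.pi, u) = k (t, u)) (l : ℕ) :
    ∃ B, 0 ≤ B ∧ ∀ u ∈ Icc 0 (2 * Real.pi), ∀ t,
      ‖iteratedFDeriv ℝ l (fun t => k (t, u)) t‖ ≤ B := by
  obtain ⟨B, hB⟩ := (isCompact_Icc.prod isCompact_Icc :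
    IsCompact (Icc 0 (2 * Real.pi) ×ˢ Icc 0 (2 * Real.pi))).exists_bound_of_continuousOn
    (continuous_iteratedFDeriv_partial hk l).continuousOn
  have h0 : (0 : ℝ) ∈ Icc 0 (2 * Real.pi) := ⟨le_rfl, Real.two_pi_pos.le⟩
  refine ⟨B, (norm_nonneg _).trans (hB (0, 0) ⟨h0, h0⟩), fun u hu t => ?_⟩
  obtain ⟨m, hm⟩ := exists_Ico_circ t
  have h1 : Function.Periodic (fun t => k (t, u)) (2 * Real.pi) := fun t => hp t u
  rw [norm_iteratedFDeriv_eq_norm_iteratedDeriv,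
    ← (periodic_iteratedDeriv h1 l).sub_int_mul_eq m,
    ← norm_iteratedFDeriv_eq_norm_iteratedDeriv]
  exact hB (t - m * (2 * Real.pi), u) ⟨⟨hm.1, hm.2.le⟩, hu⟩

theorem contDiff_kernel {k : ℝ × ℝ → ℂ} (hk : ContDiff ℝ ∞ k)
    (hp : ∀ t u, k (t + 2 * Real.pi, u) = k (t, u)) :
    (∀ ρ : ℝ →ᵇ ℂ, ContDiff ℝ ∞ fun t => ∫ u in Icc 0 (2 * Real.pi), k (t, u) * ρ u) ∧
    ∀ l, ∃ C, 0 ≤ C ∧ ∀ (ρ : ℝ →ᵇ ℂ) (t : ℝ), ‖iteratedFDeriv ℝ l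
      (fun t => ∫ u in Icc 0 (2 * Real.pi), k (t, u) * ρ u) t‖ ≤ C * ‖ρ‖ := by
  choose B hB0 hB using exists_bound_partial hk hp
  have hsm : ∀ (ρ : ℝ →ᵇ ℂ) u, ContDiff ℝ ∞ fun t => k (t, u) * ρ u := fun ρ u =>
    (hk.comp (contDiff_id.prodMk contDiff_const)).mul contDiff_const
  have hD : ∀ (ρ : ℝ →ᵇ ℂ) l u t, iteratedFDeriv ℝ l (fun t => k (t, u) * ρ u) t =
      ρ u • iteratedFDeriv ℝ l (fun t => k (t, u)) t := by
    intro ρ l u t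
    have : (fun t => k (t, u) * ρ u) = fun t => ρ u • k (t, u) := by
      funext t
      rw [smul_eq_mul, mul_comm]
    rw [this]
    exact iteratedFDeriv_const_smul_apply' (f := fun t => k (t, u)) (a := ρ u)
      ((hk.comp (contDiff_id.prodMk contDiff_const)).of_le (by exact_mod_cast le_top)).contDiffAt
  have hm : ∀ (ρ : ℝ →ᵇ ℂ) l t, AEStronglyMeasurable
      (fun u => iteratedFDeriv ℝ l (fun t => k (t, u) * ρ u) t)
      (volume.restrict (Icc 0 (2 * Real.pi))) := by
    intro ρ l t
    simp only [hD]
    exact (ρ.continuous.smul ((continuous_iteratedFDeriv_partial hk l).comp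
      (by fun_prop : Continuous fun u : ℝ => (t, u)))).aestronglyMeasurable
  have hbd : ∀ (ρ : ℝ →ᵇ ℂ) l, ∀ᵐ u ∂(volume.restrict (Icc 0 (2 * Real.pi))), ∀ t,
      ‖iteratedFDeriv ℝ l (fun t => k (t, u) * ρ u) t‖ ≤ B l * ‖ρ‖ := by
    intro ρ l
    refine (ae_restrict_iff' measurableSet_Icc).2 (Filter.Eventually.of_forall fun u hu t => ?_)
    rw [hD, norm_smul, mul_comm]
    exact mul_le_mul (hB l u hu t) (ρ.norm_coe_le_norm u) (norm_nonneg _) (hB0 l)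
  refine ⟨fun ρ => contDiff_integral_of_bounded (Filter.Eventually.of_forall (hsm ρ)) (hm ρ)
    (b := fun l _ => B l * ‖ρ‖) (fun l => integrable_const _) (hbd ρ), fun l =>
    ⟨2 * Real.pi * B l, mul_nonneg Real.two_pi_pos.le (hB0 l), fun ρ t => ?_⟩⟩
  refine (norm_iteratedFDeriv_integral_le (Filter.Eventually.of_forall (hsm ρ)) (hm ρ)
    (b := fun l _ => B l * ‖ρ‖) (fun l => integrable_const _) (hbd ρ) l t).trans_eq ?_
  rw [integral_const]
  simp [Real.two_pi_pos.le]
  ring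

/-- A smoothing operator is a small smoothing operator up to an operator with values in a subspace
that is uniformly dense. -/
theorem exists_small_operator {ι : Type*} [Fintype ι] (W : Submodule ℂ (ι → ℝ → ℂ))
    (hW : ∀ w ∈ W, ∀ j, ContDiff ℝ ∞ (w j) ∧ Function.Periodic (w j) (2 * Real.pi))
    (hWd : ∀ f : ι → ℝ → ℂ, (∀ j, ContDiff ℝ ∞ (f j)) →
      (∀ j, Function.Periodic (f j) (2 * Real.pi)) → ∀ η : ℝ, 0 < η →
        ∃ w ∈ W, ∀ j t, ‖f j t - w j t‖ ≤ η)
    (k : ι → ℝ × ℝ → ℂ) (hk : ∀ j, ContDiff ℝ ∞ (k j))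
    (hp : ∀ j t u, k j (t + 2 * Real.pi, u) = k j (t, u)) {η : ℝ} (hη : 0 < η) :
    ∃ T : (ℝ →ᵇ ℂ) →ₗ[ℂ] (ι → ℝ → ℂ),
      (∀ ρ j, ContDiff ℝ ∞ (T ρ j) ∧ Function.Periodic (T ρ j) (2 * Real.pi)) ∧
      (∀ l, ∃ C, 0 ≤ C ∧ ∀ ρ j t, ‖iteratedFDeriv ℝ l (T ρ j) t‖ ≤ C * ‖ρ‖) ∧
      (∀ ρ j t, ‖T ρ j t‖ ≤ η * ‖ρ‖) ∧
      ∀ ρ : ℝ →ᵇ ℂ, (fun j t => (∫ u in (0 : ℝ)..2 * Real.pi, k j (t, u) * ρ u) - T ρ j t) ∈ W := by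
  set μ : Measure ℝ := volume.restrict (Icc 0 (2 * Real.pi)) with hμ
  set a : ℝ := η / (4 * Real.pi) with ha
  have ha0 : 0 < a := by positivity
  obtain ⟨π, hπK, hπ⟩ := exists_simpleFunc_dist_le (K := Icc 0 (2 * Real.pi))
    (Z := Icc 0 (2 * Real.pi)) isCompact_Icc ⟨0, le_rfl, Real.two_pi_pos.le⟩ isCompact_Icc
    (F := fun u t j => k j (t, u)) (continuous_pi fun j => (hk j).continuous.comp
      (by fun_prop : Continuous fun p : ℝ × ℝ => (p.2, p.1))) ha0
  choose w hwW hw using fun u : ℝ => hWd (fun j t => k j (t, u))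
    (fun j => (hk j).comp (contDiff_id.prodMk contDiff_const)) (fun j t => hp j t u) a ha0
  have hπ' : ∀ u ∈ Icc 0 (2 * Real.pi), ∀ j t, ‖k j (t, u) - k j (t, π u)‖ ≤ a := by
    intro u hu j t
    obtain ⟨m, hm⟩ := exists_Ico_circ t
    have h1 := hπ u hu _ ⟨hm.1, hm.2.le⟩
    have h2 : ∀ u, k j (t - m * (2 * Real.pi), u) = k j (t, u) := fun u =>
      Function.Periodic.sub_int_mul_eq (f := fun t => k j (t, u)) (fun t => hp j t u) m
    have h3 := (dist_le_pi_dist _ _ j).trans h1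
    rwa [h2, h2, dist_eq_norm] at h3
  have hinteg : ∀ ρ : ℝ →ᵇ ℂ, Integrable ρ μ := fun ρ =>
    ρ.continuous.integrableOn_Icc
  have hkint : ∀ (ρ : ℝ →ᵇ ℂ) j t, Integrable (fun u => k j (t, u) * ρ u) μ := fun ρ j t =>
    (((hk j).continuous.comp (by fun_prop : Continuous fun u : ℝ => (t, u))).mul
      ρ.continuous).integrableOn_Icc
  let T : (ℝ →ᵇ ℂ) →ₗ[ℂ] (ι → ℝ → ℂ) :=
    { toFun := fun ρ j t => (∫ u, k j (t, u) * ρ u ∂μ) -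
        ∑ p ∈ π.range, (∫ u in π ⁻¹' {p}, ρ u ∂μ) * w p j t
      map_add' := fun ρ ρ' => by
        funext j t
        have h1 : ∀ p, ∫ u in π ⁻¹' {p}, (ρ + ρ') u ∂μ =
            (∫ u in π ⁻¹' {p}, ρ u ∂μ) + ∫ u in π ⁻¹' {p}, ρ' u ∂μ := fun p =>
          integral_add (hinteg ρ).integrableOn (hinteg ρ').integrableOn
        have h2 : ∫ u, k j (t, u) * (ρ + ρ') u ∂μ =
            (∫ u, k j (t, u) * ρ u ∂μ) + ∫ u, k j (t, u) * ρ' u ∂μ := by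
          rw [← integral_add (hkint ρ j t) (hkint ρ' j t)]
          simp [mul_add]
        simp only [h1, h2, add_mul, Finset.sum_add_distrib, Pi.add_apply]
        ring
      map_smul' := fun c ρ => by
        funext j t
        have h1 : ∀ p, ∫ u in π ⁻¹' {p}, (c • ρ) u ∂μ = c * ∫ u in π ⁻¹' {p}, ρ u ∂μ := fun p => by
          rw [← integral_const_mul]
          rfl
        have h2 : ∫ u, k j (t, u) * (c • ρ) u ∂μ = c * ∫ u, k j (t, u) * ρ u ∂μ := by
          rw [← integral_const_mul]
          congr 1
          funext u
          simp
          ring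
        simp only [h1, h2, Pi.smul_apply, smul_eq_mul, RingHom.id_apply, mul_sub, Finset.mul_sum,
          mul_assoc] }
  have hTdef : ∀ ρ j t, T ρ j t = (∫ u, k j (t, u) * ρ u ∂μ) -
        ∑ p ∈ π.range, (∫ u in π ⁻¹' {p}, ρ u ∂μ) * w p j t := fun _ _ _ => rfl
  have hTfun : ∀ ρ j, T ρ j = fun t => (∫ u, k j (t, u) * ρ u ∂μ) -
        ∑ p ∈ π.range, (∫ u in π ⁻¹' {p}, ρ u ∂μ) * w p j t := fun _ _ => rfl
  have hK := fun j => contDiff_kernel (hk j) (hp j)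
  have hs : ∀ (ρ : ℝ →ᵇ ℂ) j, ContDiff ℝ ∞ fun t =>
      ∑ p ∈ π.range, (∫ u in π ⁻¹' {p}, ρ u ∂μ) * w p j t := fun ρ j =>
    ContDiff.sum fun p _ => contDiff_const.mul (hW _ (hwW p) j).1
  refine ⟨T, fun ρ j => ⟨?_, fun t => ?_⟩, fun l => ?_, fun ρ j t => ?_, fun ρ => ?_⟩
  · rw [hTfun]
    exact ((hK j).1 ρ).sub (hs ρ j)
  · rw [hTdef, hTdef]
    simp only [hp, fun p => (hW _ (hwW p) j).2 t]
  · choose Ck hCk0 hCk using fun j => (hK j).2 l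
    choose A hA using fun p j => exists_iteratedDeriv_bound (hW _ (hwW p) j).1 (hW _ (hwW p) j).2 l
    have hA0 : ∀ p j, 0 ≤ A p j := fun p j => (norm_nonneg _).trans (hA p j l le_rfl 0)
    have hpj : ∀ (ρ : ℝ →ᵇ ℂ) p, ‖∫ u in π ⁻¹' {p}, ρ u ∂μ‖ ≤ 2 * Real.pi * ‖ρ‖ := by
      intro ρ p
      refine (norm_integral_le_integral_norm _).trans ((setIntegral_le_integral (hinteg ρ).norm
        (Filter.Eventually.of_forall fun _ => norm_nonneg _)).trans
        ((integral_mono (hinteg ρ).norm (integrable_const ‖ρ‖) ρ.norm_coe_le_norm).trans_eq ?_))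
      rw [integral_const]
      simp [hμ, Real.two_pi_pos.le]
    refine ⟨∑ j, (Ck j + ∑ p ∈ π.range, 2 * Real.pi * A p j), Finset.sum_nonneg fun j _ =>
      add_nonneg (hCk0 j) (Finset.sum_nonneg fun p _ => mul_nonneg Real.two_pi_pos.le (hA0 p j)),
      fun ρ j t => ?_⟩
    have hl : ((l : ℕ) : ℕ∞ω) ≤ ∞ := by exact_mod_cast le_top
    have hterm : ∀ p, ContDiffAt ℝ l (fun t => (∫ u in π ⁻¹' {p}, ρ u ∂μ) * w p j t) t := fun p =>
      ((contDiff_const.mul (hW _ (hwW p) j).1).of_le hl).contDiffAt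
    have hsub := fun_iteratedFDeriv_sub_apply (((hK j).1 ρ).of_le hl).contDiffAt
      ((hs ρ j).of_le hl).contDiffAt (x := t)
    rw [hTfun, hsub, iteratedFDeriv_fun_sum_apply fun p _ => hterm p]
    refine (norm_sub_le _ _).trans ?_
    have h2 : ∀ p ∈ π.range, ‖iteratedFDeriv ℝ l
        (fun t => (∫ u in π ⁻¹' {p}, ρ u ∂μ) * w p j t) t‖ ≤ 2 * Real.pi * A p j * ‖ρ‖ := by
      intro p _
      have h3 := iteratedFDeriv_const_smul_apply' (f := w p j) (x := t)
        (a := ∫ u in π ⁻¹' {p}, ρ u ∂μ) (((hW _ (hwW p) j).1).of_le hl).contDiffAt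
      simp only [smul_eq_mul] at h3
      rw [h3, norm_smul, norm_iteratedFDeriv_eq_norm_iteratedDeriv]
      refine (mul_le_mul (hpj ρ p) (hA p j l le_rfl t) (norm_nonneg _) (by positivity)).trans_eq ?_
      ring
    refine (add_le_add (hCk j ρ t) ((norm_sum_le _ _).trans (Finset.sum_le_sum h2))).trans ?_
    rw [← Finset.sum_mul, ← add_mul]
    refine mul_le_mul_of_nonneg_right (Finset.single_le_sum
      (f := fun j => Ck j + ∑ p ∈ π.range, 2 * Real.pi * A p j) (fun j _ =>
      add_nonneg (hCk0 j) (Finset.sum_nonneg fun p _ => mul_nonneg Real.two_pi_pos.le (hA0 p j)))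
      (Finset.mem_univ j)) (norm_nonneg _)
  · have h1 := integral_smul_comp_simpleFunc π (fun p => w p j t) (hinteg ρ)
    simp only [smul_eq_mul] at h1
    obtain ⟨M, hM⟩ := (π.map fun p => w p j t).exists_forall_norm_le
    have h2 : Integrable (fun u => ρ u * w (π u) j t) μ :=
      (hinteg ρ).mul_bdd (π.map fun p => w p j t).aestronglyMeasurable
        (Filter.Eventually.of_forall hM)
    rw [hTdef, ← h1, ← integral_sub (hkint ρ j t) h2]
    have h3 : ∀ᵐ u ∂μ, ‖k j (t, u) * ρ u - ρ u * w (π u) j t‖ ≤ 2 * a * ‖ρ‖ := by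
      refine (ae_restrict_iff' measurableSet_Icc).2 (Filter.Eventually.of_forall fun u hu => ?_)
      have h4 : k j (t, u) * ρ u - ρ u * w (π u) j t =
          ((k j (t, u) - k j (t, π u)) + (k j (t, π u) - w (π u) j t)) * ρ u := by ring
      rw [h4, norm_mul]
      refine mul_le_mul ((norm_add_le _ _).trans ?_) (ρ.norm_coe_le_norm u) (norm_nonneg _)
        (by positivity)
      linarith [hπ' u hu j t, hw (π u) j t]
    refine (norm_integral_le_of_norm_le_const h3).trans_eq ?_
    simp [hμ, Real.two_pi_pos.le, ha]
    field_simp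
    ring
  · have h1 : (fun j t => (∫ u in (0 : ℝ)..2 * Real.pi, k j (t, u) * ρ u) - T ρ j t) =
        ∑ p ∈ π.range, (∫ u in π ⁻¹' {p}, ρ u ∂μ) • w p := by
      funext j t
      rw [hTdef, intervalIntegral.integral_of_le Real.two_pi_pos.le,
        ← integral_Icc_eq_integral_Ioc, sub_sub_cancel]
      simp [Finset.sum_apply]
    rw [h1]
    exact W.sum_mem fun p _ => W.smul_mem _ (hwW p)

end

section

open scoped BoundedContinuousFunction

/-- Solvability, with estimates, of `c ρ + K ρ = e` for a smoothing operator `K` of norm at most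
one half. -/
theorem exists_solution {ι : Type*} [TopologicalSpace ι] [DiscreteTopology ι] {c : ι → ℂ}
    (hc : ∀ j, ‖c j‖ = 1) (K : (ι × ℝ →ᵇ ℂ) →ₗ[ℂ] (ι → ℝ → ℂ))
    (hK : ∀ ρ j, ContDiff ℝ ∞ (K ρ j) ∧ Function.Periodic (K ρ j) (2 * Real.pi))
    (hKC : ∀ l, ∃ C, 0 ≤ C ∧ ∀ ρ j t, ‖iteratedFDeriv ℝ l (K ρ j) t‖ ≤ C * ‖ρ‖)
    (hKs : ∀ ρ j t, ‖K ρ j t‖ ≤ 1 / 2 * ‖ρ‖) (L : ℕ) :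
    ∃ C, 0 ≤ C ∧ ∀ e : ι → ℝ → ℂ, (∀ j, ContDiff ℝ ∞ (e j)) →
      (∀ j, Function.Periodic (e j) (2 * Real.pi)) → ∀ E : ℝ, 0 ≤ E →
        (∀ j, ∀ l ≤ L, ∀ t, ‖iteratedDeriv l (e j) t‖ ≤ E) →
          ∃ ρ : ι × ℝ →ᵇ ℂ, (∀ j, ContDiff ℝ ∞ fun t => ρ (j, t)) ∧
            (∀ j, Function.Periodic (fun t => ρ (j, t)) (2 * Real.pi)) ∧
            (∀ j t, c j * ρ (j, t) + K ρ j t = e j t) ∧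
            ∀ j, ∀ l ≤ L, ∀ t, ‖iteratedDeriv l (fun t => ρ (j, t)) t‖ ≤ C * E := by
  choose Cl hCl0 hCl using hKC
  have hsum0 : 0 ≤ ∑ l ∈ Finset.range (L + 1), Cl l := Finset.sum_nonneg fun l _ => hCl0 l
  refine ⟨1 + 2 * ∑ l ∈ Finset.range (L + 1), Cl l, by positivity, fun e he hep E hE0 hE => ?_⟩
  have hc0 : ∀ j, c j ≠ 0 := fun j => norm_ne_zero_iff.1 (by rw [hc j]; exact one_ne_zero)
  have he0 : ∀ j t, ‖e j t‖ ≤ E := fun j t => by simpa using hE j 0 (Nat.zero_le _) t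
  let f : (ι × ℝ →ᵇ ℂ) → ι × ℝ → ℂ := fun ρ p => (c p.1)⁻¹ * (e p.1 p.2 - K ρ p.1 p.2)
  have hfc : ∀ ρ, Continuous (f ρ) := fun ρ => continuous_prod_of_discrete_left.2 fun j =>
    (continuous_const (y := (c j)⁻¹)).mul ((he j).continuous.sub (hK ρ j).1.continuous)
  have hfb : ∀ ρ p, ‖f ρ p‖ ≤ E + 1 / 2 * ‖ρ‖ := fun ρ p => by
    rw [norm_mul, norm_inv, hc, inv_one, one_mul]
    exact (norm_sub_le _ _).trans (add_le_add (he0 _ _) (hKs _ _ _))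
  let F : (ι × ℝ →ᵇ ℂ) → (ι × ℝ →ᵇ ℂ) := fun ρ =>
    BoundedContinuousFunction.ofNormedAddCommGroup (f ρ) (hfc ρ) _ (hfb ρ)
  have hF : ContractingWith (1 / 2) F := by
    refine ⟨by norm_num, LipschitzWith.of_dist_le_mul fun ρ ρ' => ?_⟩
    rw [BoundedContinuousFunction.dist_le (by positivity)]
    intro p
    have h1 : f ρ p - f ρ' p = (c p.1)⁻¹ * K (ρ' - ρ) p.1 p.2 := by
      rw [map_sub]
      simp only [f, Pi.sub_apply]
      ring
    change dist (f ρ p) (f ρ' p) ≤ _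
    rw [dist_eq_norm (f ρ p), h1, norm_mul, norm_inv, hc, inv_one, one_mul, dist_comm,
      dist_eq_norm ρ']
    exact (hKs _ _ _).trans_eq (by simp)
  obtain ⟨ρ, hρ⟩ : ∃ ρ, F ρ = ρ := ⟨_, hF.fixedPoint_isFixedPt⟩
  have hρp : ∀ j t, ρ (j, t) = (c j)⁻¹ * (e j t - K ρ j t) := fun j t =>
    (congrArg (fun ρ : ι × ℝ →ᵇ ℂ => ρ (j, t)) hρ).symm
  have hρf : ∀ j, (fun t => ρ (j, t)) = fun t => (c j)⁻¹ * (e j t - K ρ j t) := fun j =>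
    funext (hρp j)
  have hρn : ‖ρ‖ ≤ 2 * E := by
    have h1 : ‖ρ‖ ≤ E + 1 / 2 * ‖ρ‖ := by
      refine (BoundedContinuousFunction.norm_le (by positivity)).2 fun p => ?_
      rw [show ρ p = f ρ p from hρp p.1 p.2]
      exact hfb ρ p
    linarith
  refine ⟨ρ, fun j => ?_, fun j t => ?_, fun j t => ?_, fun j l hl t => ?_⟩
  · rw [hρf]
    exact contDiff_const.mul ((he j).sub (hK ρ j).1)
  · change ρ (j, t + 2 * Real.pi) = ρ (j, t)
    rw [hρp, hρp, hep j t, (hK ρ j).2 t]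
  · rw [hρp, mul_inv_cancel_left₀ (hc0 j), sub_add_cancel]
  · have hl' : ((l : ℕ) : ℕ∞ω) ≤ ∞ := by exact_mod_cast le_top
    have h1 := iteratedFDeriv_const_smul_apply' (f := fun t => e j t - K ρ j t) (a := (c j)⁻¹)
      (x := t) (((he j).sub (hK ρ j).1).of_le hl').contDiffAt
    simp only [smul_eq_mul] at h1
    rw [hρf, ← norm_iteratedFDeriv_eq_norm_iteratedDeriv, h1, norm_smul, norm_inv, hc, inv_one,
      one_mul, fun_iteratedFDeriv_sub_apply ((he j).of_le hl').contDiffAt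
        ((hK ρ j).1.of_le hl').contDiffAt]
    have h2 : Cl l ≤ ∑ l ∈ Finset.range (L + 1), Cl l :=
      Finset.single_le_sum (f := Cl) (fun l _ => hCl0 l) (Finset.mem_range.2 (by omega))
    have h3 := hE j l hl t
    rw [← norm_iteratedFDeriv_eq_norm_iteratedDeriv] at h3
    have h4 := (hCl l ρ j t).trans (mul_le_mul h2 hρn (norm_nonneg _) hsum0)
    calc _ ≤ _ := norm_sub_le _ _
      _ ≤ _ := add_le_add h3 h4
      _ = _ := by ring

end

section

/-- On `Z`, the function `U` is a `C^∞` limit of linear combinations of simple fractions with poles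
off `Z`. -/
def FracApprox (Z : Set ℂ) (U : ℂ → ℂ) : Prop :=
  ∀ P : ℕ, ∀ η : ℝ, 0 < η → ∃ v ∈ fracSpan Z, ∀ k ≤ P, ∀ z ∈ Z,
    ‖iteratedFDeriv ℝ k U z - iteratedFDeriv ℝ k v z‖ ≤ η

theorem contDiffAt_of_mem_fracSpan_nat {Z : Set ℂ} {v : ℂ → ℂ} (hv : v ∈ fracSpan Z) {z : ℂ}
    (hz : z ∈ Z) (k : ℕ) : ContDiffAt ℝ k v z :=
  contDiffAt_of_mem_fracSpan hv hz

theorem ContDiff.contDiffAt_nat {U : ℂ → ℂ} (hU : ContDiff ℝ ∞ U) (z : ℂ) (k : ℕ) :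
    ContDiffAt ℝ k U z :=
  (hU.of_le (by exact_mod_cast le_top)).contDiffAt

theorem FracApprox.add {Z : Set ℂ} {U V : ℂ → ℂ} (hU : ContDiff ℝ ∞ U) (hV : ContDiff ℝ ∞ V)
    (h : FracApprox Z U) (h' : FracApprox Z V) : FracApprox Z (U + V) := by
  intro P η hη
  obtain ⟨v, hv, hv'⟩ := h P (η / 2) (half_pos hη)
  obtain ⟨w, hw, hw'⟩ := h' P (η / 2) (half_pos hη)
  refine ⟨v + w, Submodule.add_mem _ hv hw, fun k hk z hz => ?_⟩
  rw [iteratedFDeriv_add_apply (hU.contDiffAt_nat z k) (hV.contDiffAt_nat z k),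
    iteratedFDeriv_add_apply (contDiffAt_of_mem_fracSpan_nat hv hz k)
      (contDiffAt_of_mem_fracSpan_nat hw hz k), add_sub_add_comm]
  calc _ ≤ _ := norm_add_le _ _
    _ ≤ η / 2 + η / 2 := add_le_add (hv' k hk z hz) (hw' k hk z hz)
    _ = η := add_halves η

theorem FracApprox.neg {Z : Set ℂ} {U : ℂ → ℂ} (h : FracApprox Z U) : FracApprox Z (-U) := by
  intro P η hη
  obtain ⟨v, hv, hv'⟩ := h P η hη
  refine ⟨-v, Submodule.neg_mem _ hv, fun k hk z hz => ?_⟩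
  rw [iteratedFDeriv_neg_apply, iteratedFDeriv_neg_apply, neg_sub_neg, norm_sub_rev]
  exact hv' k hk z hz

theorem fracApprox_zero (Z : Set ℂ) : FracApprox Z 0 := fun P η hη =>
  ⟨0, Submodule.zero_mem _, fun k hk z hz => by simpa using hη.le⟩

theorem exists_extension_sum {ι : Type*} {Z : Set ℂ} (s : Finset ι) {U : ι → ℂ → ℂ}
    (hU : ∀ i ∈ s, ContDiff ℝ ∞ (U i)) (h : ∀ i ∈ s, FracApprox Z (U i)) :
    ContDiff ℝ ∞ (∑ i ∈ s, U i) ∧ FracApprox Z (∑ i ∈ s, U i) := by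
  classical
  induction s using Finset.induction_on with
  | empty => exact ⟨contDiff_zero_fun, by simpa using fracApprox_zero Z⟩
  | insert a s ha ih =>
    rw [Finset.sum_insert ha]
    have h1 := ih (fun i hi => hU i (Finset.mem_insert_of_mem hi))
      fun i hi => h i (Finset.mem_insert_of_mem hi)
    exact ⟨(hU a (Finset.mem_insert_self a s)).add h1.1,
      (h a (Finset.mem_insert_self a s)).add (hU a (Finset.mem_insert_self a s)) h1.1 h1.2⟩

/-- A smooth periodic function on a Jordan curve extends to a smooth function that vanishes on a
given compact set off the curve and is a limit of simple fractions. -/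
theorem SmoothJordan.exists_extension {γ : ℝ → ℂ} (hγ : SmoothJordan γ) {Z : Set ℂ}
    (hZ : IsCompact Z) (hd : Disjoint Z (range γ)) {ρ : ℝ → ℂ} (hρ : ContDiff ℝ ∞ ρ)
    (hp : Function.Periodic ρ (2 * Real.pi)) :
    ∃ U : ℂ → ℂ, ContDiff ℝ ∞ U ∧ (∀ t, U (γ t) = ρ t) ∧ (∀ z ∈ Z, U z = 0) ∧
      FracApprox (Z ∪ range γ) U := by
  obtain ⟨N, hN⟩ := hγ.exists_operators hZ hd
  obtain ⟨h1, h2, -, h3, h4⟩ := (hN 1 (Or.inl rfl)).2 ρ hρ hp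
  obtain ⟨h1', h2', -, h3', h4'⟩ := (hN (-1) (Or.inr rfl)).2 ρ hρ hp
  have hf : FracApprox (Z ∪ range γ) (N 1 ρ) := fun P η hη =>
    (h4 P η hη).imp fun v hv => ⟨hv.1, fun k hk z hz => (hv.2 k hk z hz).2⟩
  have hf' : FracApprox (Z ∪ range γ) (N (-1) ρ) := fun P η hη =>
    (h4' P η hη).imp fun v hv => ⟨hv.1, fun k hk z hz => (hv.2 k hk z hz).2⟩
  refine ⟨N (-1) ρ + -N 1 ρ, h1'.add h1.neg, fun t => ?_, fun z hz => ?_,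
    hf'.add h1' h1.neg hf.neg⟩
  · have hpi : (Real.pi : ℂ) ≠ 0 := ofReal_ne_zero.2 Real.pi_ne_zero
    simp only [Pi.add_apply, Pi.neg_apply, h3, h3']
    have hI := I_ne_zero
    push_cast
    field_simp
    ring
  · simp [h2 z hz, h2' z hz]

variable {n : ℕ} {γ : Fin n → ℝ → ℂ}

/-- The union of the other curves of a family. -/
def others (γ : Fin n → ℝ → ℂ) (i : Fin n) : Set ℂ := ⋃ j ∈ ({i}ᶜ : Set (Fin n)), range (γ j)

theorem others_union (γ : Fin n → ℝ → ℂ) (i : Fin n) :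
    others γ i ∪ range (γ i) = ⋃ j, range (γ j) := by
  ext z
  simp only [others, mem_union, mem_iUnion, mem_compl_iff, mem_singleton_iff, exists_prop]
  constructor
  · rintro (⟨j, -, h⟩ | h)
    exacts [⟨j, h⟩, ⟨i, h⟩]
  · rintro ⟨j, h⟩
    by_cases hj : j = i
    · exact Or.inr (hj ▸ h)
    · exact Or.inl ⟨j, hj, h⟩

theorem mem_others {i j : Fin n} (h : j ≠ i) (t : ℝ) : γ j t ∈ others γ i :=
  mem_iUnion₂.2 ⟨j, h, t, rfl⟩

theorem isCompact_others (hγ : ∀ i, SmoothJordan (γ i)) (i : Fin n) : IsCompact (others γ i) :=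
  (toFinite _).isCompact_biUnion fun j _ => (hγ j).isCompact_range

theorem disjoint_others (hd : Pairwise fun i j => Disjoint (range (γ i)) (range (γ j)))
    (i : Fin n) : Disjoint (others γ i) (range (γ i)) :=
  disjoint_iUnion₂_left.2 fun _ hj => hd hj

theorem exists_extension (hγ : ∀ i, SmoothJordan (γ i))
    (hd : Pairwise fun i j => Disjoint (range (γ i)) (range (γ j))) {f : Fin n → ℝ → ℂ}
    (hf : ∀ j, ContDiff ℝ ∞ (f j)) (hp : ∀ j, Function.Periodic (f j) (2 * Real.pi)) :
    ∃ U : ℂ → ℂ, ContDiff ℝ ∞ U ∧ (∀ j t, U (γ j t) = f j t) ∧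
      FracApprox (⋃ j, range (γ j)) U := by
  choose U hU hUγ hU0 hUa using fun i => (hγ i).exists_extension (isCompact_others hγ i)
    (disjoint_others hd i) (hf i) (hp i)
  simp only [others_union] at hUa
  obtain ⟨h1, h2⟩ := exists_extension_sum Finset.univ (fun i _ => hU i) fun i _ => hUa i
  refine ⟨_, h1, fun j t => ?_, h2⟩
  rw [Finset.sum_apply, Finset.sum_eq_single j, hUγ]
  · exact fun i _ hi => hU0 i _ (mem_others hi.symm t)
  · simp

/-- Approximation in `C^P` near a curve gives approximation in `C^P` along it. -/
theorem exists_bound_comp_curve {Z : Set ℂ} {γ : ℝ → ℂ} (hγ : SmoothJordan γ) (hZ : range γ ⊆ Z)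
    (P : ℕ) : ∃ B : ℝ, 0 ≤ B ∧ ∀ U : ℂ → ℂ, ContDiff ℝ ∞ U → ∀ v ∈ fracSpan Z, ∀ η : ℝ, 0 ≤ η →
      (∀ k ≤ P, ∀ z ∈ Z, ‖iteratedFDeriv ℝ k U z - iteratedFDeriv ℝ k v z‖ ≤ η) →
        ∀ l ≤ P, ∀ t, ‖iteratedDeriv l (fun t => U (γ t) - v (γ t)) t‖ ≤ B * η := by
  obtain ⟨A, hA⟩ := exists_iteratedDeriv_bound hγ.smooth hγ.periodic P
  set D := max A 1 with hD
  have hD1 : 1 ≤ D := le_max_right _ _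
  refine ⟨P.factorial * D ^ P, by positivity, fun U hU v hv η hη h l hl t => ?_⟩
  set T : Set ℂ := {z | AnalyticAt ℝ v z} with hT
  have hTo : IsOpen T := isOpen_analyticAt ℝ v
  have hZT : ∀ z ∈ Z, z ∈ T := fun z hz =>
    (contDiffAt_of_mem_fracSpan hv hz).analyticAt
  have hvT : ContDiffOn ℝ ∞ v T := fun z hz =>
    (AnalyticAt.contDiffAt (𝕜 := ℝ) (n := ∞) hz).contDiffWithinAt
  have hl' : ((l : ℕ) : ℕ∞ω) ≤ ∞ := by exact_mod_cast le_top
  have h1 := norm_iteratedFDeriv_comp_le' (𝕜 := ℝ) (g := U - v) (f := γ) (n := l) (N := ∞) (t := T)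
    (fun z hz => hZT z (hZ hz)) hTo.uniqueDiffOn (hU.contDiffOn.sub hvT) hγ.smooth hl' t
    (C := η) (D := D) (fun i hi => ?_) (fun i hi hil => ?_)
  · rw [← norm_iteratedFDeriv_eq_norm_iteratedDeriv]
    refine h1.trans ?_
    calc (l.factorial : ℝ) * η * D ^ l ≤ P.factorial * η * D ^ P :=
          mul_le_mul (mul_le_mul_of_nonneg_right (by exact_mod_cast Nat.factorial_le hl) hη)
            (pow_le_pow_right₀ hD1 hl) (by positivity) (by positivity)
      _ = _ := by ring
  · rw [iteratedFDerivWithin_of_isOpen i hTo (hZT _ (hZ ⟨t, rfl⟩)), iteratedFDeriv_sub_apply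
      (hU.contDiffAt_nat _ i) (contDiffAt_of_mem_fracSpan_nat hv (hZ ⟨t, rfl⟩) i)]
    exact h i (hi.trans hl) _ (hZ ⟨t, rfl⟩)
  · rw [norm_iteratedFDeriv_eq_norm_iteratedDeriv]
    exact ((hA i (hil.trans hl) t).trans (le_max_left _ _)).trans
      (le_self_pow₀ hD1 (by omega))

end

section

open scoped BoundedContinuousFunction

theorem SmoothJordan.differentiableAt_cauchyInt {γ : ℝ → ℂ} (hγ : SmoothJordan γ) {ρ : ℝ → ℂ}
    (hρ : Continuous ρ) {z : ℂ} (hz : z ∉ range γ) : DifferentiableAt ℂ (cauchyInt γ ρ) z := by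
  obtain ⟨r, hr, hrs⟩ := Metric.isOpen_iff.1 hγ.isCompact_range.isClosed.isOpen_compl z hz
  have ha : Continuous fun u => ρ u * deriv γ u := hρ.mul hγ.continuous_deriv
  have hlow : ∀ w ∈ ball z (r / 2), ∀ u, r / 2 ≤ ‖γ u - w‖ := by
    intro w hw u
    have h1 : r ≤ ‖γ u - z‖ := by
      by_contra! hlt
      exact hrs (mem_ball_iff_norm.2 hlt) ⟨u, rfl⟩
    have h2 := mem_ball_iff_norm.1 hw
    have h3 := norm_sub_le_norm_sub_add_norm_sub (γ u) w z
    linarith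
  have hne : ∀ w ∈ ball z (r / 2), ∀ u, γ u - w ≠ 0 := fun w hw u h => by
    have := hlow w hw u
    rw [h, norm_zero] at this
    linarith
  have hball : ball z (r / 2) ∈ nhds z := ball_mem_nhds z (half_pos hr)
  have hc : ∀ w ∈ ball z (r / 2), Continuous fun u => ρ u * deriv γ u / (γ u - w) := fun w hw =>
    ha.div (hγ.continuous.sub continuous_const) (hne w hw)
  have hc' : Continuous fun u => ρ u * deriv γ u / (γ u - z) ^ 2 :=
    ha.div ((hγ.continuous.sub continuous_const).pow 2) fun u =>
      pow_ne_zero 2 (hne z (mem_of_mem_nhds hball) u)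
  have h := (intervalIntegral.hasDerivAt_integral_of_dominated_loc_of_deriv_le (μ := volume)
    (a := 0) (b := 2 * Real.pi) (F := fun w u => ρ u * deriv γ u / (γ u - w))
    (F' := fun w u => ρ u * deriv γ u / (γ u - w) ^ 2)
    (bound := fun u => ‖ρ u * deriv γ u‖ / (r / 2) ^ 2) hball
    (Filter.eventually_of_mem hball fun w hw => (hc w hw).aestronglyMeasurable)
    ((hc z (mem_of_mem_nhds hball)).intervalIntegrable _ _) hc'.aestronglyMeasurable
    (Filter.Eventually.of_forall fun u _ w hw => ?_)
    ((ha.norm.div_const _).intervalIntegrable _ _)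
    (Filter.Eventually.of_forall fun u _ w hw => ?_)).2
  · exact h.differentiableAt.const_mul _
  · rw [norm_div, norm_pow]
    exact div_le_div_of_nonneg_left (norm_nonneg _) (by positivity)
      (pow_le_pow_left₀ (half_pos hr).le (hlow w hw u) 2)
  · refine ((hasDerivAt_const w (ρ u * deriv γ u)).div ((hasDerivAt_id w).const_sub (γ u))
      (hne w hw u)).congr_deriv ?_
    simp

variable {n : ℕ} {γ : Fin n → ℝ → ℂ}

/-- Restriction of functions on the plane to a family of curves. -/
def alongCurves (γ : Fin n → ℝ → ℂ) : (ℂ → ℂ) →ₗ[ℂ] (Fin n → ℝ → ℂ) where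
  toFun v j t := v (γ j t)
  map_add' _ _ := rfl
  map_smul' _ _ := rfl

theorem smooth_periodic_of_mem_map_alongCurves (hγ : ∀ i, SmoothJordan (γ i)) {w : Fin n → ℝ → ℂ}
    (hw : w ∈ (fracSpan (⋃ j, range (γ j))).map (alongCurves γ)) (j : Fin n) :
    ContDiff ℝ ∞ (w j) ∧ Function.Periodic (w j) (2 * Real.pi) := by
  obtain ⟨v, hv, rfl⟩ := hw
  refine ⟨contDiff_iff_contDiffAt.2 fun t => ?_, fun t => ?_⟩
  · exact ContDiffAt.comp (g := v) (f := γ j) t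
      (contDiffAt_of_mem_fracSpan hv (mem_iUnion.2 ⟨j, t, rfl⟩)) (hγ j).smooth.contDiffAt
  · exact congrArg v ((hγ j).periodic t)

theorem exists_mem_map_alongCurves_near (hγ : ∀ i, SmoothJordan (γ i))
    (hd : Pairwise fun i j => Disjoint (range (γ i)) (range (γ j))) (f : Fin n → ℝ → ℂ)
    (hf : ∀ j, ContDiff ℝ ∞ (f j)) (hp : ∀ j, Function.Periodic (f j) (2 * Real.pi)) (η : ℝ)
    (hη : 0 < η) : ∃ w ∈ (fracSpan (⋃ j, range (γ j))).map (alongCurves γ),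
      ∀ j t, ‖f j t - w j t‖ ≤ η := by
  obtain ⟨U, hU, hUγ, hUa⟩ := exists_extension hγ hd hf hp
  obtain ⟨v, hv, hv'⟩ := hUa 0 η hη
  refine ⟨_, ⟨v, hv, rfl⟩, fun j t => ?_⟩
  have hm : γ j t ∈ ⋃ j, range (γ j) := mem_iUnion.2 ⟨j, t, rfl⟩
  have h1 := hv' 0 le_rfl (γ j t) hm
  rw [← iteratedFDeriv_sub_apply (hU.contDiffAt_nat _ 0) (contDiffAt_of_mem_fracSpan_nat hv hm 0),
    norm_iteratedFDeriv_zero] at h1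
  rw [← hUγ j t]
  exact h1

theorem exists_near_along (hγ : ∀ i, SmoothJordan (γ i))
    (hd : Pairwise fun i j => Disjoint (range (γ i)) (range (γ j))) {f : Fin n → ℝ → ℂ}
    (hf : ∀ j, ContDiff ℝ ∞ (f j)) (hp : ∀ j, Function.Periodic (f j) (2 * Real.pi)) (P : ℕ)
    {E : ℝ} (hE : 0 < E) : ∃ v ∈ fracSpan (⋃ j, range (γ j)), ∀ j, ∀ l ≤ P, ∀ t,
      ‖iteratedDeriv l (fun t => f j t - v (γ j t)) t‖ ≤ E := by
  obtain ⟨U, hU, hUγ, hUa⟩ := exists_extension hγ hd hf hp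
  choose B hB0 hB using fun j => exists_bound_comp_curve (hγ j)
    (subset_iUnion (fun j => range (γ j)) j) P
  have hs : 0 ≤ ∑ j, B j := Finset.sum_nonneg fun j _ => hB0 j
  have hη : 0 < E / (∑ j, B j + 1) := by positivity
  obtain ⟨v, hv, hv'⟩ := hUa P _ hη
  refine ⟨v, hv, fun j l hl t => ?_⟩
  simp only [← hUγ]
  refine (hB j U hU v hv _ hη.le hv' l hl t).trans ?_
  rw [mul_div_assoc', div_le_iff₀ (by positivity), mul_comm E]
  refine mul_le_mul_of_nonneg_right ?_ hE.le
  have := Finset.single_le_sum (f := B) (fun j _ => hB0 j) (Finset.mem_univ j)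
  linarith

theorem norm_iteratedDeriv_conj (f : ℝ → ℂ) (l : ℕ) (t : ℝ) :
    ‖iteratedDeriv l (fun t => conj (f t)) t‖ = ‖iteratedDeriv l f t‖ := by
  rw [← norm_iteratedFDeriv_eq_norm_iteratedDeriv, ← norm_iteratedFDeriv_eq_norm_iteratedDeriv]
  exact conjLIE.norm_iteratedFDeriv_comp_left f t l

/-- An element of the span of simple fractions is a finite sum of simple fractions. -/
theorem exists_sum_of_mem_fracSpan {Z : Set ℂ} {v : ℂ → ℂ} (hv : v ∈ fracSpan Z) :
    ∃ (s : Finset ℂ) (c : ℂ → ℂ), (∀ w ∈ s, w ∉ Z) ∧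
      ∀ z, v z = ∑ w ∈ s, c w * (z - w)⁻¹ := by
  rw [fracSpan, Finsupp.mem_span_image_iff_linearCombination] at hv
  obtain ⟨l, hl, rfl⟩ := hv
  refine ⟨l.support, l, fun w hw => hl hw, fun z => ?_⟩
  rw [Finsupp.linearCombination_apply, Finsupp.sum, Finset.sum_apply]
  rfl

end

section

open scoped BoundedContinuousFunction

variable {n : ℕ} {γ : Fin n → ℝ → ℂ}

/-- Restriction of a bounded continuous function to one component of `ι × ℝ`. -/
def sliceLM {ι : Type*} [TopologicalSpace ι] (i : ι) : (ι × ℝ →ᵇ ℂ) →ₗ[ℂ] (ℝ →ᵇ ℂ) where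
  toFun ρ := ρ.compContinuous ⟨fun t => (i, t), by fun_prop⟩
  map_add' _ _ := rfl
  map_smul' _ _ := rfl

theorem norm_sliceLM_le {ι : Type*} [TopologicalSpace ι] (i : ι) (ρ : ι × ℝ →ᵇ ℂ) :
    ‖sliceLM i ρ‖ ≤ ‖ρ‖ :=
  (BoundedContinuousFunction.norm_le (norm_nonneg _)).2 fun t => ρ.norm_coe_le_norm (i, t)

theorem exists_matrix_operator (hγ : ∀ i, SmoothJordan (γ i))
    (hd : Pairwise fun i j => Disjoint (range (γ i)) (range (γ j)))
    {k : Fin n → Fin n → ℝ × ℝ → ℂ} (hk : ∀ i j, ContDiff ℝ ∞ (k i j))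
    (hp : ∀ i j t u, k i j (t + 2 * Real.pi, u) = k i j (t, u)) :
    ∃ K : (Fin n × ℝ →ᵇ ℂ) →ₗ[ℂ] (Fin n → ℝ → ℂ),
      (∀ ρ j, ContDiff ℝ ∞ (K ρ j) ∧ Function.Periodic (K ρ j) (2 * Real.pi)) ∧
      (∀ l, ∃ C, 0 ≤ C ∧ ∀ ρ j t, ‖iteratedFDeriv ℝ l (K ρ j) t‖ ≤ C * ‖ρ‖) ∧
      (∀ ρ j t, ‖K ρ j t‖ ≤ 1 / 2 * ‖ρ‖) ∧
      ∀ ρ : Fin n × ℝ →ᵇ ℂ, ∃ q ∈ fracSpan (⋃ j, range (γ j)), ∀ j t,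
        ∑ i, ∫ u in (0 : ℝ)..2 * Real.pi, k i j (t, u) * ρ (i, u) = K ρ j t + q (γ j t) := by
  have hη : (0 : ℝ) < 1 / (2 * (n + 1)) := by positivity
  choose T hTs hTC hTn hTW using fun i => exists_small_operator
    ((fracSpan (⋃ j, range (γ j))).map (alongCurves γ))
    (fun w hw j => smooth_periodic_of_mem_map_alongCurves hγ hw j)
    (exists_mem_map_alongCurves_near hγ hd) (k i) (hk i) (hp i) hη
  choose C hC0 hC using hTC
  have hKf : ∀ (ρ : Fin n × ℝ →ᵇ ℂ) j, (∑ i, T i ∘ₗ sliceLM i) ρ j =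
      fun t => ∑ i, T i (sliceLM i ρ) j t := by
    intro ρ j
    funext t
    simp [Finset.sum_apply]
  refine ⟨∑ i, T i ∘ₗ sliceLM i, fun ρ j => ⟨?_, fun t => ?_⟩, fun l =>
    ⟨∑ i, C i l, Finset.sum_nonneg fun i _ => hC0 i l, fun ρ j t => ?_⟩, fun ρ j t => ?_,
    fun ρ => ?_⟩
  · rw [hKf]
    exact ContDiff.sum fun i _ => (hTs i _ j).1
  · rw [hKf]
    exact Finset.sum_congr rfl fun i _ => (hTs i _ j).2 t
  · rw [hKf, iteratedFDeriv_fun_sum_apply fun i _ =>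
      ((hTs i _ j).1.of_le (by exact_mod_cast le_top)).contDiffAt, Finset.sum_mul]
    exact (norm_sum_le _ _).trans (Finset.sum_le_sum fun i _ =>
      (hC i l _ j t).trans (mul_le_mul_of_nonneg_left (norm_sliceLM_le i ρ) (hC0 i l)))
  · rw [hKf]
    refine (norm_sum_le _ _).trans ((Finset.sum_le_sum fun i _ => (hTn i _ j t).trans
      (mul_le_mul_of_nonneg_left (norm_sliceLM_le i ρ) hη.le)).trans ?_)
    rw [Finset.sum_const, Finset.card_univ, Fintype.card_fin, nsmul_eq_mul, ← mul_assoc]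
    refine mul_le_mul_of_nonneg_right ?_ (norm_nonneg _)
    rw [mul_one_div, div_le_iff₀ (by positivity)]
    linarith
  · choose q hq hqT using fun i => hTW i (sliceLM i ρ)
    refine ⟨∑ i, q i, Submodule.sum_mem _ fun i _ => hq i, fun j t => ?_⟩
    rw [hKf, Finset.sum_apply, ← Finset.sum_add_distrib]
    refine Finset.sum_congr rfl fun i _ => ?_
    have h1 := congrFun (congrFun (hqT i) j) t
    exact sub_eq_iff_eq_add'.1 h1.symm

/-- On the curves, `conj` splits as a boundary value of holomorphic functions, one of them
conjugated and small, up to simple fractions. -/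
theorem exists_conj_decomposition (hγ : ∀ i, SmoothJordan (γ i))
    (hd : Pairwise fun i j => Disjoint (range (γ i)) (range (γ j))) {Ω : Set ℂ}
    (hΩd : ∀ i, Disjoint Ω (range (γ i))) {σ : Fin n → ℝ} (hσ : ∀ i, σ i = 1 ∨ σ i = -1)
    (hw : ∀ i, ∀ z ∈ Ω, wind (γ i) z ≠ (1 + σ i) * (Real.pi * I) + dqWind (γ i) 0) (m : ℕ)
    {δ : ℝ} (hδ : 0 < δ) :
    ∃ G M : ℂ → ℂ, ContDiff ℝ ∞ G ∧ ContDiff ℝ ∞ M ∧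
      (∀ V : Set ℂ, V ⊆ Ω → IsOpen V → DifferentiableOn ℂ G V ∧ DifferentiableOn ℂ M V) ∧
      (∀ k ≤ m, ∀ z, ‖iteratedFDeriv ℝ k G z‖ ≤ δ) ∧
      ∃ R ∈ fracSpan (⋃ j, range (γ j)), ∀ z ∈ ⋃ j, range (γ j),
        conj z = M z + conj (G z) + R z := by
  choose N hN using fun i => (hγ i).exists_operators (isCompact_others hγ i) (disjoint_others hd i)
  have hker : ∀ i j, ∃ k : ℝ × ℝ → ℂ, ContDiff ℝ ∞ k ∧
      (∀ t u, k (t + 2 * Real.pi, u) = k (t, u)) ∧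
      ∀ s : ℝ, s = 1 ∨ s = -1 → ∀ ρ : ℝ → ℂ, ContDiff ℝ ∞ ρ →
        Function.Periodic ρ (2 * Real.pi) → ∀ t,
          N i s ρ (γ j t) + conj (N i s (fun u => conj (ρ u)) (γ j t)) =
            (if i = j then -s * ρ t else 0) + ∫ u in (0 : ℝ)..2 * Real.pi, k (t, u) * ρ u := by
    intro i j
    have hcj : ∀ ρ : ℝ → ℂ, ContDiff ℝ ∞ ρ → ContDiff ℝ ∞ fun u => conj (ρ u) := fun ρ hρ =>
      conjCLE.contDiff.comp hρ
    have hcp : ∀ ρ : ℝ → ℂ, Function.Periodic ρ (2 * Real.pi) →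
        Function.Periodic (fun u => conj (ρ u)) (2 * Real.pi) := fun ρ hp t => congrArg conj (hp t)
    by_cases hij : i = j
    · subst hij
      obtain ⟨k, hk, hkp, h⟩ := (hγ i).exists_kernel_self
      refine ⟨k, hk, hkp, fun s hs ρ hρ hp t => ?_⟩
      rw [((hN i s hs).2 ρ hρ hp).2.2.2.1 t, ((hN i s hs).2 _ (hcj ρ hρ) (hcp ρ hp)).2.2.2.1 t,
        if_pos rfl]
      exact h s ρ hρ hp t
    · obtain ⟨k, hk, hkp, h⟩ := (hγ i).exists_kernel_cross (hγ j) (hd hij)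
      refine ⟨k, hk, hkp, fun s hs ρ hρ hp t => ?_⟩
      have hm := mem_others (γ := γ) (fun h => hij h.symm : j ≠ i) t
      rw [((hN i s hs).2 ρ hρ hp).2.1 _ hm, ((hN i s hs).2 _ (hcj ρ hρ) (hcp ρ hp)).2.1 _ hm,
        if_neg hij, zero_add]
      exact h ρ hρ.continuous t
  choose k hk hkp hkN using hker
  obtain ⟨K, hKs, hKC, hKn, hKq⟩ := exists_matrix_operator hγ hd hk hkp
  obtain ⟨C, hC0, hsol⟩ := exists_solution (c := fun j => -(σ j : ℂ))
    (fun j => by rcases hσ j with h | h <;> simp [h]) K hKs hKC hKn (m + 4)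
  choose D hD0 hD using fun i => (hN i (σ i) (hσ i)).1
  set B : ℝ := ∑ k ∈ Finset.range (m + 1), ∑ i, D i k with hB
  have hB0 : 0 ≤ B := Finset.sum_nonneg fun k _ => Finset.sum_nonneg fun i _ => hD0 i k
  have hE : 0 < δ / (B * C + 1) := by positivity
  set E := δ / (B * C + 1) with hEdef
  have hfs : ∀ j, ContDiff ℝ ∞ fun t => conj (γ j t) := fun j =>
    conjCLE.contDiff.comp (hγ j).smooth
  have hfp : ∀ j, Function.Periodic (fun t => conj (γ j t)) (2 * Real.pi) := fun j t =>
    congrArg conj ((hγ j).periodic t)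
  obtain ⟨v, hv, hvE⟩ := exists_near_along hγ hd hfs hfp (m + 4) hE
  have hvs := fun j => smooth_periodic_of_mem_map_alongCurves hγ
    (w := alongCurves γ v) ⟨v, hv, rfl⟩ j
  obtain ⟨ρ, hρs, hρp, hρe, hρC⟩ := hsol (fun j t => conj (γ j t) - v (γ j t))
    (fun j => (hfs j).sub (hvs j).1) (fun j => (hfp j).sub (hvs j).2) E hE.le hvE
  obtain ⟨q, hq, hqK⟩ := hKq ρ
  have hρs' : ∀ j, ContDiff ℝ ∞ fun t => conj (ρ (j, t)) := fun j => conjCLE.contDiff.comp (hρs j)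
  have hρp' : ∀ j, Function.Periodic (fun t => conj (ρ (j, t))) (2 * Real.pi) := fun j t =>
    congrArg conj (hρp j t)
  have h1 := fun i => (hN i (σ i) (hσ i)).2 _ (hρs i) (hρp i)
  have h2 := fun i => (hN i (σ i) (hσ i)).2 _ (hρs' i) (hρp' i)
  have hdiff : ∀ V : Set ℂ, V ⊆ Ω → IsOpen V → ∀ (i : Fin n) (F : ℂ → ℂ) (τ : ℝ → ℂ),
      Continuous τ → (∀ z ∉ range (γ i),
        wind (γ i) z ≠ (1 + σ i) * (Real.pi * I) + dqWind (γ i) 0 → F z = cauchyInt (γ i) τ z) →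
        DifferentiableOn ℂ F V := by
    intro V hVΩ hV i F τ hτ h z hz
    have hnr : ∀ w ∈ V, w ∉ range (γ i) := fun w hw => disjoint_left.1 (hΩd i) (hVΩ hw)
    exact (((hγ i).differentiableAt_cauchyInt hτ (hnr z hz)).congr_of_eventuallyEq
      (Filter.eventually_of_mem (hV.mem_nhds hz) fun w hwV =>
        h w (hnr w hwV) (hw i w (hVΩ hwV)))).differentiableWithinAt
  refine ⟨fun z => ∑ i, N i (σ i) (fun t => conj (ρ (i, t))) z,
    fun z => ∑ i, N i (σ i) (fun t => ρ (i, t)) z, ContDiff.sum fun i _ => (h2 i).1,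
    ContDiff.sum fun i _ => (h1 i).1, fun V hVΩ hV => ⟨?_, ?_⟩, fun l hl z => ?_,
    v - q, Submodule.sub_mem _ hv hq, fun z hz => ?_⟩
  · exact DifferentiableOn.fun_sum fun i _ =>
      hdiff V hVΩ hV i _ _ (hρs' i).continuous (h2 i).2.2.1
  · exact DifferentiableOn.fun_sum fun i _ =>
      hdiff V hVΩ hV i _ _ (hρs i).continuous (h1 i).2.2.1
  · rw [iteratedFDeriv_fun_sum_apply fun i _ => (h2 i).1.contDiffAt_nat z l]
    have h3 : ∀ i, ‖iteratedFDeriv ℝ l (N i (σ i) fun t => conj (ρ (i, t))) z‖ ≤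
        D i l * (C * E) := fun i => hD i l _ (hρs' i) (hρp' i) (C * E) (fun l' hl' t => by
          rw [norm_iteratedDeriv_conj]
          exact hρC i l' (by omega) t) z
    have h4 : ∑ i, D i l ≤ B := Finset.single_le_sum (f := fun l => ∑ i, D i l)
      (fun k _ => Finset.sum_nonneg fun i _ => hD0 i k) (Finset.mem_range.2 (by omega))
    refine (norm_sum_le _ _).trans ((Finset.sum_le_sum fun i _ => h3 i).trans ?_)
    rw [← Finset.sum_mul]
    refine (mul_le_mul_of_nonneg_right h4 (by positivity)).trans ?_
    rw [hEdef, ← mul_assoc, mul_div_assoc', div_le_iff₀ (by positivity), mul_comm δ]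
    exact mul_le_mul_of_nonneg_right (by linarith) hδ.le
  · obtain ⟨j, t, rfl⟩ := mem_iUnion.1 hz
    have h3 : ∀ i, N i (σ i) (fun t => ρ (i, t)) (γ j t) +
        conj (N i (σ i) (fun t => conj (ρ (i, t))) (γ j t)) =
          (if i = j then -(σ i : ℂ) * ρ (i, t) else 0) +
            ∫ u in (0 : ℝ)..2 * Real.pi, k i j (t, u) * ρ (i, u) := fun i =>
      hkN i j (σ i) (hσ i) _ (hρs i) (hρp i) t
    rw [map_sum, ← Finset.sum_add_distrib, Finset.sum_congr rfl fun i _ => h3 i,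
      Finset.sum_add_distrib, hqK j t, Finset.sum_ite_eq' Finset.univ j, if_pos (Finset.mem_univ j)]
    have h4 := hρe j t
    simp only [Pi.sub_apply]
    linear_combination -h4

end

/-- every smoothly bounded domain admits, for each `m` and `δ > 0`, a
holomorphic map `g`, smooth and injective on the closure and `(m, δ)`-close to the identity,
such that `g(Ω)` is a quadrature domain. -/
theorem stmt_11 (Ω : Set ℂ) (hΩo : IsOpen Ω) (hΩc : IsConnected Ω)
    (hsm : HasSmoothBoundary Ω) (m : ℕ) (δ : ℝ) (hδ : 0 < δ) :
    ∃ g : ℂ → ℂ,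
      (∃ U : Set ℂ, IsOpen U ∧ closure Ω ⊆ U ∧ ContDiffOn ℝ (⊤ : ℕ∞) g U) ∧
      DifferentiableOn ℂ g Ω ∧ InjOn g (closure Ω) ∧ CloseToId Ω m δ g ∧
      IsQuadratureDomain (g '' Ω) := by
  obtain ⟨hb, n, γ, hγs, hγp, hγi, hγd, hd, hfr⟩ := hsm
  have hγ : ∀ i, SmoothJordan (γ i) := fun i => ⟨hγs i, hγp i, hγi i, hγd i⟩
  obtain ⟨z₀, hz₀⟩ := hΩc.nonempty
  have hΩf : Disjoint Ω (frontier Ω) := (disjoint_frontier_iff_isOpen.2 hΩo).symm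
  have hΩd : ∀ i, Disjoint Ω (range (γ i)) := fun i =>
    hΩf.mono_right (hfr ▸ subset_iUnion (fun i => range (γ i)) i)
  have hσex : ∀ i, ∃ s : ℝ, (s = 1 ∨ s = -1) ∧
      ∀ z ∈ Ω, wind (γ i) z ≠ (1 + s) * (Real.pi * I) + dqWind (γ i) 0 := by
    intro i
    have hconst : ∀ z ∈ Ω, wind (γ i) z = wind (γ i) z₀ := fun z hz =>
      (hγ i).wind_eq_of_isPreconnected hΩc.isPreconnected (hΩd i) hz hz₀
    by_cases h : wind (γ i) z₀ = (1 + (-1 : ℝ)) * (Real.pi * I) + dqWind (γ i) 0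
    · refine ⟨1, Or.inl rfl, fun z hz h' => ?_⟩
      rw [hconst z hz, h] at h'
      have h2 : (2 : ℂ) * (Real.pi * I) = 0 := by
        push_cast at h'
        linear_combination -h'
      simp [Real.pi_ne_zero] at h2
    · exact ⟨-1, Or.inr rfl, fun z hz => (hconst z hz).symm ▸ h⟩
  choose σ hσ hσw using hσex
  obtain ⟨G, M, hG, hM, hGM, hGs, R, hR, hRe⟩ := exists_conj_decomposition hγ hd hΩd hσ hσw
    (max m 1) (lt_min hδ (by norm_num : (0 : ℝ) < 1 / 2))
  obtain ⟨hGΩ, hMΩ⟩ := hGM Ω subset_rfl hΩo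
  obtain ⟨s, c, hs, hRs⟩ := exists_sum_of_mem_fracSpan hR
  have hinj : Function.Injective fun z => z - G z := by
    refine injective_id_sub (hG.differentiable (by simp)) fun z => ?_
    have h1 := hGs 1 (le_max_right _ _) z
    rw [← norm_iteratedFDeriv_one]
    exact h1.trans (min_le_right _ _)
  have hgs : ContDiff ℝ ∞ fun z => z - G z := contDiff_id.sub hG
  have hgΩ : DifferentiableOn ℂ (fun z => z - G z) Ω := differentiableOn_id.sub hGΩ
  refine ⟨fun z => z - G z, ⟨univ, isOpen_univ, subset_univ _, hgs.contDiffOn⟩, hgΩ,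
    hinj.injOn, fun k hk z _ => ?_, ?_⟩
  · simp only [sub_sub_cancel_left]
    rw [show (fun w => -G w) = -G from rfl, iteratedFDeriv_neg_apply, norm_neg]
    exact (hGs k (hk.trans (le_max_left _ _)) z).trans (min_le_left _ _)
  · refine isQuadratureDomain_of_frontier hΩo hb hΩc.nonempty (hgs.of_le (by simp))
      (hM.of_le (by simp)) hgΩ hMΩ hinj.injOn s (fun w hw => hfr ▸ hs w hw) c fun z hz => ?_
    rw [map_sub, hRe z (hfr ▸ hz), hRs]
    ring
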